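/- Let G be a finitely generated torsion group with a distinguished finite generating set, let T(n) = max(n, T_G(n)), and suppose there exists a total computable superexponential function ζ : ℕ → ℕ such that WP(G) is (ζ∘ζ∘T∘ζ∘T∘ζ)-impredictable. Then S(G × ℤ, 3) ⊊ S(G × ℤ, 4), where G × ℤ is given the generating set consisting of the generators of G (paired with 0) together with (e_G, 1). -/

import Mathlib

open Classical in
/-- Characteristic sequence of a set of naturals. -/
noncomputable def charSeq (A : Set ℕ) : ℕ → Bool := fun i => decide (i ∈ A)

/-- The length-`m` prefix of the characteristic sequence of `A`. -/
noncomputable def charPrefix (A : Set ℕ) (m : ℕ) : List Bool :=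
  (List.range m).map (charSeq A)

/-- `A` is Σ⁰₁ (recursively enumerable). -/
def IsSigma01 (A : Set ℕ) : Prop :=
  ∃ f : ℕ →. ℕ, Partrec f ∧ ∀ n, n ∈ A ↔ (f n).Dom

/-- `A` many-one reduces to `B`. -/
def ManyOneRed (A B : Set ℕ) : Prop :=
  ∃ f : ℕ → ℕ, Computable f ∧ ∀ n, n ∈ A ↔ f n ∈ B

/-- `A` is `φ`-impredictable with witness `ψ`. -/
def ImpredictableWith (φ : ℕ → ℕ) (A : Set ℕ) (ψ : ℕ → ℕ) : Prop :=
  ∀ χ : ℕ × List Bool →. ℕ, Partrec χ →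
    ∀ N : ℕ, ∃ p : ℕ, N ≤ p ∧ (ψ p ∈ A ↔ (χ (p, charPrefix A (φ p))).Dom)

/-- `A` is `φ`-impredictable. -/
def Impredictable (φ : ℕ → ℕ) (A : Set ℕ) : Prop :=
  ∃ ψ : ℕ → ℕ, Computable ψ ∧ ImpredictableWith φ A ψ

/-- Bitwise comparison of binary strings of equal length. -/
def bitLE (u v : List Bool) : Prop := List.Forall₂ (· ≤ ·) u v

/-- `B` wtt-reduces to `A` with rate `β`. -/
def WttRedRate (B A : Set ℕ) (β : ℕ → ℕ) : Prop :=
  Computable β ∧ Monotone β ∧ Filter.Tendsto β Filter.atTop Filter.atTop ∧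
  ∃ g : List Bool →. List Bool, Partrec g ∧
    ∀ m : ℕ, ∃ out : List Bool, out ∈ g (charPrefix A m) ∧
      out = charPrefix B out.length ∧ β m ≤ out.length

/-- `B` conjunctively reduces to `A` with rate `β`. -/
def ConjRedRate (B A : Set ℕ) (β : ℕ → ℕ) : Prop :=
  Computable β ∧ Monotone β ∧ Filter.Tendsto β Filter.atTop Filter.atTop ∧
  ∃ g : List Bool → List Bool, Computable g ∧
    (∀ w : List Bool, (g w).length = β w.length) ∧
    (∀ u v : List Bool, bitLE u v → bitLE (g u) (g v)) ∧
    (∀ m : ℕ, g (charPrefix A m) = charPrefix B (β m)) ∧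
    ∃ w : ℕ → ℕ → List Bool, Computable₂ w ∧ (∀ i m, (w i m).length = m) ∧
      ∀ (u v : List Bool) (i : ℕ), u.length = v.length →
        (bitLE (w i u.length) u ↔ bitLE (w i u.length) v) →
        (g u).getD i false = (g v).getD i false

/-- Evaluation of a word over the generators (`true` = generator, `false` = inverse). -/
def evalWord {K : Type*} [Group K] {m : ℕ} (gen : Fin m → K) (w : List (Fin m × Bool)) : K :=
  (w.map fun l => if l.2 then gen l.1 else (gen l.1)⁻¹).prod

/-- Index of a word in the length-then-lexicographic enumeration of all words
(bijective base-`2m` numeration). -/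
def wordCode {m : ℕ} (w : List (Fin m × Bool)) : ℕ :=
  w.foldl (fun acc l => acc * (2 * m) + (2 * l.1.val + (if l.2 then 1 else 0) + 1)) 0

/-- The word problem of a group with distinguished generators. -/
def WordProblem {K : Type*} [Group K] {m : ℕ} (gen : Fin m → K) : Set ℕ :=
  { n | ∃ w : List (Fin m × Bool), wordCode w = n ∧ evalWord gen w = 1 }

/-- Word norm with respect to the distinguished generators. -/
noncomputable def wordNorm {K : Type*} [Group K] {m : ℕ} (gen : Fin m → K) (g : K) : ℕ :=
  sInf { ℓ | ∃ w : List (Fin m × Bool), w.length = ℓ ∧ evalWord gen w = g }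

/-- The torsion function of a group with distinguished generators. -/
noncomputable def torsionFn {K : Type*} [Group K] {m : ℕ} (gen : Fin m → K) (n : ℕ) : ℕ :=
  sSup { k | ∃ g : K, wordNorm gen g ≤ n ∧ orderOf g = k }

/-- Shift action on configurations. -/
def shiftC {G : Type*} [Group G] {α : Type*} (g : G) (x : G → α) : G → α :=
  fun k => x (g⁻¹ * k)

/-- A head configuration: a configuration with at most one non-`none` coordinate
(`none` plays the role of the symbol `0`). -/
def HeadOK {G : Type*} {q : ℕ} (y : G → Option (Fin q)) : Prop :=
  ∀ a b : G, y a ≠ none → y b ≠ none → a = b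

/-- The space `Y = ∏ᵢ X¹_{Qᵢ}` of head configurations of a `k`-headed automaton. -/
def YS (G : Type*) [Group G] (k : ℕ) (q : Fin k → ℕ) : Type _ :=
  { y : ∀ i : Fin k, G → Option (Fin (q i)) // ∀ i, HeadOK (y i) }

/-- Diagonal shift action on head configurations. -/
def yshift {G : Type*} [Group G] {k : ℕ} {q : Fin k → ℕ} (g : G) (y : YS G k q) :
    YS G k q :=
  ⟨fun i => shiftC g (y.1 i), fun i a b ha hb => mul_left_cancel (y.2 i _ _ ha hb)⟩

/-- Product topology where each factor is discrete (prodiscrete topology). -/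
def piBot (ι α : Type*) : TopologicalSpace (ι → α) :=
  @Pi.topologicalSpace ι (fun _ => α) (fun _ => ⊥)

/-- The topology on the space of head configurations. -/
def ysTop (G : Type*) [Group G] (k : ℕ) (q : Fin k → ℕ) : TopologicalSpace (YS G k q) :=
  TopologicalSpace.induced Subtype.val
    (@Pi.topologicalSpace (Fin k) (fun i => G → Option (Fin (q i)))
      (fun i => piBot G (Option (Fin (q i)))))

/-- A `k`-headed group-walking automaton on the full shift `(Fin s)^G`. -/
structure GWA (G : Type*) [Group G] (s k : ℕ) where
  /-- numbers of states of the heads -/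
  q : Fin k → ℕ
  /-- the transition cellular automaton -/
  f : (G → Fin s) × YS G k q → (G → Fin s) × YS G k q
  cont : @Continuous _ _
      (@instTopologicalSpaceProd _ _ (piBot G (Fin s)) (ysTop G k q))
      (@instTopologicalSpaceProd _ _ (piBot G (Fin s)) (ysTop G k q)) f
  fst_eq : ∀ p, (f p).1 = p.1
  equivar : ∀ (g : G) (p : (G → Fin s) × YS G k q),
      f (shiftC g p.1, yshift g p.2) = (shiftC g (f p).1, yshift g (f p).2)
  vanish : ∀ (p : (G → Fin s) × YS G k q) (i : Fin k),
      ((f p).2.1 i = fun _ => none) ↔ (p.2.1 i = fun _ => none)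
  /-- the initial clopen set -/
  Ini : Set (YS G k q)
  /-- the final (rejecting) clopen set -/
  Fini : Set (YS G k q)
  clopen_Ini : @IsClopen _ (ysTop G k q) Ini
  clopen_Fini : @IsClopen _ (ysTop G k q) Fini

/-- The subshift `S(A)` defined by a group-walking automaton `A`. -/
def autSet {G : Type*} [Group G] {s k : ℕ} (aut : GWA G s k) : Set (G → Fin s) :=
  { x | ∀ (g h : G) (y : YS G k aut.q) (n : ℕ), y ∈ aut.Ini →
      yshift h ((aut.f^[n] (shiftC g x, y)).2) ∉ aut.Fini }

/-- Membership in the class `S(G,k)` of subshifts defined by `k`-headed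
group-walking automata, for alphabet `Fin s`. -/
def InS (G : Type*) [Group G] (k s : ℕ) (X : Set (G → Fin s)) : Prop :=
  ∃ aut : GWA G s k, X = autSet aut

/-- `S(G,k₁) ⊊ S(G,k₂)`. -/
def headsLT (G : Type*) [Group G] (k₁ k₂ : ℕ) : Prop :=
  (∀ (s : ℕ) (X : Set (G → Fin s)), InS G k₁ s X → InS G k₂ s X) ∧
  ∃ (s : ℕ) (X : Set (G → Fin s)), InS G k₂ s X ∧ ¬ InS G k₁ s X



namespace FH
set_option linter.unusedSectionVars false
set_option linter.unusedVariables false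

section topo
variable {H : Type*} [Group H] {s k : ℕ} {q : Fin k → ℕ}

/-- Two (configuration, head configuration) pairs agree on a finite window. -/
def Agree (W : Finset H) (p p' : (H → Fin s) × YS H k q) : Prop :=
  ∀ w ∈ W, p.1 w = p'.1 w ∧ ∀ i, p.2.1 i w = p'.2.1 i w

theorem Agree.symm {W : Finset H} {p p' : (H → Fin s) × YS H k q} (h : Agree W p p') :
    Agree W p' p := fun w hw => ⟨(h w hw).1.symm, fun i => ((h w hw).2 i).symm⟩

theorem Agree.trans {W : Finset H} {p p' p'' : (H → Fin s) × YS H k q} (h : Agree W p p')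
    (h' : Agree W p' p'') : Agree W p p'' :=
  fun w hw => ⟨(h w hw).1.trans (h' w hw).1, fun i => ((h w hw).2 i).trans ((h' w hw).2 i)⟩

theorem Agree.mono {W W' : Finset H} (hW : W ⊆ W') {p p' : (H → Fin s) × YS H k q}
    (h : Agree W' p p') : Agree W p p' := fun w hw => h w (hW hw)

/-- Product topology on pairs. -/
abbrev pTop (H : Type*) [Group H] (s k : ℕ) (q : Fin k → ℕ) :
    TopologicalSpace ((H → Fin s) × YS H k q) :=
  @instTopologicalSpaceProd _ _ (piBot H (Fin s)) (ysTop H k q)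

theorem cont_evalX (w : H) : @Continuous _ _ (piBot H (Fin s)) ⊥ (fun x : H → Fin s => x w) :=
  @continuous_apply H (fun _ => Fin s) (fun _ => ⊥) w

theorem cont_evalY (i : Fin k) (w : H) :
    @Continuous _ _ (ysTop H k q) ⊥ (fun y : YS H k q => y.1 i w) := by
  have h1 : @Continuous _ _ (ysTop H k q) (@Pi.topologicalSpace (Fin k)
      (fun i => H → Option (Fin (q i))) (fun i => piBot H (Option (Fin (q i)))))
      (Subtype.val : YS H k q → _) := continuous_induced_dom
  have h2 := @continuous_apply (Fin k) (fun i => H → Option (Fin (q i)))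
    (fun i => piBot H (Option (Fin (q i)))) i
  have h3 := @continuous_apply H (fun _ => Option (Fin (q i))) (fun _ => ⊥) w
  exact @Continuous.comp _ _ _ (_) (_) (⊥) _ _ h3 (@Continuous.comp _ _ _ (_) (_) (_) _ _ h2 h1)

theorem mem_nhds_X {x : H → Fin s} {u : Set (H → Fin s)}
    (hu : u ∈ @nhds _ (piBot H (Fin s)) x) :
    ∃ W : Finset H, ∀ x', (∀ w ∈ W, x w = x' w) → x' ∈ u := by
  rw [piBot, @nhds_pi H (fun _ => Fin s) (fun _ => ⊥) x, Filter.mem_pi] at hu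
  obtain ⟨I, hI, t, ht, hsub⟩ := hu
  refine ⟨hI.toFinset, fun x' hx' => hsub ?_⟩
  intro w hw
  rw [← hx' w (hI.mem_toFinset.2 hw)]
  exact @mem_of_mem_nhds _ ⊥ _ _ (ht w)

theorem mem_nhds_piBot {α : Type*} {x : H → α} {u : Set (H → α)}
    (hu : u ∈ @nhds _ (piBot H α) x) :
    ∃ W : Finset H, ∀ x', (∀ w ∈ W, x w = x' w) → x' ∈ u := by
  rw [piBot, @nhds_pi H (fun _ => α) (fun _ => ⊥) x, Filter.mem_pi] at hu
  obtain ⟨I, hI, t, ht, hsub⟩ := hu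
  refine ⟨hI.toFinset, fun x' hx' => hsub ?_⟩
  intro w hw
  rw [← hx' w (hI.mem_toFinset.2 hw)]
  exact @mem_of_mem_nhds _ ⊥ _ _ (ht w)

theorem mem_nhds_Y {y : YS H k q} {u : Set (YS H k q)}
    (hu : u ∈ @nhds _ (ysTop H k q) y) :
    ∃ W : Finset H, ∀ y' : YS H k q, (∀ w ∈ W, ∀ i, y.1 i w = y'.1 i w) → y' ∈ u := by
  classical
  rw [ysTop, @nhds_induced _ _ (_) _ y, Filter.mem_comap] at hu
  obtain ⟨v, hv, hvu⟩ := hu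
  rw [@nhds_pi (Fin k) (fun i => H → Option (Fin (q i)))
    (fun i => piBot H (Option (Fin (q i)))), Filter.mem_pi] at hv
  obtain ⟨I, hI, t, ht, hsub⟩ := hv
  choose W hW using fun i => mem_nhds_piBot (ht i)
  refine ⟨Finset.univ.biUnion W, fun y' hy' => hvu (hsub ?_)⟩
  intro i _
  exact hW i _ fun w hw => hy' w (Finset.mem_biUnion.2 ⟨i, Finset.mem_univ i, hw⟩) i

theorem isOpen_cyl (W : Finset H) (p : (H → Fin s) × YS H k q) :
    @IsOpen _ (pTop H s k q) {p' | Agree W p p'} := by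
  classical
  let := pTop H s k q
  have : {p' | Agree W p p'} = ⋂ w ∈ W, ({p' : (H → Fin s) × YS H k q | p.1 w = p'.1 w} ∩
      ⋂ i, {p' : (H → Fin s) × YS H k q | p.2.1 i w = p'.2.1 i w}) := by
    ext p'; simp [Agree]
  rw [this]
  refine isOpen_biInter_finset fun w _ => IsOpen.inter ?_ (isOpen_iInter_of_finite fun i => ?_)
  · have h : @Continuous _ _ (pTop H s k q) ⊥ (fun p' : (H → Fin s) × YS H k q => p'.1 w) :=
      @Continuous.comp _ _ _ (_) (_) (⊥) _ _ (cont_evalX w)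
        (@continuous_fst _ _ (piBot H (Fin s)) (ysTop H k q))
    exact @IsOpen.preimage _ _ (_) (⊥) _ h {a | p.1 w = a} trivial
  · have h : @Continuous _ _ (pTop H s k q) ⊥ (fun p' : (H → Fin s) × YS H k q => p'.2.1 i w) :=
      @Continuous.comp _ _ _ (_) (_) (⊥) _ _ (cont_evalY i w)
        (@continuous_snd _ _ (piBot H (Fin s)) (ysTop H k q))
    exact @IsOpen.preimage _ _ (_) (⊥) _ h {a | p.2.1 i w = a} trivial

theorem cyl_of_nhds {p : (H → Fin s) × YS H k q} {u : Set ((H → Fin s) × YS H k q)}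
    (hu : u ∈ @nhds _ (pTop H s k q) p) : ∃ W : Finset H, ∀ p', Agree W p p' → p' ∈ u := by
  classical
  obtain ⟨v, hv, v', hv', hsub⟩ :=
    (@mem_nhds_prod_iff _ _ (piBot H (Fin s)) (ysTop H k q) p.1 p.2 u).1 hu
  obtain ⟨W, hW⟩ := mem_nhds_X hv
  obtain ⟨W', hW'⟩ := mem_nhds_Y hv'
  refine ⟨W ∪ W', fun p' h => hsub ⟨hW _ fun w hw => ?_, hW' _ fun w hw => ?_⟩⟩
  · exact (h w (Finset.mem_union_left _ hw)).1
  · exact (h w (Finset.mem_union_right _ hw)).2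

theorem cont_bot_iff {α : Type*} (Φ : (H → Fin s) × YS H k q → α) :
    @Continuous _ _ (pTop H s k q) ⊥ Φ ↔
      ∀ p, ∃ W : Finset H, ∀ p', Agree W p p' → Φ p' = Φ p := by
  constructor
  · intro h p
    have hu : Φ ⁻¹' {Φ p} ∈ @nhds _ (pTop H s k q) p :=
      @IsOpen.mem_nhds _ (pTop H s k q) _ _ (@IsOpen.preimage _ _ (_) (⊥) _ h _ trivial) rfl
    obtain ⟨W, hW⟩ := cyl_of_nhds hu
    exact ⟨W, fun p' h' => hW p' h'⟩
  · intro h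
    refine @Continuous.mk _ _ (_) (⊥) _ fun S _ => ?_
    refine (@isOpen_iff_mem_nhds _ (pTop H s k q) _).2 fun p hp => ?_
    obtain ⟨W, hW⟩ := h p
    refine @Filter.mem_of_superset _ _ {p' | Agree W p p'} _
      (@IsOpen.mem_nhds _ (pTop H s k q) _ _ (isOpen_cyl W p) (fun w _ => ⟨rfl, fun i => rfl⟩)) ?_
    intro p' hp'
    show Φ p' ∈ S
    rw [hW p' hp']; exact hp

theorem compactX : @CompactSpace (H → Fin s) (piBot H (Fin s)) := by
  let : ∀ _ : H, TopologicalSpace (Fin s) := fun _ => ⊥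
  exact @Pi.compactSpace H (fun _ => Fin s) (fun _ => ⊥) (fun _ => @Finite.compactSpace _ (⊥) _)

theorem compactY : @CompactSpace (YS H k q) (ysTop H k q) := by
  let : ∀ i, TopologicalSpace (H → Option (Fin (q i))) := fun i => piBot H (Option (Fin (q i)))
  have hc : ∀ i, CompactSpace (H → Option (Fin (q i))) := fun i =>
    @Pi.compactSpace H (fun _ => Option (Fin (q i))) (fun _ => ⊥)
      (fun _ => @Finite.compactSpace _ (⊥) _)
  have hclosed : IsClosed {y : ∀ i : Fin k, H → Option (Fin (q i)) | ∀ i, HeadOK (y i)} := by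
    have : {y : ∀ i : Fin k, H → Option (Fin (q i)) | ∀ i, HeadOK (y i)} =
        ⋂ i, ⋂ a : H, ⋂ b : H, ⋂ _ : a ≠ b,
          ({y : ∀ i : Fin k, H → Option (Fin (q i)) | y i a = none} ∪ {y | y i b = none}) := by
      ext y
      simp only [Set.mem_ofPred_eq, Set.mem_iInter, HeadOK, Set.mem_union]
      refine forall_congr' fun i => forall_congr' fun a => forall_congr' fun b => ?_
      tauto
    rw [this]
    have key : ∀ i (a : H), IsClosed {y : ∀ i : Fin k, H → Option (Fin (q i)) | y i a = none} := by
      intro i a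
      have h2 := @continuous_apply (Fin k) (fun i => H → Option (Fin (q i))) _ i
      have h3 := @continuous_apply H (fun _ => Option (Fin (q i))) (fun _ => ⊥) a
      have h4 := @Continuous.comp _ _ _ (_) (_) (⊥) _ _ h3 h2
      exact @IsClosed.preimage _ _ (_) (⊥) _ h4 {none} (@IsClosed.mk _ (⊥) _ trivial)
    exact isClosed_iInter fun i => isClosed_iInter fun a => isClosed_iInter fun b =>
      isClosed_iInter fun _ => (key i a).union (key i b)
  exact isCompact_iff_compactSpace.1 hclosed.isCompact

theorem uniform_window {α : Type*} (Φ : (H → Fin s) × YS H k q → α)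
    (h : ∀ p, ∃ W : Finset H, ∀ p', Agree W p p' → Φ p' = Φ p) :
    ∃ W : Finset H, ∀ p p', Agree W p p' → Φ p' = Φ p := by
  classical
  choose W hW using h
  have hc : @CompactSpace _ (pTop H s k q) :=
    @instCompactSpaceProd _ _ (piBot H (Fin s)) (ysTop H k q) compactX compactY
  obtain ⟨t, ht⟩ := @IsCompact.elim_finite_subcover _ (pTop H s k q) Set.univ _
    (@isCompact_univ _ (_) hc) (fun p => {p' | Agree (W p) p p'}) (fun p => isOpen_cyl _ _)
    (fun p _ => Set.mem_iUnion.2 ⟨p, fun w _ => ⟨rfl, fun i => rfl⟩⟩)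
  refine ⟨t.biUnion W, fun p p' hpp => ?_⟩
  have := ht (Set.mem_univ p)
  simp only [Set.mem_iUnion] at this
  obtain ⟨p0, hp0, hag⟩ := this
  rw [hW p0 p hag, hW p0 p' (hag.trans (hpp.mono (Finset.subset_biUnion_of_mem W hp0)))]

theorem clopen_window (I : Set (YS H k q)) (hI : @IsClopen _ (ysTop H k q) I) :
    ∃ W : Finset H, ∀ y y' : YS H k q, (∀ w ∈ W, ∀ i, y.1 i w = y'.1 i w) → (y ∈ I ↔ y' ∈ I) := by
  have hloc : ∀ p : (H → Fin 1) × YS H k q, ∃ W : Finset H, ∀ p', Agree W p p' →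
      (p'.2 ∈ I) = (p.2 ∈ I) := by
    intro p
    by_cases hp : p.2 ∈ I
    · obtain ⟨W, hW⟩ := mem_nhds_Y (@IsOpen.mem_nhds _ (ysTop H k q) _ _ hI.2 hp)
      exact ⟨W, fun p' h => by simp [hp, hW p'.2 (fun w hw => (h w hw).2)]⟩
    · obtain ⟨W, hW⟩ := mem_nhds_Y (@IsOpen.mem_nhds _ (ysTop H k q) _ _ hI.1.1 hp)
      refine ⟨W, fun p' h => ?_⟩
      have := hW p'.2 (fun w hw => (h w hw).2)
      simp only [hp, eq_iff_iff, iff_false]; exact this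
  obtain ⟨W, hW⟩ := uniform_window _ hloc
  refine ⟨W, fun y y' h => ?_⟩
  have := hW (fun _ => 0, y) (fun _ => 0, y') (fun w hw => ⟨rfl, h w hw⟩)
  exact (iff_of_eq this).symm

theorem clopen_of_window (I : Set (YS H k q)) (W : Finset H)
    (h : ∀ y y' : YS H k q, (∀ w ∈ W, ∀ i, y.1 i w = y'.1 i w) → (y ∈ I ↔ y' ∈ I)) :
    @IsClopen _ (ysTop H k q) I := by
  classical
  have key : ∀ J : Set (YS H k q), (∀ y y' : YS H k q, (∀ w ∈ W, ∀ i, y.1 i w = y'.1 i w) →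
      (y ∈ J ↔ y' ∈ J)) → @IsOpen _ (ysTop H k q) J := by
    intro J hJ
    refine (@isOpen_iff_mem_nhds _ (ysTop H k q) _).2 fun y hy => ?_
    let := ysTop H k q
    have hopen : IsOpen (⋂ w ∈ W, ⋂ i, {y' : YS H k q | y.1 i w = y'.1 i w}) := by
      refine isOpen_biInter_finset fun w _ => isOpen_iInter_of_finite fun i => ?_
      exact @IsOpen.preimage _ _ (_) (⊥) _ (cont_evalY i w) {a | y.1 i w = a} trivial
    refine Filter.mem_of_superset (hopen.mem_nhds ?_) ?_
    · simp
    · intro y' hy'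
      simp only [Set.mem_iInter, Set.mem_ofPred_eq] at hy'
      exact (hJ y y' hy').1 hy
  refine ⟨@IsClosed.mk _ (_) _ (key _ fun y y' hyy => not_congr (h y y' hyy)), key _ h⟩

theorem cont_of_coords (f : (H → Fin s) × YS H k q → (H → Fin s) × YS H k q)
    (hf : ∀ p, (f p).1 = p.1)
    (h : ∀ i (g : H) p, ∃ W : Finset H, ∀ p', Agree W p p' → (f p').2.1 i g = (f p).2.1 i g) :
    @Continuous _ _ (pTop H s k q) (pTop H s k q) f := by
  refine (@continuous_prodMk _ _ _ (pTop H s k q) (piBot H (Fin s)) (ysTop H k q) (fun p => (f p).1)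
    (fun p => (f p).2)).2 ⟨?_, ?_⟩
  · have : (fun p => (f p).1) = fun p : (H → Fin s) × YS H k q => p.1 := funext hf
    rw [this]
    exact @continuous_fst _ _ (piBot H (Fin s)) (ysTop H k q)
  · refine (@continuous_induced_rng _ _ _ (_) _ _ (_)).2 ?_
    refine @continuous_pi _ _ (fun i => H → Option (Fin (q i))) (_)
      (fun i => piBot H (Option (Fin (q i)))) _ fun i => ?_
    refine @continuous_pi _ _ (fun _ => Option (Fin (q i))) (_) (fun _ => ⊥) _ fun g => ?_
    exact (cont_bot_iff _).2 (h i g)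

theorem coords_of_cont (f : (H → Fin s) × YS H k q → (H → Fin s) × YS H k q)
    (hf : @Continuous _ _ (pTop H s k q) (pTop H s k q) f) (i : Fin k) (g : H) :
    ∃ W : Finset H, ∀ p p', Agree W p p' → (f p').2.1 i g = (f p).2.1 i g := by
  refine uniform_window (fun p => (f p).2.1 i g) ((cont_bot_iff _).1 ?_)
  exact @Continuous.comp _ _ _ (_) (_) (⊥) _ _ (cont_evalY i g)
    (@Continuous.comp _ _ _ (_) (pTop H s k q) (_) _ _
      (@continuous_snd _ _ (piBot H (Fin s)) (ysTop H k q)) hf)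

end topo

end FH


namespace FH
section incl
variable {H : Type*} [Group H] {s k : ℕ} {q : Fin k → ℕ}

/-- state numbers with an additional dummy head -/
def qx (q : Fin k → ℕ) : Fin (k + 1) → ℕ := Fin.cons 0 q

def dropY (y : YS H (k + 1) (qx q)) : YS H k q :=
  ⟨fun i => y.1 i.succ, fun i => y.2 i.succ⟩

def liftY (y : YS H k q) : YS H (k + 1) (qx q) :=
  ⟨fun i => Fin.cases (motive := fun i => H → Option (Fin (qx q i))) (fun _ => none) y.1 i,
    fun i => by
      refine Fin.cases ?_ (fun i => ?_) i
      · intro a b ha; exact absurd rfl ha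
      · exact y.2 i⟩

theorem drop_lift (y : YS H k q) : dropY (liftY y) = y := rfl

theorem lift_drop (y : YS H (k + 1) (qx q)) : liftY (dropY y) = y := by
  apply Subtype.ext
  funext i
  refine Fin.cases ?_ (fun i => rfl) i
  funext g
  cases hy : y.1 0 g with
  | none => rfl
  | some a => exact Fin.elim0 a

theorem drop_shift (g : H) (y : YS H (k + 1) (qx q)) : dropY (yshift g y) = yshift g (dropY y) :=
  rfl

theorem lift_shift (g : H) (y : YS H k q) : liftY (yshift g y) = yshift g (liftY y) := by
  rw [← lift_drop (yshift g (liftY y))]; rfl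

/-- add a dummy head -/
def addHead (aut : GWA H s k) : GWA H s (k + 1) where
  q := qx aut.q
  f p := (p.1, liftY (aut.f (p.1, dropY p.2)).2)
  cont := by
    refine cont_of_coords _ (fun p => rfl) fun i g p => ?_
    refine Fin.cases ?_ (fun i => ?_) i
    · exact ⟨∅, fun p' _ => rfl⟩
    · obtain ⟨W, hW⟩ := coords_of_cont aut.f aut.cont i g
      refine ⟨W, fun p' hp' => ?_⟩
      exact hW (p.1, dropY p.2) (p'.1, dropY p'.2)
        (fun w hw => ⟨(hp' w hw).1, fun i => (hp' w hw).2 i.succ⟩)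
  fst_eq p := rfl
  equivar g p := by
    have := aut.equivar g (p.1, dropY p.2)
    simp only [drop_shift, ← lift_shift]
    rw [this]
  vanish p i := by
    refine Fin.cases ?_ (fun i => ?_) i
    · refine iff_of_true rfl ?_
      rw [← lift_drop p.2]; rfl
    · exact aut.vanish (p.1, dropY p.2) i
  Ini := dropY ⁻¹' aut.Ini
  Fini := dropY ⁻¹' aut.Fini
  clopen_Ini := by
    obtain ⟨W, hW⟩ := clopen_window _ aut.clopen_Ini
    exact clopen_of_window _ W fun y y' h => hW _ _ fun w hw i => h w hw i.succ
  clopen_Fini := by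
    obtain ⟨W, hW⟩ := clopen_window _ aut.clopen_Fini
    exact clopen_of_window _ W fun y y' h => hW _ _ fun w hw i => h w hw i.succ

theorem addHead_iter (aut : GWA H s k) (n : ℕ) (x : H → Fin s) (y : YS H k aut.q) :
    (addHead aut).f^[n] (x, liftY y) =
      ((aut.f^[n] (x, y)).1, liftY (aut.f^[n] (x, y)).2) := by
  induction n with
  | zero => rfl
  | succ n ih =>
    rw [Function.iterate_succ_apply', Function.iterate_succ_apply', ih]
    show (_, _) = _
    simp only [drop_lift]
    rw [aut.fst_eq]

theorem addHead_set (aut : GWA H s k) : autSet (addHead aut) = autSet aut := by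
  ext x
  constructor
  · intro h g e y n hy hF
    refine h g e (liftY y) n hy ?_
    rw [addHead_iter]
    exact hF
  · intro h g e y n hy hF
    refine h g e (dropY y) n hy ?_
    rw [← lift_drop y] at hF
    rw [addHead_iter] at hF
    exact hF

theorem incl (H : Type*) [Group H] (k s : ℕ) (X : Set (H → Fin s)) (h : InS H k s X) :
    InS H (k + 1) s X := by
  obtain ⟨aut, rfl⟩ := h
  exact ⟨addHead aut, (addHead_set aut).symm⟩

end incl
end FH


namespace FH
section conf
variable {H : Type*} [Group H] {s k : ℕ} {q : Fin k → ℕ}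

/-- head configurations as lists of positions -/
abbrev Conf (H : Type*) {k : ℕ} (q : Fin k → ℕ) := ∀ i : Fin k, Option (H × Fin (q i))

open Classical in
noncomputable def ofC (c : Conf H q) : YS H k q :=
  ⟨fun i g => (c i).bind fun p => if p.1 = g then some p.2 else none, by
    intro i a b ha hb
    cases h : c i with
    | none => simp [h] at ha
    | some p =>
      simp [h] at ha hb
      rw [← ha, ← hb]⟩

theorem ofC_some {c : Conf H q} {i : Fin k} {g : H} {a : Fin (q i)} :
    (ofC c).1 i g = some a ↔ c i = some (g, a) := by
  cases h : c i with
  | none => simp [ofC, h]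
  | some p =>
    obtain ⟨g', a'⟩ := p
    simp [ofC, h]

open Classical in
noncomputable def toC (y : YS H k q) : Conf H q := fun i =>
  if h : ∃ p : H × Fin (q i), y.1 i p.1 = some p.2 then some h.choose else none

theorem toC_some {y : YS H k q} {i : Fin k} {g : H} {a : Fin (q i)} :
    toC y i = some (g, a) ↔ y.1 i g = some a := by
  unfold toC
  constructor
  · intro h
    split_ifs at h with h'
    have := h'.choose_spec
    simp only [Option.some.injEq] at h
    rw [h] at this
    exact this
  · intro h
    have h' : ∃ p : H × Fin (q i), y.1 i p.1 = some p.2 := ⟨(g, a), h⟩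
    rw [dif_pos h']
    have h2 := h'.choose_spec
    have : h'.choose.1 = g := y.2 i _ _ (by rw [h2]; simp) (by rw [h]; simp)
    congr 1
    apply Prod.ext
    · exact this
    · rw [this, h] at h2
      simpa using h2.symm

theorem conf_ext {c c' : Conf H q} (h : ∀ i g a, c i = some (g, a) ↔ c' i = some (g, a)) :
    c = c' := by
  funext i
  apply Option.ext
  rintro ⟨g, a⟩
  exact h i g a

theorem ys_ext {y y' : YS H k q} (h : ∀ i g a, y.1 i g = some a ↔ y'.1 i g = some a) :
    y = y' := by
  apply Subtype.ext
  funext i g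
  apply Option.ext
  intro a
  exact h i g a

theorem toC_ofC (c : Conf H q) : toC (ofC c) = c :=
  conf_ext fun i g a => by rw [toC_some, ofC_some]

theorem ofC_toC (y : YS H k q) : ofC (toC y) = y :=
  ys_ext fun i g a => by rw [ofC_some, toC_some]

/-- translation of configurations -/
def sh (g : H) (c : Conf H q) : Conf H q := fun i => (c i).map fun p => (g * p.1, p.2)

theorem sh_some {g h : H} {c : Conf H q} {i : Fin k} {a : Fin (q i)} :
    sh g c i = some (h, a) ↔ c i = some (g⁻¹ * h, a) := by
  cases hc : c i with
  | none => simp [sh, hc]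
  | some p =>
    obtain ⟨g', a'⟩ := p
    simp [sh, hc, eq_inv_mul_iff_mul_eq]

theorem sh_none {g : H} {c : Conf H q} {i : Fin k} : sh g c i = none ↔ c i = none := by
  simp [sh]

theorem sh_mul (g h : H) (c : Conf H q) : sh (g * h) c = sh g (sh h c) :=
  conf_ext fun i a b => by simp [sh_some, mul_assoc]

theorem sh_one (c : Conf H q) : sh 1 c = c :=
  conf_ext fun i a b => by simp [sh_some]

theorem ofC_sh (g : H) (c : Conf H q) : ofC (sh g c) = yshift g (ofC c) := by
  refine ys_ext fun i h a => ?_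
  rw [ofC_some, sh_some]
  show _ ↔ (ofC c).1 i (g⁻¹ * h) = _
  rw [ofC_some]

theorem yshift_mul (g h : H) (y : YS H k q) : yshift (g * h) y = yshift g (yshift h y) := by
  rw [← ofC_toC y, ← ofC_sh, ← ofC_sh, ← ofC_sh, sh_mul]

theorem yshift_one (y : YS H k q) : yshift 1 y = y := by
  rw [← ofC_toC y, ← ofC_sh, sh_one]

theorem shiftC_mul {α : Type*} (g h : H) (x : H → α) : shiftC (g * h) x = shiftC g (shiftC h x) := by
  funext a; simp [shiftC, mul_assoc]

theorem shiftC_one {α : Type*} (x : H → α) : shiftC (1 : H) x = x := by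
  funext a; simp [shiftC]

/-- one step of the automaton on configurations -/
noncomputable def stp (aut : GWA H s k) (x : H → Fin s) (c : Conf H aut.q) : Conf H aut.q :=
  toC (aut.f (x, ofC c)).2

variable (aut : GWA H s k)

theorem stp_some {x : H → Fin s} {c : Conf H aut.q} {i : Fin k} {g : H} {a : Fin (aut.q i)} :
    stp aut x c i = some (g, a) ↔ (aut.f (x, ofC c)).2.1 i g = some a := toC_some

theorem f_ofC (x : H → Fin s) (c : Conf H aut.q) : aut.f (x, ofC c) = (x, ofC (stp aut x c)) := by
  apply Prod.ext
  · exact aut.fst_eq _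
  · exact (ofC_toC _).symm

theorem f_iter (x : H → Fin s) (c : Conf H aut.q) (n : ℕ) :
    aut.f^[n] (x, ofC c) = (x, ofC ((stp aut x)^[n] c)) := by
  induction n with
  | zero => rfl
  | succ n ih => rw [Function.iterate_succ_apply', Function.iterate_succ_apply', ih, f_ofC]

theorem conf_none_iff {c : Conf H q} {i : Fin k} :
    c i = none ↔ (ofC c).1 i = fun _ => none := by
  constructor
  · intro h; funext g; simp [ofC, h]
  · intro h
    apply Option.eq_none_iff_forall_ne_some.2
    rintro ⟨g, a⟩ hc
    rw [← ofC_some, h] at hc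
    simp at hc

theorem stp_none {x : H → Fin s} {c : Conf H aut.q} {i : Fin k} :
    stp aut x c i = none ↔ c i = none := by
  rw [conf_none_iff, conf_none_iff]
  have := aut.vanish (x, ofC c) i
  rw [f_ofC] at this
  exact this

theorem stp_sh (g : H) (x : H → Fin s) (c : Conf H aut.q) :
    stp aut (shiftC g x) (sh g c) = sh g (stp aut x c) := by
  have := aut.equivar g (x, ofC c)
  simp only [← ofC_sh, f_ofC] at this
  have h2 := congrArg (fun p => toC p.2) this
  simpa [toC_ofC] using h2

theorem window_rule : ∃ W : Finset H, ∀ i (x x' : H → Fin s) (y y' : YS H k aut.q) (g : H),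
    (∀ w ∈ W, x (g * w) = x' (g * w) ∧ ∀ j, y.1 j (g * w) = y'.1 j (g * w)) →
    (aut.f (x, y)).2.1 i g = (aut.f (x', y')).2.1 i g := by
  classical
  choose W hW using fun i => coords_of_cont aut.f aut.cont i 1
  refine ⟨Finset.univ.biUnion W, fun i x x' y y' g h => ?_⟩
  have key : ∀ (x : H → Fin s) (y : YS H k aut.q), (aut.f (x, y)).2.1 i g =
      (aut.f (shiftC g⁻¹ x, yshift g⁻¹ y)).2.1 i 1 := by
    intro x y
    rw [aut.equivar g⁻¹ (x, y)]
    show _ = (aut.f (x, y)).2.1 i (g⁻¹⁻¹ * 1)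
    simp
  rw [key x y, key x' y']
  refine (hW i _ _ fun w hw => ?_).symm
  have := h w (Finset.mem_biUnion.2 ⟨i, Finset.mem_univ i, hw⟩)
  refine ⟨?_, fun j => ?_⟩
  · show x (g⁻¹⁻¹ * w) = x' (g⁻¹⁻¹ * w)
    simpa using this.1
  · show y.1 j (g⁻¹⁻¹ * w) = y'.1 j (g⁻¹⁻¹ * w)
    simpa using this.2 j

/-- `D` is a set of displacements such that everything is determined by what is seen in `D`. -/
theorem local_rule : ∃ D M : Finset H, ∀ D', D ⊆ D' → 1 ∈ D' →
    (∀ i (x : H → Fin s) (c : Conf H aut.q) g a g' a', c i = some (g, a) →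
      stp aut x c i = some (g', a') → g⁻¹ * g' ∈ M) ∧
    ∀ i (x x' : H → Fin s) (c c' : Conf H aut.q) g a, c i = some (g, a) →
      (∀ d ∈ D', x (g * d) = x' (g * d)) →
      (∀ j, ∀ d ∈ D', ∀ b, c j = some (g * d, b) ↔ c' j = some (g * d, b)) →
      stp aut x c i = stp aut x' c' i := by
  classical
  obtain ⟨W, hW⟩ := window_rule aut
  refine ⟨(W ×ˢ W).image fun p => p.1⁻¹ * p.2, W.image fun w => w⁻¹, ?_⟩
  have hmov : (∀ i (x : H → Fin s) (c : Conf H aut.q) g a g' a', c i = some (g, a) →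
      stp aut x c i = some (g', a') → ∃ w ∈ W, g = g' * w) := by
    intro i x c g a g' a' hc hs
    by_contra hcon
    push Not at hcon
    let c' : Conf H aut.q := fun j => if j = i then none else c j
    have h1 : stp aut x c' i = none := (stp_none aut).2 (by simp [c'])
    have h2 : (aut.f (x, ofC c)).2.1 i g' = (aut.f (x, ofC c')).2.1 i g' := by
      refine hW i _ _ _ _ _ fun w hw => ⟨rfl, fun j => ?_⟩
      apply Option.ext
      intro b
      rw [ofC_some, ofC_some]
      by_cases hj : j = i
      · subst hj
        simp only [c', hc, if_true]
        simp only [Option.some.injEq, Prod.mk.injEq]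
        refine iff_of_false (fun h => hcon w hw h.1) (by simp)
      · simp [c', hj]
    rw [(stp_some aut).1 hs] at h2
    rw [(stp_some aut).2 h2.symm] at h1
    cases h1
  intro D' hD h1
  constructor
  · intro i x c g a g' a' hc hs
    obtain ⟨w, hw, rfl⟩ := hmov i x c g a g' a' hc hs
    exact Finset.mem_image.2 ⟨w, hw, by simp⟩
  · intro i x x' c c' g a hc hx hcc
    cases hs : stp aut x c i with
    | none => rw [stp_none, hc] at hs; cases hs
    | some p =>
      obtain ⟨g', a'⟩ := p
      obtain ⟨w, hw, hg⟩ := hmov i x c g a g' a' hc hs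
      symm
      rw [stp_some] at hs ⊢
      rw [← hs]
      symm
      refine hW i _ _ _ _ _ fun v hv => ?_
      have hd : w⁻¹ * v ∈ D' := hD (Finset.mem_image.2 ⟨(w, v), Finset.mem_product.2 ⟨hw, hv⟩, rfl⟩)
      have he : g * (w⁻¹ * v) = g' * v := by rw [hg]; group
      refine ⟨?_, fun j => ?_⟩
      · rw [← he]; exact hx _ hd
      · rw [← he]
        apply Option.ext
        intro b
        rw [ofC_some, ofC_some]
        exact hcc j _ hd b

end conf
end FH


namespace FH
section norm
variable {G : Type*} [Group G] {m : ℕ} (gen : Fin m → G)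

theorem evalWord_nil : evalWord gen [] = 1 := by simp [evalWord]

theorem evalWord_append (u v : List (Fin m × Bool)) :
    evalWord gen (u ++ v) = evalWord gen u * evalWord gen v := by simp [evalWord]

/-- inverse word -/
def invW (w : List (Fin m × Bool)) : List (Fin m × Bool) := (w.map fun l => (l.1, !l.2)).reverse

theorem evalWord_inv (w : List (Fin m × Bool)) : evalWord gen (invW w) = (evalWord gen w)⁻¹ := by
  induction w with
  | nil => simp [invW, evalWord]
  | cons l w ih =>
    have : invW (l :: w) = invW w ++ [(l.1, !l.2)] := by simp [invW]
    rw [this, evalWord_append, ih]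
    obtain ⟨i, b⟩ := l
    cases b <;> simp [evalWord]

theorem invW_length (w : List (Fin m × Bool)) : (invW w).length = w.length := by simp [invW]

variable {gen} (hG : Subgroup.closure (Set.range gen) = ⊤)
include hG

theorem exists_word (g : G) : ∃ w : List (Fin m × Bool), evalWord gen w = g := by
  have hg : g ∈ Subgroup.closure (Set.range gen) := by rw [hG]; trivial
  induction hg using Subgroup.closure_induction with
  | mem x hx =>
    obtain ⟨i, rfl⟩ := hx
    exact ⟨[(i, true)], by simp [evalWord]⟩
  | one => exact ⟨[], evalWord_nil gen⟩
  | mul x y _ _ hx hy =>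
    obtain ⟨u, rfl⟩ := hx
    obtain ⟨v, rfl⟩ := hy
    exact ⟨u ++ v, evalWord_append gen u v⟩
  | inv x _ hx =>
    obtain ⟨u, rfl⟩ := hx
    exact ⟨invW u, evalWord_inv gen u⟩

theorem norm_word (g : G) : ∃ w : List (Fin m × Bool), w.length = wordNorm gen g ∧ evalWord gen w = g := by
  have : wordNorm gen g ∈ { ℓ | ∃ w : List (Fin m × Bool), w.length = ℓ ∧ evalWord gen w = g } := by
    apply Nat.sInf_mem
    obtain ⟨w, hw⟩ := exists_word hG g
    exact ⟨_, w, rfl, hw⟩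
  exact this

omit hG in
theorem norm_le (w : List (Fin m × Bool)) : wordNorm gen (evalWord gen w) ≤ w.length :=
  Nat.sInf_le ⟨w, rfl, rfl⟩

theorem norm_mul (g h : G) : wordNorm gen (g * h) ≤ wordNorm gen g + wordNorm gen h := by
  obtain ⟨u, hu, rfl⟩ := norm_word hG g
  obtain ⟨v, hv, rfl⟩ := norm_word hG h
  rw [← hu, ← hv, ← evalWord_append, ← List.length_append]
  exact norm_le _

theorem norm_inv_le (g : G) : wordNorm gen g⁻¹ ≤ wordNorm gen g := by
  obtain ⟨u, hu, rfl⟩ := norm_word hG g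
  rw [← hu, ← evalWord_inv, ← invW_length]
  exact norm_le _

theorem norm_inv (g : G) : wordNorm gen g⁻¹ = wordNorm gen g :=
  le_antisymm (norm_inv_le hG g) (by simpa using norm_inv_le hG g⁻¹)

omit hG in
theorem norm_one : wordNorm gen (1 : G) = 0 := by
  have := norm_le (gen := gen) []
  rw [evalWord_nil] at this
  simpa using this

theorem norm_pow (g : G) (n : ℕ) : wordNorm gen (g ^ n) ≤ n * wordNorm gen g := by
  induction n with
  | zero => simp [norm_one]
  | succ n ih =>
    rw [pow_succ, Nat.succ_mul]
    exact (norm_mul hG _ _).trans (by omega)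

theorem ball_finite (n : ℕ) : {g : G | wordNorm gen g ≤ n}.Finite := by
  have : {g : G | wordNorm gen g ≤ n} ⊆
      (evalWord gen) '' {w : List (Fin m × Bool) | w.length ≤ n} := by
    intro g hg
    obtain ⟨w, hw, h⟩ := norm_word hG g
    exact ⟨w, by show w.length ≤ n; rw [hw]; exact hg, h⟩
  refine Set.Finite.subset (Set.Finite.image _ ?_) this
  exact List.finite_length_le _ _

theorem torsion_bdd (n : ℕ) : BddAbove { k | ∃ g : G, wordNorm gen g ≤ n ∧ orderOf g = k } := by
  apply Set.Finite.bddAbove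
  refine ((ball_finite hG n).image orderOf).subset ?_
  rintro k ⟨g, hg, rfl⟩
  exact ⟨g, hg, rfl⟩

theorem order_le {g : G} {n : ℕ} (h : wordNorm gen g ≤ n) : orderOf g ≤ torsionFn gen n :=
  le_csSup (torsion_bdd hG n) ⟨g, h, rfl⟩

theorem torsion_mono : Monotone (torsionFn gen) := by
  intro a b hab
  apply csSup_le_csSup (torsion_bdd hG b)
  · exact ⟨_, 1, by simp [norm_one], rfl⟩
  · rintro k ⟨g, hg, rfl⟩
    exact ⟨g, hg.trans hab, rfl⟩

theorem norm_pow_le (ht : ∀ g : G, IsOfFinOrder g) {g : G} {n : ℕ} (h : wordNorm gen g ≤ n) (j : ℕ) :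
    wordNorm gen (g ^ j) ≤ torsionFn gen n * n := by
  rw [← pow_mod_orderOf]
  refine (norm_pow hG _ _).trans (Nat.mul_le_mul ?_ h)
  exact (Nat.mod_lt _ (ht g).orderOf_pos).le.trans (order_le hG h)

/-- distance -/
noncomputable def dst (gen : Fin m → G) (g h : G) : ℕ := wordNorm gen (g⁻¹ * h)

theorem dst_comm (g h : G) : dst gen g h = dst gen h g := by
  unfold dst
  rw [← norm_inv hG]; simp

theorem dst_tri (g h k : G) : dst gen g k ≤ dst gen g h + dst gen h k := by
  unfold dst
  have : g⁻¹ * k = (g⁻¹ * h) * (h⁻¹ * k) := by group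
  rw [this]
  exact norm_mul hG _ _

omit hG in
theorem dst_self (g : G) : dst gen g g = 0 := by simp [dst, norm_one]

/-- bound given by the walk lemma -/
noncomputable def wb (gen : Fin m → G) (K ρ : ℕ) : ℕ :=
  2 * ((K + 1) * ρ) + torsionFn gen ((K + 1) * ρ) * ((K + 1) * ρ)

theorem walk_aux {E : Set ℕ} {g : ℕ → G} {ρ : ℕ}
    (H2 : ∀ t t', t ≤ t' → (∀ e, t < e → e < t' → e ∉ E) → dst gen (g t) (g t') ≤ ρ) (N : ℕ) :
    ∀ t t', t ≤ t' → (∀ A : Finset ℕ, (∀ e ∈ A, e ∈ E ∧ t < e ∧ e < t') → A.card ≤ N) →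
      dst gen (g t) (g t') ≤ (N + 1) * ρ := by
  classical
  induction N with
  | zero =>
    intro t t' htt hA
    rw [zero_add, one_mul]
    refine H2 t t' htt fun e h1 h2 h3 => ?_
    have := hA {e} (by intro e' he'; rw [Finset.mem_singleton] at he'; subst he'; exact ⟨h3, h1, h2⟩)
    simp at this
  | succ N ih =>
    intro t t' htt hA
    by_cases hex : ∃ e, e ∈ E ∧ t < e ∧ e < t'
    · have hs := Nat.find_spec hex
      have hm := fun e => Nat.find_min hex (m := e)
      set e := Nat.find hex
      have h1 : dst gen (g t) (g e) ≤ ρ := H2 _ _ hs.2.1.le fun e' h1 h2 h3 =>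
        hm e' h2 ⟨h3, h1, h2.trans hs.2.2⟩
      have h2 : dst gen (g e) (g t') ≤ (N + 1) * ρ := by
        refine ih _ _ hs.2.2.le fun A h => ?_
        have := hA (insert e A) (by
          intro e' he'
          rw [Finset.mem_insert] at he'
          rcases he' with rfl | he'
          · exact hs
          · have := h _ he'
            exact ⟨this.1, hs.2.1.trans this.2.1, this.2.2⟩)
        rw [Finset.card_insert_of_notMem (fun h' => (h _ h').2.1.ne rfl)] at this
        omega
      have := dst_tri hG (g t) (g e) (g t')
      have h3 : (N + 1 + 1) * ρ = ρ + (N + 1) * ρ := by ring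
      omega
    · push Not at hex
      have := H2 t t' htt fun e h1 h2 h3 => absurd h2 (by have := hex e h3 h1; omega)
      have h3 : ρ ≤ (N + 1 + 1) * ρ := Nat.le_mul_of_pos_left _ (by omega)
      omega

theorem walk (ht : ∀ g : G, IsOfFinOrder g) {C : Type*} [Fintype C] (E : Set ℕ) (g : ℕ → G)
    (c : ℕ → C) (ρ : ℕ)
    (H1 : ∀ t t', t ∈ E → t' ∈ E → c t = c t' → ∀ s, (g t)⁻¹ * g (t + s) = (g t')⁻¹ * g (t' + s))
    (H2 : ∀ t t', t ≤ t' → (∀ e, t < e → e < t' → e ∉ E) → dst gen (g t) (g t') ≤ ρ) (t : ℕ) :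
    dst gen (g 0) (g t) ≤ wb gen (Fintype.card C) ρ := by
  classical
  set K := Fintype.card C
  have hinj : ∀ A : Finset ℕ, (∀ a ∈ A, ∀ b ∈ A, a < b → c a ≠ c b) → A.card ≤ K := by
    intro A hA
    show A.card ≤ Fintype.card C
    rw [← Finset.card_univ]
    refine Finset.card_le_card_of_injOn c (fun _ _ => Finset.mem_univ _) ?_
    intro a ha b hb hab
    rcases lt_trichotomy a b with h | h | h
    · exact absurd hab (hA a ha b hb h)
    · exact h
    · exact absurd hab.symm (hA b hb a ha h)
  by_cases hex : ∃ b, b ∈ E ∧ ∃ a ∈ E, a < b ∧ c a = c b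
  swap
  · push Not at hex
    have := walk_aux hG H2 K 0 t (Nat.zero_le _) fun A hA => hinj A fun a ha b hb hab =>
      hex b (hA b hb).1 a (hA a ha).1 hab
    unfold wb
    omega
  · obtain ⟨hbE, a, haE, hab, hcab⟩ := Nat.find_spec hex
    have hm := fun e => Nat.find_min hex (m := e)
    set b := Nat.find hex
    have hL : ∀ t t', t ≤ t' → t' ≤ b → dst gen (g t) (g t') ≤ (K + 1) * ρ := by
      intro t t' htt htb
      refine walk_aux hG H2 K t t' htt fun A hA => hinj A fun a' ha' b' hb' hab' hc => ?_
      exact hm b' ((hA b' hb').2.2.trans_le htb) ⟨(hA b' hb').1, a', (hA a' ha').1, hab', hc⟩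
    by_cases htb : t ≤ b
    · have := hL 0 t (Nat.zero_le _) htb
      unfold wb; omega
    · set u := (g a)⁻¹ * g b with hu
      set l := b - a with hl
      have hbl : b = a + l := by omega
      have hl0 : 0 < l := by omega
      have hper : ∀ j s, (g a)⁻¹ * g (a + j * l + s) = u ^ j * ((g a)⁻¹ * g (a + s)) := by
        intro j
        induction j with
        | zero => intro s; simp
        | succ j ih =>
          intro s
          have h1 : a + (j + 1) * l + s = a + j * l + (l + s) := by ring
          rw [h1, ih, pow_succ, mul_assoc]
          congr 1
          have h2 := H1 a b haE hbE hcab s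
          rw [h2, hu, ← add_assoc, ← hbl]
          group
      have h1 : t = a + ((t - a) / l) * l + (t - a) % l := by
        have := Nat.div_add_mod' (t - a) l
        omega
      set j := (t - a) / l
      set r := (t - a) % l
      have hr : r < l := Nat.mod_lt _ hl0
      have h2 := hL 0 a (Nat.zero_le _) hab.le
      have h3 := hL a (a + r) (by omega) (by omega)
      have h4 : wordNorm gen (u ^ j) ≤ torsionFn gen ((K + 1) * ρ) * ((K + 1) * ρ) :=
        norm_pow_le hG ht (hL a b hab.le le_rfl) j
      have h5 : dst gen (g a) (g t) ≤ wordNorm gen (u ^ j) + dst gen (g a) (g (a + r)) := by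
        unfold dst
        rw [h1, hper]
        exact norm_mul hG _ _
      have h6 := dst_tri hG (g 0) (g a) (g t)
      unfold wb
      omega

end norm
end FH


namespace FH
section dyn
variable {H : Type*} [Group H] {s k : ℕ}

/-- the local-rule data of an automaton -/
structure Dyn (aut : GWA H s k) (D M : Finset H) : Prop where
  one : 1 ∈ D
  symm : ∀ d ∈ D, d⁻¹ ∈ D
  mov : ∀ i (x : H → Fin s) (c : Conf H aut.q) g a g' a', c i = some (g, a) →
      stp aut x c i = some (g', a') → g⁻¹ * g' ∈ M
  loc : ∀ i (x x' : H → Fin s) (c c' : Conf H aut.q) g a, c i = some (g, a) →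
      (∀ d ∈ D, x (g * d) = x' (g * d)) →
      (∀ j, ∀ d ∈ D, ∀ b, c j = some (g * d, b) ↔ c' j = some (g * d, b)) →
      stp aut x c i = stp aut x' c' i

theorem exists_dyn (aut : GWA H s k) (D0 : Finset H) : ∃ D M, D0 ⊆ D ∧ Dyn aut D M := by
  classical
  obtain ⟨D, M, h⟩ := local_rule aut
  let E : Finset H := insert 1 (D ∪ D0)
  let D' : Finset H := E ∪ E.image fun g => g⁻¹
  have hED : E ⊆ D' := Finset.subset_union_left
  have h1 : (1 : H) ∈ D' := hED (Finset.mem_insert_self _ _)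
  have hD : D ⊆ D' := fun d hd => hED (Finset.mem_insert_of_mem (Finset.mem_union_left _ hd))
  obtain ⟨hm, hl⟩ := h D' hD h1
  refine ⟨D', M, fun d hd => hED (Finset.mem_insert_of_mem (Finset.mem_union_right _ hd)), h1, ?_, hm, hl⟩
  intro d hd
  rcases Finset.mem_union.1 hd with h | h
  · exact Finset.mem_union_right _ (Finset.mem_image_of_mem _ h)
  · obtain ⟨e, he, rfl⟩ := Finset.mem_image.1 h
    exact Finset.mem_union_left _ (by simpa using he)

section basic
variable {q : Fin k → ℕ}

def Near (D : Finset H) (c : Conf H q) (i j : Fin k) : Prop :=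
  i ≠ j ∧ ∃ g a h b, c i = some (g, a) ∧ c j = some (h, b) ∧ g⁻¹ * h ∈ D

def pos (c : Conf H q) (i : Fin k) : H := (c i).elim 1 Prod.fst

theorem pos_eq {c : Conf H q} {i : Fin k} {g a} (h : c i = some (g, a)) : pos c i = g := by
  simp [pos, h]

open Classical in
noncomputable def restr (S : Set (Fin k)) (c : Conf H q) : Conf H q :=
  fun i => if i ∈ S then c i else none

omit [Group H] in
theorem restr_mem {S : Set (Fin k)} {c : Conf H q} {i} (h : i ∈ S) : restr S c i = c i := by
  simp [restr, h]

omit [Group H] in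
theorem restr_notMem {S : Set (Fin k)} {c : Conf H q} {i} (h : i ∉ S) : restr S c i = none := by
  simp [restr, h]

theorem pos_restr {S : Set (Fin k)} {c : Conf H q} {i} (h : i ∈ S) :
    pos (restr S c) i = pos c i := by
  simp [pos, restr_mem h]

/-- no head of `S` is near a head outside -/
def Sep (D : Finset H) (S : Set (Fin k)) (c : Conf H q) : Prop :=
  ∀ i ∈ S, ∀ j, j ∉ S → ¬ Near D c i j

def Lonely (D : Finset H) (c : Conf H q) (i : Fin k) : Prop := ∀ j, ¬ Near D c i j

theorem lonely_sep {D : Finset H} {c : Conf H q} {i : Fin k} (h : Lonely D c i) :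
    Sep D {i} c := by
  intro i' hi j _
  rw [Set.mem_singleton_iff] at hi
  subst hi
  exact h j

end basic

variable {aut : GWA H s k} {D M : Finset H} (hd : Dyn aut D M)

include hd

theorem near_symm {c : Conf H aut.q} {i j} (h : Near D c i j) : Near D c j i := by
  obtain ⟨hij, g, a, h, b, h1, h2, h3⟩ := h
  exact ⟨hij.symm, h, b, g, a, h2, h1, by simpa using hd.symm _ h3⟩

theorem sep_compl {c : Conf H aut.q} {S : Set (Fin k)} (h : Sep D S c) : Sep D Sᶜ c := by
  intro i hi j hj hn
  exact h j (by simpa using hj) i hi (near_symm hd hn)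

theorem restr_stp {x : H → Fin s} {c : Conf H aut.q} {S : Set (Fin k)} (h : Sep D S c) :
    stp aut x (restr S c) = restr S (stp aut x c) := by
  funext i
  by_cases hi : i ∈ S
  · rw [restr_mem hi]
    cases hc : c i with
    | none => rw [(stp_none aut).2 hc, (stp_none aut).2 (by rw [restr_mem hi, hc])]
    | some p =>
      obtain ⟨g, a⟩ := p
      refine hd.loc i x x _ _ g a (by rw [restr_mem hi, hc]) (fun _ _ => rfl) fun j d hdd b => ?_
      by_cases hj : j ∈ S
      · rw [restr_mem hj]
      · rw [restr_notMem hj]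
        refine iff_of_false (by simp) fun hcj => ?_
        exact h i hi j hj ⟨fun e => hj (e ▸ hi), g, a, _, b, hc, hcj, by simpa using hdd⟩
  · rw [restr_notMem hi, (stp_none aut).2 (restr_notMem hi)]

theorem restr_iter {x : H → Fin s} {c : Conf H aut.q} {S : Set (Fin k)} (t : ℕ)
    (h : ∀ τ < t, Sep D S ((stp aut x)^[τ] c)) :
    (stp aut x)^[t] (restr S c) = restr S ((stp aut x)^[t] c) := by
  induction t with
  | zero => rfl
  | succ t ih =>
    rw [Function.iterate_succ_apply', Function.iterate_succ_apply',
      ih fun τ hτ => h τ (by omega), restr_stp hd (h t (by omega))]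

omit hd in
theorem iter_none {x : H → Fin s} {c : Conf H aut.q} {i} (t : ℕ) :
    (stp aut x)^[t] c i = none ↔ c i = none := by
  induction t with
  | zero => rfl
  | succ t ih => rw [Function.iterate_succ_apply', stp_none, ih]

omit hd in
theorem iter_sh {x : H → Fin s} {u : H} (hu : shiftC u x = x) (c : Conf H aut.q) (t : ℕ) :
    (stp aut x)^[t] (sh u c) = sh u ((stp aut x)^[t] c) := by
  induction t with
  | zero => rfl
  | succ t ih =>
    rw [Function.iterate_succ_apply', Function.iterate_succ_apply', ih]
    have := stp_sh aut u x ((stp aut x)^[t] c)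
    rwa [hu] at this

omit hd in
theorem pos_sh {q : Fin k → ℕ} {u : H} {c : Conf H q} {i} (h : c i ≠ none) :
    pos (sh u c) i = u * pos c i := by
  obtain ⟨⟨g, a⟩, hc⟩ := Option.ne_none_iff_exists'.1 h
  rw [pos_eq hc]
  exact pos_eq (a := a) (by rw [sh_some, hc]; simp)

theorem step_pos {x : H → Fin s} {c : Conf H aut.q} {i} (h : c i ≠ none) :
    (pos c i)⁻¹ * pos (stp aut x c) i ∈ M := by
  obtain ⟨⟨g, a⟩, hc⟩ := Option.ne_none_iff_exists'.1 h
  obtain ⟨⟨g', a'⟩, hc'⟩ := Option.ne_none_iff_exists'.1 (mt (stp_none aut (x := x)).1 h)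
  rw [pos_eq hc, pos_eq hc']
  exact hd.mov i x c g a g' a' hc hc'

end dyn

section bounds
variable {H : Type*} [Group H] {s : ℕ} {G : Type*} [Group G] {m : ℕ} {gen : Fin m → G}
  (hG : Subgroup.closure (Set.range gen) = ⊤) (ht : ∀ g : G, IsOfFinOrder g)
  {Q : Type*} [Group Q] [Fintype Q] (γ : H →* G) (π : H →* Q)
  {k : ℕ} {aut : GWA H s k} {D M : Finset H} (hd : Dyn aut D M) {μ : ℕ}
  (hμ : ∀ h ∈ M, wordNorm gen (γ h) ≤ μ)
  {x : H → Fin s} (hx : ∀ h, π h = 1 → shiftC h x = x)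

noncomputable abbrev run (aut : GWA H s k) (x : H → Fin s) (c : Conf H aut.q) (t : ℕ) : Conf H aut.q := (stp aut x)^[t] c

noncomputable def gd (gen : Fin m → G) (γ : H →* G) (a b : H) : ℕ := dst gen (γ a) (γ b)

include hG in
theorem gd_tri (a b c : H) : gd gen γ a c ≤ gd gen γ a b + gd gen γ b c := dst_tri hG _ _ _
include hG in
theorem gd_comm (a b : H) : gd gen γ a b = gd gen γ b a := dst_comm hG _ _
theorem gd_self (a : H) : gd gen γ a a = 0 := dst_self _
theorem gd_le {a b : H} {B : Finset H} {r : ℕ} (h : a⁻¹ * b ∈ B)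
    (hr : ∀ h ∈ B, wordNorm gen (γ h) ≤ r) : gd gen γ a b ≤ r := by
  have := hr _ h
  simpa [gd, dst] using this

noncomputable def bd1 (gen : Fin m → G) (q P μ : ℕ) : ℕ := wb gen ((q + 1) * P) μ

include hG ht hd hμ hx

/-- one head walking alone -/
theorem solo0 (q : ℕ) (hq : ∀ i, aut.q i ≤ q) (c : Conf H aut.q) (i : Fin k) (hc : c i ≠ none)
    (hs : ∀ j, j ≠ i → c j = none) (t : ℕ) :
    gd gen γ (pos c i) (pos (run aut x c t) i) ≤ bd1 gen q (Fintype.card Q) μ := by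
  classical
  have hp : ∀ t, run aut x c t i ≠ none := fun t h => hc ((iter_none t).1 h)
  have hs' : ∀ t j, j ≠ i → run aut x c t j = none := fun t j hj => (iter_none t).2 (hs j hj)
  let E : Set ℕ := Set.univ
  let cl : ℕ → Option (Fin (aut.q i)) × Q := fun t => ((run aut x c t i).map Prod.snd, π (pos (run aut x c t) i))
  have := walk hG ht E (fun t => γ (pos (run aut x c t) i)) cl μ ?_ ?_ t
  · refine this.trans ?_
    unfold bd1 wb
    have hK : Fintype.card (Option (Fin (aut.q i)) × Q) ≤ (q + 1) * Fintype.card Q := by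
      simp only [Fintype.card_prod, Fintype.card_option, Fintype.card_fin]
      exact Nat.mul_le_mul_right _ (by have := hq i; omega)
    have h1 : (Fintype.card (Option (Fin (aut.q i)) × Q) + 1) * μ ≤ ((q + 1) * Fintype.card Q + 1) * μ :=
      Nat.mul_le_mul_right _ (by omega)
    exact Nat.add_le_add (by omega) (Nat.mul_le_mul (torsion_mono hG h1) h1)
  · intro t t' _ _ hcl s
    obtain ⟨⟨g, a⟩, h1⟩ := Option.ne_none_iff_exists'.1 (hp t)
    obtain ⟨⟨g', a'⟩, h2⟩ := Option.ne_none_iff_exists'.1 (hp t')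
    simp only [cl, Prod.mk.injEq, h1, h2, Option.map_some, Option.some.injEq, pos_eq h1, pos_eq h2] at hcl
    obtain ⟨rfl, hπ⟩ := hcl
    have hu : shiftC (g' * g⁻¹) x = x := hx _ (by rw [map_mul, map_inv, hπ, mul_inv_cancel])
    have hsh : run aut x c t' = sh (g' * g⁻¹) (run aut x c t) := by
      funext j
      by_cases hj : j = i
      · subst hj
        rw [h2]
        exact (sh_some.2 (by rw [h1]; simp)).symm
      · rw [hs' t' j hj, sh_none.2 (hs' t j hj)]
    have h3 : run aut x c (t' + s) = sh (g' * g⁻¹) (run aut x c (t + s)) := by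
      simp only [run] at hsh ⊢
      rw [add_comm t' s, add_comm t s, Function.iterate_add_apply, Function.iterate_add_apply, hsh,
        iter_sh hu]
    rw [h3, pos_sh (hp _), pos_eq h1, pos_eq h2]
    simp only [map_mul, map_inv]
    group
  · intro t t' htt hno
    have : t' ≤ t + 1 := by
      by_contra hcon
      exact hno (t + 1) (by omega) (by omega) trivial
    rcases Nat.lt_or_ge t t' with h | h
    · have : t' = t + 1 := by omega
      subst this
      refine gd_le γ ?_ hμ
      simp only [run]
      rw [Function.iterate_succ_apply']
      exact step_pos hd (hp t)
    · have : t' = t := by omega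
      subst this
      rw [dst_self]; omega

omit ht hd hμ hx hG in
theorem run_add (c : Conf H aut.q) (a b : ℕ) : run aut x c (a + b) = run aut x (run aut x c a) b := by
  simp only [run]
  rw [add_comm, Function.iterate_add_apply]

theorem solo (q : ℕ) (hq : ∀ i, aut.q i ≤ q) (c : Conf H aut.q) (i : Fin k) (hc : c i ≠ none)
    (σ t : ℕ) (hσ : σ ≤ t) (hl : ∀ τ, σ ≤ τ → τ < t → Lonely D (run aut x c τ) i) :
    gd gen γ (pos (run aut x c σ) i) (pos (run aut x c t) i) ≤ bd1 gen q (Fintype.card Q) μ := by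
  obtain ⟨l, rfl⟩ := Nat.exists_eq_add_of_le hσ
  have hp : ∀ t, run aut x c t i ≠ none := fun t h => hc ((iter_none t).1 h)
  have h1 := restr_iter hd (x := x) (c := run aut x c σ) (S := {i}) l (fun τ hτ => by
    have := hl (σ + τ) (by omega) (by omega)
    rw [run_add] at this
    exact lonely_sep this)
  have h2 := solo0 hG ht γ π hd hμ hx q hq (restr {i} (run aut x c σ)) i
    (by rw [restr_mem (Set.mem_singleton i)]; exact hp σ) (fun j hj => restr_notMem hj) l
  simp only [run] at h1 h2
  rw [h1, pos_restr (Set.mem_singleton i), pos_restr (Set.mem_singleton i)] at h2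
  rw [run_add]
  exact h2

noncomputable def bd2 (gen : Fin m → G) (q P μ D : ℕ) : ℕ :=
  wb gen ((q + 1) * ((q + 1) * ((D + 1) * P))) (μ + bd1 gen q P μ)

theorem duo0 (q : ℕ) (hq : ∀ i, aut.q i ≤ q) (c : Conf H aut.q) (i j : Fin k) (hij : i ≠ j)
    (hci : c i ≠ none) (hcj : c j ≠ none)
    (hs : ∀ l, l ≠ i → l ≠ j → c l = none) (t : ℕ) :
    gd gen γ (pos c i) (pos (run aut x c t) i) ≤ bd2 gen q (Fintype.card Q) μ D.card := by
  classical
  have hpi : ∀ t, run aut x c t i ≠ none := fun t h => hci ((iter_none t).1 h)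
  have hpj : ∀ t, run aut x c t j ≠ none := fun t h => hcj ((iter_none t).1 h)
  have hs' : ∀ t l, l ≠ i → l ≠ j → run aut x c t l = none := fun t l h h' =>
    (iter_none t).2 (hs l h h')
  let E : Set ℕ := {t | Near D (run aut x c t) i j}
  let cl : ℕ → Option (Fin (aut.q i)) × Option (Fin (aut.q j)) × Option D × Q := fun t => ((run aut x c t i).map Prod.snd, (run aut x c t j).map Prod.snd,
    (if h : (pos (run aut x c t) i)⁻¹ * pos (run aut x c t) j ∈ D then some ⟨_, h⟩ else none),
    π (pos (run aut x c t) i))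
  have := walk hG ht E (fun t => γ (pos (run aut x c t) i)) cl
    (μ + bd1 gen q (Fintype.card Q) μ) ?_ ?_ t
  · refine this.trans ?_
    unfold bd2 wb
    have hK : Fintype.card (Option (Fin (aut.q i)) × Option (Fin (aut.q j)) × Option D × Q) ≤ (q + 1) * ((q + 1) * ((D.card + 1) * Fintype.card Q)) := by
      simp only [Fintype.card_prod, Fintype.card_option, Fintype.card_fin, Fintype.card_coe]
      have h1 := hq i
      have h2 := hq j
      gcongr
    have h1 : (Fintype.card (Option (Fin (aut.q i)) × Option (Fin (aut.q j)) × Option D × Q) + 1) * (μ + bd1 gen q (Fintype.card Q) μ) ≤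
      ((q + 1) * ((q + 1) * ((D.card + 1) * Fintype.card Q)) + 1) * (μ + bd1 gen q (Fintype.card Q) μ) :=
      Nat.mul_le_mul_right _ (by omega)
    exact Nat.add_le_add (by omega) (Nat.mul_le_mul (torsion_mono hG h1) h1)
  · intro t t' hE hE' hcl s
    obtain ⟨_, g1, a1, g2, a2, h1, h2, hD1⟩ := hE
    obtain ⟨_, g1', a1', g2', a2', h1', h2', hD2⟩ := hE'
    simp only [cl, Prod.mk.injEq, h1, h2, h1', h2', Option.map_some, Option.some.injEq,
      pos_eq h1, pos_eq h2, pos_eq h1', pos_eq h2', hD1, hD2, dif_pos, Subtype.mk.injEq] at hcl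
    obtain ⟨rfl, rfl, hδ, hπ⟩ := hcl
    have hu : shiftC (g1' * g1⁻¹) x = x := hx _ (by rw [map_mul, map_inv, hπ, mul_inv_cancel])
    have hsh : run aut x c t' = sh (g1' * g1⁻¹) (run aut x c t) := by
      funext l
      by_cases hl : l = i
      · subst hl
        rw [h1']
        exact (sh_some.2 (by rw [h1]; simp)).symm
      · by_cases hl' : l = j
        · subst hl'
          rw [h2']
          refine (sh_some.2 ?_).symm
          rw [h2]
          have : g2' = g1' * (g1⁻¹ * g2) := by rw [hδ]; group
          rw [this]
          congr 2
          group
        · rw [hs' t' l hl hl', sh_none.2 (hs' t l hl hl')]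
    have h3 : run aut x c (t' + s) = sh (g1' * g1⁻¹) (run aut x c (t + s)) := by
      simp only [run] at hsh ⊢
      rw [add_comm t' s, add_comm t s, Function.iterate_add_apply, Function.iterate_add_apply, hsh,
        iter_sh hu]
    rw [h3, pos_sh (hpi _), pos_eq h1, pos_eq h1']
    simp only [map_mul, map_inv]
    group
  · intro t t' htt hno
    rcases Nat.lt_or_ge t t' with h | h
    · have h1 : dst gen (γ (pos (run aut x c t) i)) (γ (pos (run aut x c (t+1)) i)) ≤ μ := by
        refine gd_le γ ?_ hμ
        simp only [run]
        rw [Function.iterate_succ_apply']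
        exact step_pos hd (hpi t)
      have h2 : dst gen (γ (pos (run aut x c (t+1)) i)) (γ (pos (run aut x c t') i)) ≤ _ :=
        solo hG ht γ π hd hμ hx q hq c i hci (t+1) t' h (by
          intro τ h1 h2 l hn
          by_cases hl : l = j
          · subst hl
            exact hno τ (by omega) h2 hn
          · obtain ⟨h3, _, _, _, _, _, h4, _⟩ := hn
            rw [hs' τ l (Ne.symm h3) hl] at h4
            cases h4)
      have h3 := dst_tri hG (γ (pos (run aut x c t) i)) (γ (pos (run aut x c (t+1)) i)) (γ (pos (run aut x c t') i))
      omega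
    · have : t' = t := by omega
      subst this
      rw [dst_self]; omega

omit ht hd hμ hx hG in
theorem bd1_le_bd2 (q P μ D : ℕ) : bd1 gen q P μ ≤ bd2 gen q P μ D := by
  unfold bd2
  unfold wb
  have : μ + bd1 gen q P μ ≤ ((q + 1) * ((q + 1) * ((D + 1) * P)) + 1) * (μ + bd1 gen q P μ) :=
    Nat.le_mul_of_pos_left _ (by omega)
  omega

end bounds
end FH


namespace FH
theorem third : ∀ i l : Fin 3, i ≠ l → ∃ j, j ≠ i ∧ j ≠ l ∧ ∀ h, h = i ∨ h = j ∨ h = l := by decide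

section three
variable {H : Type*} [Group H] {s : ℕ} {G : Type*} [Group G] {m : ℕ} {gen : Fin m → G}
  (hG : Subgroup.closure (Set.range gen) = ⊤) (ht : ∀ g : G, IsOfFinOrder g)
  {Q : Type*} [Group Q] [Fintype Q] (γ : H →* G) (π : H →* Q)
  {aut : GWA H s 3} {D M : Finset H} (hd : Dyn aut D M) {μ : ℕ}
  (hμ : ∀ h ∈ M, wordNorm gen (γ h) ≤ μ) (hμD : ∀ h ∈ D, wordNorm gen (γ h) ≤ μ)
  {x : H → Fin s} (hx : ∀ h, π h = 1 → shiftC h x = x)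

theorem near_gd (hμD : ∀ h ∈ D, wordNorm gen (γ h) ≤ μ) {c : Conf H aut.q} {i j} (h : Near D c i j) :
    gd gen γ (pos c i) (pos c j) ≤ μ := by
  obtain ⟨_, g, a, g', b, h1, h2, h3⟩ := h
  rw [pos_eq h1, pos_eq h2]
  exact gd_le γ h3 hμD

include hG ht hd hμ hx

theorem duo (q : ℕ) (hq : ∀ i, aut.q i ≤ q) (c : Conf H aut.q) (l i : Fin 3) (hc : c i ≠ none)
    (σ t : ℕ) (hσ : σ ≤ t) (hl : ∀ τ, σ ≤ τ → τ < t → Lonely D (run aut x c τ) l) :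
    gd gen γ (pos (run aut x c σ) i) (pos (run aut x c t) i) ≤ bd2 gen q (Fintype.card Q) μ D.card := by
  by_cases hil : i = l
  · subst hil
    exact (solo hG ht γ π hd hμ hx q hq c i hc σ t hσ hl).trans (bd1_le_bd2 _ _ _ _)
  · obtain ⟨l', rfl⟩ := Nat.exists_eq_add_of_le hσ
    have hp : ∀ t, run aut x c t i ≠ none := fun t h => hc ((iter_none t).1 h)
    have h1 := restr_iter hd (x := x) (c := run aut x c σ) (S := {l}ᶜ) l' (fun τ hτ => by
      have := hl (σ + τ) (by omega) (by omega)
      rw [run_add] at this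
      exact sep_compl hd (lonely_sep this))
    have hmem : i ∈ ({l}ᶜ : Set (Fin 3)) := hil
    obtain ⟨j, hji, hjl, hall⟩ := third i l hil
    have h2 : gd gen γ (pos (restr {l}ᶜ (run aut x c σ)) i)
        (pos (run aut x (restr {l}ᶜ (run aut x c σ)) l') i) ≤ bd2 gen q (Fintype.card Q) μ D.card := by
      by_cases hj : run aut x c σ j = none
      · refine (solo0 hG ht γ π hd hμ hx q hq _ i (by rw [restr_mem hmem]; exact hp σ) ?_ l').trans
          (bd1_le_bd2 _ _ _ _)
        intro h hh
        rcases hall h with rfl | rfl | rfl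
        · exact absurd rfl hh
        · rw [restr_mem hjl, hj]
        · exact restr_notMem (by simp)
      · refine duo0 hG ht γ π hd hμ hx q hq _ i j hji.symm (by rw [restr_mem hmem]; exact hp σ)
          (by rw [restr_mem hjl]; exact hj) ?_ l'
        intro h hh hh'
        rcases hall h with rfl | rfl | rfl
        · exact absurd rfl hh
        · exact absurd rfl hh'
        · exact restr_notMem (by simp)
    simp only [run] at h1 h2
    rw [h1, pos_restr hmem, pos_restr hmem] at h2
    rw [run_add]
    exact h2

include hμD

theorem forward (q : ℕ) (hq : ∀ i, aut.q i ≤ q) (c : Conf H aut.q) (R0 : ℕ)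
    (h0 : ∀ i j, c i ≠ none → c j ≠ none → gd gen γ (pos c i) (pos c j) ≤ R0) (t : ℕ) (i j : Fin 3)
    (hi : c i ≠ none) (hj : c j ≠ none) :
    gd gen γ (pos (run aut x c t) i) (pos (run aut x c t) j) ≤
      R0 + 6 * μ + 2 * bd1 gen q (Fintype.card Q) μ + 2 * bd2 gen q (Fintype.card Q) μ D.card := by
  classical
  have hp : ∀ t i, c i ≠ none → run aut x c t i ≠ none := fun t i hc h => hc ((iter_none t).1 h)
  have hp' : ∀ t i, run aut x c t i ≠ none → c i ≠ none := fun t i hc h => hc ((iter_none t).2 h)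
  have hex : ∃ σ, σ ≤ t ∧ ∃ l : Fin 3, ∀ τ, σ ≤ τ → τ < t → Lonely D (run aut x c τ) l :=
    ⟨t, le_rfl, 0, fun τ h h' => by omega⟩
  obtain ⟨hσt, l, hl⟩ := Nat.find_spec hex
  have hmin := fun e => Nat.find_min hex (m := e)
  set σ := Nat.find hex
  set r1 := bd1 gen q (Fintype.card Q) μ
  set r2 := bd2 gen q (Fintype.card Q) μ D.card
  have key : ∀ B, (∀ i j, c i ≠ none → c j ≠ none →
      gd gen γ (pos (run aut x c σ) i) (pos (run aut x c σ) j) ≤ B) →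
      gd gen γ (pos (run aut x c t) i) (pos (run aut x c t) j) ≤ B + 2 * r2 := by
    intro B hB
    have h1 := duo hG ht γ π hd hμ hx q hq c l i hi σ t hσt hl
    have h2 := duo hG ht γ π hd hμ hx q hq c l j hj σ t hσt hl
    have h3 := hB i j hi hj
    have h4 := gd_tri hG γ (pos (run aut x c t) i) (pos (run aut x c σ) i) (pos (run aut x c t) j)
    have h5 := gd_tri hG γ (pos (run aut x c σ) i) (pos (run aut x c σ) j) (pos (run aut x c t) j)
    rw [gd_comm hG γ (pos (run aut x c t) i) (pos (run aut x c σ) i)] at h4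
    omega
  rcases Nat.eq_zero_or_pos σ with hz | hpos
  · have := key R0 (by rw [hz]; exact h0)
    omega
  obtain ⟨σ', hσ'⟩ : ∃ σ', σ = σ' + 1 := ⟨σ - 1, by omega⟩
  have hnl : ∀ h : Fin 3, ∃ τ, σ' ≤ τ ∧ τ < t ∧ ¬ Lonely D (run aut x c τ) h := by
    intro h
    by_contra hcon
    push Not at hcon
    exact hmin σ' (by omega) ⟨by omega, h, hcon⟩
  have hln : ¬ Lonely D (run aut x c σ') l := by
    obtain ⟨τ, h1, h2, h3⟩ := hnl l
    rcases Nat.eq_or_lt_of_le h1 with h | h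
    · rw [h]; exact h3
    · exact absurd (hl τ (by omega) h2) h3
  unfold Lonely at hln
  push Not at hln
  obtain ⟨j', hj'⟩ := hln
  obtain ⟨l', hl'l, hl'j, hall⟩ := third l j' hj'.1
  have hcl : c l ≠ none := hp' σ' l (by obtain ⟨_, _, _, _, _, h, _⟩ := hj'; rw [h]; simp)
  have hcj : c j' ≠ none := hp' σ' j' (by obtain ⟨_, _, _, _, _, _, h, _⟩ := hj'; rw [h]; simp)
  have hstep : ∀ i, c i ≠ none → gd gen γ (pos (run aut x c σ') i) (pos (run aut x c σ) i) ≤ μ := by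
    intro i hi
    refine gd_le γ ?_ hμ
    rw [hσ']
    simp only [run]
    rw [Function.iterate_succ_apply']
    exact step_pos hd (hp σ' i hi)
  have e1 : gd gen γ (pos (run aut x c σ) l) (pos (run aut x c σ) j') ≤ 3 * μ := by
    have h1 := near_gd γ hμD hj'
    have h2 := hstep l hcl
    have h3 := hstep j' hcj
    have h4 := gd_tri hG γ (pos (run aut x c σ) l) (pos (run aut x c σ') l) (pos (run aut x c σ) j')
    have h5 := gd_tri hG γ (pos (run aut x c σ') l) (pos (run aut x c σ') j') (pos (run aut x c σ) j')
    rw [gd_comm hG γ (pos (run aut x c σ) l) (pos (run aut x c σ') l)] at h4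
    omega
  -- second edge
  have e2 : ∃ w, w ≠ l' ∧ c w ≠ none ∧ c l' ≠ none ∧
      gd gen γ (pos (run aut x c σ) l') (pos (run aut x c σ) w) ≤ 3 * μ + 2 * r1 := by
    have hex2 := hnl l'
    obtain ⟨g1, g2, g3⟩ := Nat.find_spec hex2
    have gmin := fun e => Nat.find_min hex2 (m := e)
    set τ := Nat.find hex2
    unfold Lonely at g3
    push Not at g3
    obtain ⟨w, hw⟩ := g3
    have hcl' : c l' ≠ none := hp' τ l' (by obtain ⟨_, _, _, _, _, h, _⟩ := hw; rw [h]; simp)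
    have hcw : c w ≠ none := hp' τ w (by obtain ⟨_, _, _, _, _, _, h, _⟩ := hw; rw [h]; simp)
    refine ⟨w, hw.1.symm, hcw, hcl', ?_⟩
    have hwn := near_gd γ hμD hw
    rcases Nat.eq_or_lt_of_le g1 with h | h
    · rw [← h] at hwn
      have h2 := hstep l' hcl'
      have h3 := hstep w hcw
      have h4 := gd_tri hG γ (pos (run aut x c σ) l') (pos (run aut x c σ') l') (pos (run aut x c σ) w)
      have h5 := gd_tri hG γ (pos (run aut x c σ') l') (pos (run aut x c σ') w) (pos (run aut x c σ) w)
      rw [gd_comm hG γ (pos (run aut x c σ) l') (pos (run aut x c σ') l')] at h4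
      omega
    · -- during [σ, τ) everybody is alone
      have hll : ∀ τ', σ ≤ τ' → τ' < τ → Lonely D (run aut x c τ') l' := by
        intro τ' h1 h2
        by_contra hcon
        exact gmin τ' h2 ⟨by omega, by omega, hcon⟩
      have hlw : ∀ τ', σ ≤ τ' → τ' < τ → Lonely D (run aut x c τ') w := by
        intro τ' h1 h2 v hv
        have h3 := near_symm hd hv
        rcases hall v with rfl | rfl | rfl
        · exact hl τ' h1 (by omega) w h3
        · exact hll τ' h1 h2 w h3
        · -- v = j', so w is l or l'
          rcases hall w with rfl | rfl | rfl
          · exact hl τ' h1 (by omega) _ hv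
          · exact hw.1 rfl
          · exact hv.1 rfl
      have h2 := solo hG ht γ π hd hμ hx q hq c l' hcl' σ τ (by omega) hll
      have h3 := solo hG ht γ π hd hμ hx q hq c w hcw σ τ (by omega) hlw
      have h4 := gd_tri hG γ (pos (run aut x c σ) l') (pos (run aut x c τ) l') (pos (run aut x c σ) w)
      have h5 := gd_tri hG γ (pos (run aut x c τ) l') (pos (run aut x c τ) w) (pos (run aut x c σ) w)
      rw [gd_comm hG γ (pos (run aut x c τ) w) (pos (run aut x c σ) w)] at h5
      omega
  obtain ⟨w, hwl, hcw, hcl', e2⟩ := e2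
  have := key (R0 + 6 * μ + 2 * r1) ?_
  · omega
  · intro a b _ _
    have hs := fun v => gd_self (gen := gen) γ (pos (run aut x c σ) v)
    have hc := fun v u => gd_comm hG γ (pos (run aut x c σ) v) (pos (run aut x c σ) u)
    have htr := fun v u z => gd_tri hG γ (pos (run aut x c σ) v) (pos (run aut x c σ) u) (pos (run aut x c σ) z)
    generalize gd gen γ = d at *
    have hz : w = l ∨ w = j' := by
      rcases hall w with h | h | h
      · exact Or.inl h
      · exact absurd h hwl
      · exact Or.inr h
    have f1 : d (pos (run aut x c σ) l') (pos (run aut x c σ) l) ≤ 6 * μ + 2 * r1 := by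
      have := htr l' j' l
      have := hc l j'
      rcases hz with rfl | rfl <;> omega
    have f2 : d (pos (run aut x c σ) l') (pos (run aut x c σ) j') ≤ 6 * μ + 2 * r1 := by
      have := htr l' l j'
      rcases hz with rfl | rfl <;> omega
    have := hc l j'
    have := hc l l'
    have := hc j' l'
    have := hs a
    rcases hall a with rfl | rfl | rfl <;> rcases hall b with rfl | rfl | rfl <;> omega

/-- interaction component of a head up to time `n` -/
def comp (aut : GWA H s 3) (D : Finset H) (x : H → Fin s) (c : Conf H aut.q) (n : ℕ) (v : Fin 3) : Set (Fin 3) :=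
  {j | Relation.ReflTransGen (fun i j => ∃ τ ≤ n, Near D (run aut x c τ) i j) v j}

omit hG ht hμ hx hμD hd in
theorem comp_sep (c : Conf H aut.q) (n : ℕ) (v : Fin 3) (τ : ℕ) (hτ : τ ≤ n) :
    Sep D (comp aut D x c n v) (run aut x c τ) := by
  intro i hi j hj hn
  exact hj (Relation.ReflTransGen.tail hi ⟨τ, hτ, hn⟩)

omit hG ht hμ hx hμD in
theorem comp_partner (c : Conf H aut.q) (n : ℕ) (v i j : Fin 3) (hi : i ∈ comp aut D x c n v)
    (hj : j ∈ comp aut D x c n v) (hij : i ≠ j) : ∃ w ∈ comp aut D x c n v, ∃ τ ≤ n, Near D (run aut x c τ) i w := by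
  have hsym : ∀ a b, Relation.ReflTransGen (fun i j => ∃ τ ≤ n, Near D (run aut x c τ) i j) a b →
      Relation.ReflTransGen (fun i j => ∃ τ ≤ n, Near D (run aut x c τ) i j) b a := by
    intro a b h
    induction h with
    | refl => exact .refl
    | tail _ h ih =>
      obtain ⟨τ, h1, h2⟩ := h
      exact Relation.ReflTransGen.head ⟨τ, h1, near_symm hd h2⟩ ih
  have h1 : Relation.ReflTransGen (fun i j => ∃ τ ≤ n, Near D (run aut x c τ) i j) i j :=
    (hsym _ _ hi).trans hj
  rcases Relation.ReflTransGen.cases_head h1 with h | ⟨w, hw, _⟩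
  · exact absurd h hij
  · exact ⟨w, Relation.ReflTransGen.tail hi hw, hw⟩

theorem decomp (q : ℕ) (hq : ∀ i, aut.q i ≤ q) (c : Conf H aut.q) (n : ℕ) (v i j : Fin 3)
    (hi : i ∈ comp aut D x c n v) (hj : j ∈ comp aut D x c n v) :
    gd gen γ (pos c i) (pos c j) ≤
      2 * (μ + bd1 gen q (Fintype.card Q) μ + bd2 gen q (Fintype.card Q) μ D.card) := by
  classical
  set r1 := bd1 gen q (Fintype.card Q) μ
  set r2 := bd2 gen q (Fintype.card Q) μ D.card
  by_cases hij : i = j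
  · subst hij; rw [gd_self]; omega
  have hp' : ∀ t i, run aut x c t i ≠ none → c i ≠ none := fun t i hc h => hc ((iter_none t).2 h)
  have key : ∀ i j, i ∈ comp aut D x c n v → j ∈ comp aut D x c n v → i ≠ j → ∃ w, w ≠ i ∧
      gd gen γ (pos c i) (pos c w) ≤ μ + r1 + r2 := by
    intro i j hi hj hij
    obtain ⟨w, _, τ, hτ, hn⟩ := comp_partner hd c n v i j hi hj hij
    have hex : ∃ τ, ∃ w, Near D (run aut x c τ) i w := ⟨τ, w, hn⟩
    obtain ⟨w, hw⟩ := Nat.find_spec hex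
    have gmin := fun e => Nat.find_min hex (m := e)
    set τ := Nat.find hex
    have hci : c i ≠ none := hp' τ i (by obtain ⟨_, _, _, _, _, h, _⟩ := hw; rw [h]; simp)
    have hcw : c w ≠ none := hp' τ w (by obtain ⟨_, _, _, _, _, _, h, _⟩ := hw; rw [h]; simp)
    refine ⟨w, hw.1.symm, ?_⟩
    have hlon : ∀ τ', 0 ≤ τ' → τ' < τ → Lonely D (run aut x c τ') i := fun τ' _ h w hw => gmin τ' h ⟨w, hw⟩
    have h1 := solo hG ht γ π hd hμ hx q hq c i hci 0 τ (by omega) hlon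
    have h2 := duo hG ht γ π hd hμ hx q hq c i w hcw 0 τ (by omega) hlon
    have h3 := near_gd γ hμD hw
    have h4 := gd_tri hG γ (pos c i) (pos (run aut x c τ) i) (pos c w)
    have h5 := gd_tri hG γ (pos (run aut x c τ) i) (pos (run aut x c τ) w) (pos c w)
    rw [gd_comm hG γ (pos (run aut x c τ) w) (pos c w)] at h5
    have e : run aut x c 0 = c := rfl
    rw [e] at h1 h2
    omega
  obtain ⟨w, hw, hdw⟩ := key i j hi hj hij
  obtain ⟨w', hw', hdw'⟩ := key j i hj hi (Ne.symm hij)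
  obtain ⟨l, hli, hlj, hall⟩ := third i j hij
  have h4 := gd_tri hG γ (pos c i) (pos c l) (pos c j)
  have h5 := gd_comm hG γ (pos c i) (pos c j)
  have h6 := gd_comm hG γ (pos c l) (pos c j)
  rcases hall w with rfl | rfl | rfl
  · exact absurd rfl hw
  · rcases hall w' with rfl | rfl | rfl
    · omega
    · omega
    · exact absurd rfl hw'
  · omega

end three
end FH


namespace FH
section locs
variable {H : Type*} [Group H] {s k : ℕ} {q : Fin k → ℕ}

abbrev NdT (H : Type*) {k : ℕ} (q : Fin k → ℕ) (D : Finset H) :=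
  (∀ i, Option (Fin (q i))) × (Fin k → Fin k → D → Bool)

abbrev LocT (H : Type*) {k : ℕ} (q : Fin k → ℕ) (D : Finset H) (s : ℕ) :=
  NdT H q D × (Fin k → D → Option (Fin s))

open Classical in
noncomputable def ndt (D : Finset H) (c : Conf H q) : NdT H q D :=
  (fun i => (c i).map Prod.snd, fun i j d => decide (∃ g a b, c i = some (g, a) ∧ c j = some (g * d, b)))

noncomputable def loct (D : Finset H) (x : H → Fin s) (c : Conf H q) : LocT H q D s :=
  (ndt D c, fun i d => (c i).map fun p => x (p.1 * d))

variable {D : Finset H}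

theorem ndt_state {c c' : Conf H q} (h : ndt D c = ndt D c') (i : Fin k) :
    (c i).map Prod.snd = (c' i).map Prod.snd := congrFun (congrArg Prod.fst h) i

theorem ndt_none {c c' : Conf H q} (h : ndt D c = ndt D c') (i : Fin k) :
    c i = none ↔ c' i = none := by
  have := ndt_state h i
  cases h1 : c i <;> cases h2 : c' i <;> simp_all

theorem ndt_near {c c' : Conf H q} (h : ndt D c = ndt D c') {i : Fin k} {g a g' a'}
    (h1 : c i = some (g, a)) (h2 : c' i = some (g', a')) (j : Fin k) (d : H) (hd : d ∈ D) (b)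
    (hb : c j = some (g * d, b)) : c' j = some (g' * d, b) := by
  have h3 := congrFun (congrFun (congrFun (congrArg Prod.snd h) i) j) ⟨d, hd⟩
  simp only [ndt, decide_eq_decide] at h3
  obtain ⟨g'', a'', b'', h4, h5⟩ := h3.1 ⟨g, a, b, h1, hb⟩
  rw [h2] at h4
  simp only [Option.some.injEq, Prod.mk.injEq] at h4
  obtain ⟨rfl, rfl⟩ := h4
  have h6 := ndt_state h j
  rw [hb, h5] at h6
  simp only [Option.map_some, Option.some.injEq] at h6
  rw [h5, h6]

theorem ndt_near_iff {c c' : Conf H q} (h : ndt D c = ndt D c') {i : Fin k} {g a g' a'}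
    (h1 : c i = some (g, a)) (h2 : c' i = some (g', a')) (j : Fin k) (d : H) (hd : d ∈ D) (b) :
    c j = some (g * d, b) ↔ c' j = some (g' * d, b) :=
  ⟨ndt_near h h1 h2 j d hd b, ndt_near h.symm h2 h1 j d hd b⟩

theorem rel_step {aut : GWA H s k} {M : Finset H} (hd : Dyn aut D M) {x x' : H → Fin s}
    {c c' : Conf H aut.q} (h : loct D x c = loct D x' c') {i : Fin k} {g a g' a'}
    (h1 : c i = some (g, a)) (h2 : c' i = some (g', a')) :
    stp aut x' c' i = (stp aut x c i).map fun p => (g' * g⁻¹ * p.1, p.2) := by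
  have hn : ndt D c = ndt D c' := congrArg Prod.fst h
  have e : stp aut (shiftC (g' * g⁻¹) x) (sh (g' * g⁻¹) c) i =
      (stp aut x c i).map fun p => (g' * g⁻¹ * p.1, p.2) := by
    rw [stp_sh]; rfl
  rw [← e]
  refine hd.loc i _ _ _ _ g' a' h2 ?_ ?_
  · intro d hdd
    have h3 := congrFun (congrFun (congrArg Prod.snd h) i) ⟨d, hdd⟩
    simp only [loct, h1, h2, Option.map_some, Option.some.injEq] at h3
    rw [← h3]
    simp [shiftC, mul_assoc]
  · intro j d hdd b
    rw [sh_some, ndt_near_iff hn.symm h2 h1 j d hdd b]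
    have : (g' * g⁻¹)⁻¹ * (g' * d) = g * d := by group
    rw [this]

def Sees (I : Set (YS H k q)) (c : Conf H q) : Prop := ∃ g, yshift g (ofC c) ∈ I

variable {I : Set (YS H k q)} {W : Finset H}

theorem yshift_some {g w : H} {c : Conf H q} {i : Fin k} {a} :
    (yshift g (ofC c)).1 i w = some a ↔ c i = some (g⁻¹ * w, a) := by
  rw [← ofC_sh, ofC_some, sh_some]

theorem sees_move (hW : ∀ y y' : YS H k q, (∀ w ∈ W, ∀ i, y.1 i w = y'.1 i w) → (y ∈ I ↔ y' ∈ I))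
    {c c' : Conf H q} {g g' : H} (hs : yshift g (ofC c) ∈ I)
    (h : ∀ w ∈ W, ∀ i a, c i = some (g⁻¹ * w, a) ↔ c' i = some (g'⁻¹ * w, a)) : Sees I c' := by
  refine ⟨g', (hW _ _ fun w hw i => ?_).1 hs⟩
  apply Option.ext
  intro a
  rw [yshift_some, yshift_some]
  exact h w hw i a

variable [Infinite H]

theorem sees_empty (hW : ∀ y y' : YS H k q, (∀ w ∈ W, ∀ i, y.1 i w = y'.1 i w) → (y ∈ I ↔ y' ∈ I))
    {c : Conf H q} {g : H} (hs : yshift g (ofC c) ∈ I)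
    (h : ∀ w ∈ W, ∀ i a, c i ≠ some (g⁻¹ * w, a)) (c' : Conf H q) : Sees I c' := by
  classical
  obtain ⟨g', hg'⟩ := Infinite.exists_notMem_finset
    ((Finset.univ ×ˢ W : Finset (Fin k × H)).image fun p => p.2 * (pos c' p.1)⁻¹)
  refine sees_move hW (g' := g') hs fun w hw i a => iff_of_false (h w hw i a) fun hc => hg' ?_
  refine Finset.mem_image.2 ⟨(i, w), Finset.mem_product.2 ⟨Finset.mem_univ _, hw⟩, ?_⟩
  simp [pos_eq hc]

theorem sees_transport (hW : ∀ y y' : YS H k q, (∀ w ∈ W, ∀ i, y.1 i w = y'.1 i w) → (y ∈ I ↔ y' ∈ I))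
    (hWD : ∀ w ∈ W, ∀ w' ∈ W, w⁻¹ * w' ∈ D)
    {c c' : Conf H q} (h : ndt D c = ndt D c') (hs : Sees I c) : Sees I c' := by
  obtain ⟨g, hs⟩ := hs
  by_cases hv : ∃ w ∈ W, ∃ i a, c i = some (g⁻¹ * w, a)
  · obtain ⟨w0, hw0, v, a, hc⟩ := hv
    have hne : c' v ≠ none := fun hn => by rw [← ndt_none h, hc] at hn; cases hn
    obtain ⟨⟨g', a'⟩, hc'⟩ := Option.ne_none_iff_exists'.1 hne
    refine sees_move hW (g' := w0 * g'⁻¹) hs fun w hw i b => ?_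
    have := ndt_near_iff h hc hc' i (w0⁻¹ * w) (hWD _ hw0 _ hw) b
    convert this using 3 <;> group
  · push Not at hv
    exact sees_empty hW hs hv c'

theorem sees_restr (hW : ∀ y y' : YS H k q, (∀ w ∈ W, ∀ i, y.1 i w = y'.1 i w) → (y ∈ I ↔ y' ∈ I))
    (hWD : ∀ w ∈ W, ∀ w' ∈ W, w⁻¹ * w' ∈ D) {c : Conf H q} (hs : Sees I c) :
    (∀ c', Sees I c') ∨ ∃ v, ∀ S : Set (Fin k), v ∈ S → Sep D S c → Sees I (restr S c) := by
  obtain ⟨g, hs⟩ := hs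
  by_cases hv : ∃ w ∈ W, ∃ i a, c i = some (g⁻¹ * w, a)
  · obtain ⟨w0, hw0, v, a, hc⟩ := hv
    refine Or.inr ⟨v, fun S hvS hsep => ?_⟩
    refine sees_move hW (g' := g) hs fun w hw i b => ?_
    by_cases hi : i ∈ S
    · rw [restr_mem hi]
    · rw [restr_notMem hi]
      refine iff_of_false (fun hci => ?_) (by simp)
      refine hsep v hvS i hi ⟨fun e => hi (e ▸ hvS), _, _, _, _, hc, hci, ?_⟩
      convert hWD _ hw0 _ hw using 1
      group
  · push Not at hv
    exact Or.inl (sees_empty hW hs hv)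

theorem sees_of_restr (hW : ∀ y y' : YS H k q, (∀ w ∈ W, ∀ i, y.1 i w = y'.1 i w) → (y ∈ I ↔ y' ∈ I))
    (hWD : ∀ w ∈ W, ∀ w' ∈ W, w⁻¹ * w' ∈ D) {c : Conf H q} {S : Set (Fin k)} (hsep : Sep D S c)
    (hs : Sees I (restr S c)) : Sees I c := by
  obtain ⟨g, hs⟩ := hs
  by_cases hv : ∃ w ∈ W, ∃ i a, restr S c i = some (g⁻¹ * w, a)
  · obtain ⟨w0, hw0, v, a, hc⟩ := hv
    have hvS : v ∈ S := by
      by_contra hn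
      rw [restr_notMem hn] at hc; cases hc
    rw [restr_mem hvS] at hc
    refine sees_move hW (g' := g) hs fun w hw i b => ?_
    by_cases hi : i ∈ S
    · rw [restr_mem hi]
    · rw [restr_notMem hi]
      refine iff_of_false (by simp) (fun hci => ?_)
      refine hsep v hvS i hi ⟨fun e => hi (e ▸ hvS), _, _, _, _, hc, hci, ?_⟩
      convert hWD _ hw0 _ hw using 1
      group
  · push Not at hv
    exact sees_empty hW hs hv _

end locs

section core
variable {H : Type*} [Group H] {s k : ℕ} {aut : GWA H s k} {D M : Finset H}

theorem not_mem_autSet (x : H → Fin s) : x ∉ autSet aut ↔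
    ∃ c n, Sees aut.Ini c ∧ Sees aut.Fini (run aut x c n) := by
  have key : ∀ g c n, (stp aut (shiftC g x))^[n] (sh g c) = sh g ((stp aut x)^[n] c) := by
    intro g c n
    induction n with
    | zero => rfl
    | succ n ih => rw [Function.iterate_succ_apply', Function.iterate_succ_apply', ih, stp_sh]
  constructor
  · intro h
    simp only [autSet, Set.mem_ofPred_eq] at h
    push Not at h
    obtain ⟨g, h, y, n, hy, hF⟩ := h
    have hsh : sh g (sh g⁻¹ (toC y)) = toC y := by rw [← sh_mul]; simp [sh_one]
    refine ⟨sh g⁻¹ (toC y), n, ⟨g, ?_⟩, ⟨h * g, ?_⟩⟩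
    · rw [← ofC_sh, hsh, ofC_toC]; exact hy
    · rw [yshift_mul, ← ofC_sh g, ← key, hsh]
      rw [← ofC_toC y, f_iter] at hF
      simpa [toC_ofC] using hF
  · rintro ⟨c, n, ⟨g, hg⟩, ⟨h, hh⟩⟩ hx
    refine hx g (h * g⁻¹) (yshift g (ofC c)) n hg ?_
    rw [← ofC_sh, f_iter, key, ofC_sh, ← yshift_mul]
    simpa using hh

def tauJ (aut : GWA H s k) (D : Finset H) : Set (LocT H aut.q D s) :=
  {ℓ | ∃ x c S, Sees aut.Ini c ∧ Sep D S c ∧ loct D x (restr S c) = ℓ}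

def tauF (aut : GWA H s k) (D : Finset H) : Set (LocT H aut.q D s) :=
  {ℓ | ∃ x c, Sees aut.Fini c ∧ loct D x c = ℓ}

open Classical in
theorem reach (hd : Dyn aut D M) (t : ℕ) : ∃ B : Finset H, ∀ x (c : Conf H aut.q) i, c i ≠ none →
    (pos c i)⁻¹ * pos (run aut x c t) i ∈ B := by
  induction t with
  | zero => exact ⟨{1}, fun x c i _ => by simp [run]⟩
  | succ t ih =>
    obtain ⟨B, hB⟩ := ih
    refine ⟨(B ×ˢ M).image fun p => p.1 * p.2, fun x c i hc => ?_⟩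
    simp only [run]
    rw [Function.iterate_succ_apply']
    refine Finset.mem_image.2 ⟨(_, _), Finset.mem_product.2 ⟨hB x c i hc,
      step_pos hd (x := x) (c := run aut x c t) (i := i) (fun h => hc ((iter_none t).1 h))⟩, ?_⟩
    simp [run]

variable [Infinite H] (hd : Dyn aut D M)
  {WI WF : Finset H}
  (hWI : ∀ y y' : YS H k aut.q, (∀ w ∈ WI, ∀ i, y.1 i w = y'.1 i w) → (y ∈ aut.Ini ↔ y' ∈ aut.Ini))
  (hWF : ∀ y y' : YS H k aut.q, (∀ w ∈ WF, ∀ i, y.1 i w = y'.1 i w) → (y ∈ aut.Fini ↔ y' ∈ aut.Fini))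
  (hWID : ∀ w ∈ WI, ∀ w' ∈ WI, w⁻¹ * w' ∈ D)
  (hWFD : ∀ w ∈ WF, ∀ w' ∈ WF, w⁻¹ * w' ∈ D)
include hd hWI hWF hWID hWFD

theorem rej_of_tables (x : H → Fin s) (c' : Conf H aut.q) (n : ℕ) (hJ : loct D x c' ∈ tauJ aut D)
    (hF : loct D x (run aut x c' n) ∈ tauF aut D) :
    ∃ c n, Sees aut.Ini c ∧ Sees aut.Fini (run aut x c n) := by
  classical
  obtain ⟨x0, c, S, hI, hsep, hloc⟩ := hJ
  obtain ⟨x1, c1, hF1, hloc1⟩ := hF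
  have hnd : ndt D (restr S c) = ndt D c' := congrArg Prod.fst hloc
  have hSF : Sees aut.Fini (run aut x c' n) :=
    sees_transport hWF hWFD (congrArg Prod.fst hloc1 : ndt D c1 = _) hF1
  choose B hB using fun t => reach hd t
  let BB : Finset H := (Finset.range (n + 1)).biUnion B
  obtain ⟨h, hh⟩ := Infinite.exists_notMem_finset
    ((((Finset.univ : Finset (Fin k × Fin k)) ×ˢ (BB ×ˢ BB)) ×ˢ D).image fun p =>
      pos c' p.1.1.1 * p.1.2.1 * p.2 * p.1.2.2⁻¹ * (pos c p.1.1.2)⁻¹)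
  let c3 : Conf H aut.q := fun i => if i ∈ S then c' i else sh h c i
  have hc3 : ∀ i ∈ S, c3 i = c' i := fun i hi => by simp [c3, hi]
  have hc3' : ∀ i, i ∉ S → c3 i = sh h c i := fun i hi => by simp [c3, hi]
  have hr : restr S c3 = c' := by
    funext i
    by_cases hi : i ∈ S
    · rw [restr_mem hi, hc3 i hi]
    · rw [restr_notMem hi]
      exact ((ndt_none hnd i).1 (restr_notMem hi)).symm
  have hsep3 : ∀ t ≤ n, Sep D S (run aut x c3 t) := by
    intro t htn i hi j hj hnear
    obtain ⟨hij, g, a, g', b, h1, h2, h3⟩ := hnear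
    have hi3 : c3 i ≠ none := fun hn => by simp only [run] at h1; rw [(iter_none t).2 hn] at h1; cases h1
    have hj3 : c3 j ≠ none := fun hn => by simp only [run] at h2; rw [(iter_none t).2 hn] at h2; cases h2
    have hpi := hB t x c3 i hi3
    have hpj := hB t x c3 j hj3
    rw [pos_eq h1] at hpi
    rw [pos_eq h2] at hpj
    have e1 : pos c3 i = pos c' i := by simp [pos, hc3 i hi]
    have hcj : c j ≠ none := fun hn => hj3 (by rw [hc3' j hj]; exact sh_none.2 hn)
    have e2 : pos c3 j = h * pos c j := by
      rw [← pos_sh hcj]; simp [pos, hc3' j hj]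
    rw [e1] at hpi
    rw [e2] at hpj
    have hBB : ∀ b ∈ B t, b ∈ BB := fun b hb =>
      Finset.mem_biUnion.2 ⟨t, Finset.mem_range.2 (by omega), hb⟩
    refine hh (Finset.mem_image.2 ⟨(((i, j), (_, _)), _), Finset.mem_product.2
      ⟨Finset.mem_product.2 ⟨Finset.mem_univ _, Finset.mem_product.2 ⟨hBB _ hpi, hBB _ hpj⟩⟩, h3⟩, ?_⟩)
    simp only
    group
  have hnd3 : ndt D c = ndt D c3 := by
    apply Prod.ext
    · funext i
      show (c i).map Prod.snd = (c3 i).map Prod.snd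
      by_cases hi : i ∈ S
      · rw [hc3 i hi, ← ndt_state hnd i, restr_mem hi]
      · rw [hc3' i hi]
        show _ = ((c i).map fun p => (h * p.1, p.2)).map Prod.snd
        rw [Option.map_map]; rfl
    · funext i j d
      simp only [ndt, decide_eq_decide]
      have hmix : ∀ (e : Conf H aut.q), Sep D S e → ((i ∈ S ∧ j ∉ S) ∨ (i ∉ S ∧ j ∈ S)) →
          ¬ ∃ g a b, e i = some (g, a) ∧ e j = some (g * d, b) := by
        rintro e hse hor ⟨g, a, b, h1, h2⟩
        have hne : i ≠ j := by rintro rfl; tauto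
        have hN : Near D e i j := ⟨hne, g, a, _, b, h1, h2, by simp⟩
        rcases hor with ⟨hi, hj⟩ | ⟨hi, hj⟩
        · exact hse i hi j hj hN
        · exact hse j hj i hi (near_symm hd hN)
      by_cases hi : i ∈ S <;> by_cases hj : j ∈ S
      · rw [hc3 i hi, hc3 j hj]
        have h3 := congrFun (congrFun (congrFun (congrArg Prod.snd hnd) i) j) d
        simp only [ndt, decide_eq_decide, restr_mem hi, restr_mem hj] at h3
        exact h3
      · exact iff_of_false (hmix c hsep (Or.inl ⟨hi, hj⟩)) (hmix c3 (hsep3 0 (by omega)) (Or.inl ⟨hi, hj⟩))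
      · exact iff_of_false (hmix c hsep (Or.inr ⟨hi, hj⟩)) (hmix c3 (hsep3 0 (by omega)) (Or.inr ⟨hi, hj⟩))
      · rw [hc3' i hi, hc3' j hj]
        simp only [sh_some]
        constructor
        · rintro ⟨g, a, b, h1, h2⟩
          exact ⟨h * g, a, b, by rw [h1]; simp, by rw [h2]; simp [mul_assoc]⟩
        · rintro ⟨g, a, b, h1, h2⟩
          exact ⟨h⁻¹ * g, a, b, h1, by rw [h2]; simp [mul_assoc]⟩
  refine ⟨c3, n, sees_transport hWI hWID hnd3 hI, ?_⟩
  have hrun := restr_iter hd (x := x) (c := c3) (S := S) n fun τ hτ => hsep3 τ hτ.le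
  rw [hr] at hrun
  refine sees_of_restr hWF hWFD (hsep3 n le_rfl) ?_
  simp only [run] at hSF hrun ⊢
  rw [← hrun]
  exact hSF

end core

section core3
variable {H : Type*} [Group H] {s : ℕ} {G : Type*} [Group G] {m : ℕ} {gen : Fin m → G}
  (hG : Subgroup.closure (Set.range gen) = ⊤) (ht : ∀ g : G, IsOfFinOrder g)
  {Q : Type*} [Group Q] [Fintype Q] (γ : H →* G) (π : H →* Q)
  {aut : GWA H s 3} {D M : Finset H} (hd : Dyn aut D M) {μ : ℕ}
  (hμ : ∀ h ∈ M, wordNorm gen (γ h) ≤ μ) (hμD : ∀ h ∈ D, wordNorm gen (γ h) ≤ μ)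
  {x : H → Fin s} (hx : ∀ h, π h = 1 → shiftC h x = x) [Infinite H]
  {WF : Finset H}
  (hWF : ∀ y y' : YS H 3 aut.q, (∀ w ∈ WF, ∀ i, y.1 i w = y'.1 i w) → (y ∈ aut.Fini ↔ y' ∈ aut.Fini))
  (hWFD : ∀ w ∈ WF, ∀ w' ∈ WF, w⁻¹ * w' ∈ D)

/-- the global distance bound -/
noncomputable def bd3 (gen : Fin m → G) (q P μ D : ℕ) : ℕ :=
  2 * (μ + bd1 gen q P μ + bd2 gen q P μ D) + 6 * μ + 2 * bd1 gen q P μ + 2 * bd2 gen q P μ D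

include hG ht hd hμ hμD hx hWF hWFD
theorem tables_of_rej (q : ℕ) (hq : ∀ i, aut.q i ≤ q) (c : Conf H aut.q) (n : ℕ)
    (hI : Sees aut.Ini c) (hF : Sees aut.Fini (run aut x c n)) :
    ∃ c', loct D x c' ∈ tauJ aut D ∧ loct D x (run aut x c' n) ∈ tauF aut D ∧
      ∀ t i j, c' i ≠ none → c' j ≠ none →
        gd gen γ (pos (run aut x c' t) i) (pos (run aut x c' t) j) ≤ bd3 gen q (Fintype.card Q) μ D.card := by
  have main : ∀ S : Set (Fin 3), (∀ τ ≤ n, Sep D S (run aut x c τ)) →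
      Sees aut.Fini (restr S (run aut x c n)) →
      (∀ i ∈ S, ∀ j ∈ S, gd gen γ (pos c i) (pos c j) ≤
        2 * (μ + bd1 gen q (Fintype.card Q) μ + bd2 gen q (Fintype.card Q) μ D.card)) →
      ∃ c', loct D x c' ∈ tauJ aut D ∧ loct D x (run aut x c' n) ∈ tauF aut D ∧
      ∀ t i j, c' i ≠ none → c' j ≠ none →
        gd gen γ (pos (run aut x c' t) i) (pos (run aut x c' t) j) ≤ bd3 gen q (Fintype.card Q) μ D.card := by
    intro S hS hSF hdist
    refine ⟨restr S c, ⟨x, c, S, hI, hS 0 (by omega), rfl⟩, ⟨x, _, hSF, ?_⟩, ?_⟩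
    · have := restr_iter hd (x := x) (c := c) (S := S) n fun τ hτ => hS τ hτ.le
      simp only [run]
      rw [this]
    · intro t i j hi hj
      refine forward hG ht γ π hd hμ hμD hx q hq (restr S c) _ ?_ t i j hi hj
      intro i j hi hj
      have hmem : ∀ i, restr S c i ≠ none → i ∈ S := fun i h => by
        by_contra hn
        exact h (restr_notMem hn)
      rw [pos_restr (hmem i hi), pos_restr (hmem j hj)]
      exact hdist i (hmem i hi) j (hmem j hj)
  rcases sees_restr hWF hWFD hF with h | ⟨v, hv⟩
  · refine main ∅ (fun τ _ i hi => absurd hi (by simp)) (h _) (fun i hi => absurd hi (by simp))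
  · refine main (comp aut D x c n v) (fun τ hτ => comp_sep c n v τ hτ)
      (hv _ Relation.ReflTransGen.refl (comp_sep c n v n le_rfl)) ?_
    intro i hi j hj
    exact decomp hG ht γ π hd hμ hμD hx q hq c n v i j hi hj

end core3
end FH


namespace FH
section codes
variable {m : ℕ}

/-- digit of a letter -/
def dig (l : Fin m × Bool) : ℕ := 2 * l.1.val + (if l.2 then 1 else 0)

theorem dig_lt (l : Fin m × Bool) : dig l < 2 * m := by
  obtain ⟨⟨i, hi⟩, b⟩ := l
  cases b <;> simp [dig] <;> omega

theorem dig_inj {l l' : Fin m × Bool} (h : dig l = dig l') : l = l' := by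
  obtain ⟨⟨i, hi⟩, b⟩ := l
  obtain ⟨⟨j, hj⟩, b'⟩ := l'
  cases b <;> cases b' <;> simp [dig] at h ⊢ <;> omega

theorem wordCode_nil : wordCode ([] : List (Fin m × Bool)) = 0 := rfl

theorem wordCode_snoc (w : List (Fin m × Bool)) (l) :
    wordCode (w ++ [l]) = wordCode w * (2 * m) + (dig l + 1) := by
  simp [wordCode, dig]

theorem wordCode_inj {w w' : List (Fin m × Bool)} (h : wordCode w = wordCode w') : w = w' := by
  induction w using List.reverseRecOn generalizing w' with
  | nil =>
    rcases List.eq_nil_or_concat w' with rfl | ⟨v, l, rfl⟩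
    · rfl
    · rw [List.concat_eq_append, wordCode_snoc] at h
      rw [wordCode_nil] at h; omega
  | append_singleton w l ih =>
    rcases List.eq_nil_or_concat w' with rfl | ⟨v, l', rfl⟩
    · rw [wordCode_snoc, wordCode_nil] at h; omega
    · rw [List.concat_eq_append] at h ⊢
      rw [wordCode_snoc, wordCode_snoc] at h
      have h1 := dig_lt l
      have h2 := dig_lt l'
      have h' : dig l + 2 * m * wordCode w = dig l' + 2 * m * wordCode v := by
        rw [mul_comm (2 * m), mul_comm (2 * m)]; omega
      have e1 := congrArg (· % (2 * m)) h'
      simp only [Nat.add_mul_mod_self_left, Nat.mod_eq_of_lt h1, Nat.mod_eq_of_lt h2] at e1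
      have e2 : wordCode w = wordCode v := by
        rw [e1] at h'
        exact Nat.eq_of_mul_eq_mul_left (by omega : 0 < 2 * m) (by omega)
      rw [ih e2, dig_inj e1]

theorem wordCode_lt (w : List (Fin m × Bool)) : wordCode w < (2 * m + 2) ^ w.length := by
  induction w using List.reverseRecOn with
  | nil => simp [wordCode]
  | append_singleton w l ih =>
    rw [wordCode_snoc, List.length_append, List.length_singleton, pow_succ]
    have h1 := dig_lt l
    have : (wordCode w + 1) * (2 * m + 2) ≤ (2 * m + 2) ^ w.length * (2 * m + 2) :=
      Nat.mul_le_mul_right _ ih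
    nlinarith

theorem wordCode_primrec : Primrec (wordCode : List (Fin m × Bool) → ℕ) := by
  have h : Primrec (fun p : List (Fin m × Bool) × (ℕ × (Fin m × Bool)) =>
      p.2.1 * (2 * m) + (2 * p.2.2.1.val + (if p.2.2.2 then 1 else 0) + 1)) :=
    Primrec.nat_add.comp (Primrec.nat_mul.comp (Primrec.fst.comp Primrec.snd) (Primrec.const _))
      ((Primrec.dom_finite (fun l : Fin m × Bool => 2 * l.1.val + (if l.2 then 1 else 0) + 1)).comp
        (Primrec.snd.comp Primrec.snd))
  exact Primrec.list_foldl Primrec.id (Primrec.const 0) h.to₂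

theorem invW_primrec : Primrec (invW : List (Fin m × Bool) → List (Fin m × Bool)) :=
  Primrec.list_reverse.comp (Primrec.list_map Primrec.id
    ((Primrec.dom_finite (fun l : Fin m × Bool => (l.1, !l.2))).comp Primrec.snd).to₂)

/-- oracle answers -/
def Ora (u : List Bool) (b : Bool) (w : List (Fin m × Bool)) : Prop := u[wordCode w]? = some b

theorem ora_primrec {α : Type*} [Primcodable α] {u : α → List Bool} (b : Bool)
    {w : α → List (Fin m × Bool)} (hu : Primrec u) (hw : Primrec w) :
    PrimrecPred fun a => Ora (u a) b (w a) :=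
  Primrec.eq.comp (Primrec.list_getElem?.comp hu (wordCode_primrec.comp hw)) (Primrec.const (some b))

variable {G : Type*} [Group G] {gen : Fin m → G}

theorem mem_wp (w : List (Fin m × Bool)) : wordCode w ∈ WordProblem gen ↔ evalWord gen w = 1 :=
  ⟨fun ⟨_, h, h'⟩ => wordCode_inj h ▸ h', fun h => ⟨w, rfl, h⟩⟩

theorem ora_true {N : ℕ} {w : List (Fin m × Bool)} (h : Ora (charPrefix (WordProblem gen) N) true w) :
    evalWord gen w = 1 := by
  rw [Ora, charPrefix, List.getElem?_map] at h
  simp only [Option.map_eq_some_iff, charSeq] at h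
  obtain ⟨a, h1, h2⟩ := h
  have := (List.getElem?_eq_some_iff.1 h1)
  obtain ⟨h3, h4⟩ := this
  simp only [List.getElem_range] at h4
  subst h4
  exact (mem_wp w).1 (by simpa using h2)

theorem ora_false {N : ℕ} {w : List (Fin m × Bool)} (h : Ora (charPrefix (WordProblem gen) N) false w) :
    evalWord gen w ≠ 1 := by
  rw [Ora, charPrefix, List.getElem?_map] at h
  simp only [Option.map_eq_some_iff, charSeq] at h
  obtain ⟨a, h1, h2⟩ := h
  have := (List.getElem?_eq_some_iff.1 h1)
  obtain ⟨h3, h4⟩ := this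
  simp only [List.getElem_range] at h4
  subst h4
  exact fun h' => absurd ((mem_wp w).2 h') (by simpa using h2)

open Classical in
theorem ora_mk {N ℓ : ℕ} {w : List (Fin m × Bool)} (h : w.length ≤ ℓ) (hN : (2 * m + 2) ^ ℓ ≤ N) :
    Ora (charPrefix (WordProblem gen) N) (decide (evalWord gen w = 1)) w := by
  have h1 : wordCode w < N := (wordCode_lt w).trans_le ((Nat.pow_le_pow_right (by omega) h).trans hN)
  rw [Ora, charPrefix, List.getElem?_map, List.getElem?_range h1]
  simp only [Option.map_some, charSeq, mem_wp]

end codes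

section prim
variable {α : Type*} [Primcodable α]

theorem pp_const (p : Prop) : PrimrecPred fun _ : α => p := by
  classical
  by_cases h : p
  · exact (Primrec.eq.comp (Primrec.const 0) (Primrec.const 0)).of_eq fun a => by simp [h]
  · exact (Primrec.eq.comp (Primrec.const 0) (Primrec.const 1)).of_eq fun a => by simp [h]

theorem pp_imp {p q : α → Prop} (hp : PrimrecPred p) (hq : PrimrecPred q) :
    PrimrecPred fun a => p a → q a :=
  (hp.not.or hq).of_eq fun a => by tauto

theorem pp_imp_const {p : Prop} {q : α → Prop} (hq : p → PrimrecPred q) :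
    PrimrecPred fun a => p → q a := by
  by_cases h : p
  · exact (hq h).of_eq fun a => by simp [h]
  · exact (pp_const True).of_eq fun a => by simp [h]

theorem pp_all {ι : Type*} [Finite ι] {p : ι → α → Prop} (hp : ∀ i, PrimrecPred (p i)) :
    PrimrecPred fun a => ∀ i, p i a := by
  classical
  cases nonempty_fintype ι
  have : ∀ l : Finset ι, PrimrecPred fun a => ∀ i ∈ l, p i a := by
    intro l
    induction l using Finset.induction_on with
    | empty => exact (pp_const True).of_eq fun a => by simp
    | insert i l _ ih => exact ((hp i).and ih).of_eq fun a => by simp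
  exact (this Finset.univ).of_eq fun a => by simp

/-- case distinction over a finite parameter -/
theorem pp_cases {ι : Type*} [Finite ι] [Primcodable ι] {f : α → ι} (hf : Primrec f) {p : ι → α → Prop}
    (hp : ∀ i, PrimrecPred (p i)) : PrimrecPred fun a => p (f a) a := by
  classical
  exact (pp_all fun i => pp_imp (Primrec.eq.comp hf (Primrec.const i)) (hp i)).of_eq fun a =>
    ⟨fun h => h _ rfl, fun h i hi => hi ▸ h⟩

theorem pp_exists_re {β : Type*} [Primcodable β] {p : α × β → Prop} (hp : PrimrecPred p) :
    ∃ χ : α →. ℕ, Partrec χ ∧ ∀ a, (χ a).Dom ↔ ∃ b, p (a, b) := by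
  classical
  let f : α → ℕ → Bool := fun a n => ((Encodable.decode (α := β) n).map fun b => decide (p (a, b))).getD false
  have hf : Primrec₂ f := by
    refine Primrec.option_getD.comp (Primrec.option_map (Primrec.decode.comp Primrec.snd) ?_)
      (Primrec.const false)
    exact (hp.decide.comp ((Primrec.fst.comp Primrec.fst).pair Primrec.snd)).to₂
  refine ⟨fun a => Nat.rfind fun n => Part.some (f a n), Partrec.rfind hf.to_comp.partrec₂, fun a => ?_⟩
  refine Iff.trans (Nat.rfind_dom (p := fun n => Part.some (f a n))) ?_
  constructor
  · rintro ⟨n, hn, -⟩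
    simp only [Part.mem_some_iff, f] at hn
    cases h : Encodable.decode (α := β) n with
    | none => simp [h] at hn
    | some b => exact ⟨b, by simpa [h] using hn⟩
  · rintro ⟨b, hb⟩
    exact ⟨Encodable.encode b, by simp [f, hb], fun _ => trivial⟩

end prim
end FH


namespace FH
section cert
variable {G : Type*} [Group G] {m : ℕ} {k : ℕ}

/-- the group on which automata walk -/
abbrev HZ (G : Type*) := G × Multiplicative ℤ

open Classical in
/-- the periodic configurations -/
noncomputable def xP (G : Type*) (P : ℕ) : HZ G → Fin 2 :=
  fun h => if (P : ℤ) ∣ Multiplicative.toAdd h.2 then 1 else 0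

def dz (h : HZ G) : ℤ := Multiplicative.toAdd h.2
def dp (h : HZ G) : ℕ := (dz h).toNat
def dn (h : HZ G) : ℕ := (-dz h).toNat

theorem dz_eq (h : HZ G) : (dz h : ℤ) = dp h - dn h := by
  simp only [dp, dn]; omega

theorem xP_apply {P : ℕ} (hP : 0 < P) (g : G) (z : ℕ) (d : HZ G) :
    xP G P ((g, Multiplicative.ofAdd (z : ℤ)) * d) = if (z + dp d + (P - 1) * dn d) % P = 0 then 1 else 0 := by
  unfold xP
  have e : Multiplicative.toAdd ((g, Multiplicative.ofAdd (z : ℤ)) * d).2 = (z : ℤ) + dz d := by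
    simp [dz]
  rw [e, dz_eq]
  congr 1
  rw [← Nat.dvd_iff_mod_eq_zero, ← Int.natCast_dvd_natCast]
  push_cast [Nat.cast_sub (show 1 ≤ P from hP)]
  have : (z : ℤ) + dp d + ((P : ℤ) - 1) * dn d = (z + (dp d - dn d)) + P * dn d := by ring
  rw [this, dvd_add_left (dvd_mul_right _ _)]

variable {q : Fin k → ℕ} {D : Finset (HZ G)} (wd : G → List (Fin m × Bool))

/-- consistency of a local table entry with the oracle -/
def Good (u : List Bool) (P : ℕ) (ℓ : LocT (HZ G) q D 2) (w : Fin k → List (Fin m × Bool))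
    (z : Fin k → ℕ) : Prop :=
  (∀ i j d, (ℓ.1.2 i j d = true → ℓ.1.1 i ≠ none ∧ ℓ.1.1 j ≠ none ∧ z j + dn d.1 = z i + dp d.1 ∧
      Ora u true (invW (w i) ++ w j ++ invW (wd d.1.1))) ∧
    (ℓ.1.2 i j d = false → ℓ.1.1 i = none ∨ ℓ.1.1 j = none ∨ z j + dn d.1 ≠ z i + dp d.1 ∨
      Ora u false (invW (w i) ++ w j ++ invW (wd d.1.1)))) ∧
  ∀ i d, (ℓ.1.1 i = none → ℓ.2 i d = none) ∧
    (ℓ.1.1 i ≠ none → ((z i + dp d.1 + (P - 1) * dn d.1) % P = 0 → ℓ.2 i d = some 1) ∧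
      (¬ (z i + dp d.1 + (P - 1) * dn d.1) % P = 0 → ℓ.2 i d = some 0))

/-- consistency of a step -/
def StepOK (u : List Bool) (nx : ∀ i : Fin k, Option (HZ G × Fin (q i))) (ℓ' : LocT (HZ G) q D 2)
    (w : Fin k → List (Fin m × Bool)) (z : Fin k → ℕ)
    (w' : Fin k → List (Fin m × Bool)) (z' : Fin k → ℕ) : Prop :=
  (∀ i, ℓ'.1.1 i = (nx i).map Prod.snd) ∧
  (∀ i, nx i ≠ none → z' i + dn (pos nx i) = z i + dp (pos nx i)) ∧
  (∀ i j, nx i ≠ none → nx j ≠ none → Ora u true (invW (w' j) ++ w' i ++ invW (wd (pos nx i).1) ++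
    invW (w i) ++ w j ++ wd (pos nx j).1))

section pr
variable {α : Type*} [Primcodable α] {u : α → List Bool} {P : α → ℕ}
  {w w' : α → Fin k → List (Fin m × Bool)} {z z' : α → Fin k → ℕ}
  (hu : Primrec u) (hP : Primrec P) (hw : Primrec w) (hz : Primrec z) (hw' : Primrec w') (hz' : Primrec z')

theorem app_pr {σ : Type*} [Primcodable σ] {f : α → Fin k → σ} (hf : Primrec f) (i : Fin k) :
    Primrec fun a => f a i := Primrec.fin_app.comp hf (Primrec.const i)

include hu hP hw hz in
theorem good_pr (ℓ : LocT (HZ G) q D 2) : PrimrecPred fun a => Good wd (u a) (P a) ℓ (w a) (z a) := by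
  have hword : ∀ i j (d : D), Primrec fun a => invW (w a i) ++ w a j ++ invW (wd d.1.1) := fun i j d =>
    Primrec.list_append.comp (Primrec.list_append.comp (invW_primrec.comp (app_pr hw i)) (app_pr hw j))
      (Primrec.const _)
  have heq : ∀ i j (d : D), PrimrecPred fun a => z a j + dn d.1 = z a i + dp d.1 := fun i j d =>
    Primrec.eq.comp (Primrec.nat_add.comp (app_pr hz j) (Primrec.const _))
      (Primrec.nat_add.comp (app_pr hz i) (Primrec.const _))
  have hmod : ∀ i (d : D), PrimrecPred fun a => (z a i + dp d.1 + (P a - 1) * dn d.1) % P a = 0 := fun i d =>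
    Primrec.eq.comp (Primrec.nat_mod.comp (Primrec.nat_add.comp
      (Primrec.nat_add.comp (app_pr hz i) (Primrec.const _))
      (Primrec.nat_mul.comp (Primrec.nat_sub.comp hP (Primrec.const 1)) (Primrec.const _))) hP)
      (Primrec.const 0)
  refine PrimrecPred.and ?_ ?_
  · refine pp_all fun i => pp_all fun j => pp_all fun d => PrimrecPred.and (pp_imp_const fun _ => ?_)
      (pp_imp_const fun _ => ?_)
    · exact (pp_const _).and ((pp_const _).and ((heq i j d).and (ora_primrec true hu (hword i j d))))
    · exact (pp_const _).or ((pp_const _).or ((heq i j d).not.or (ora_primrec false hu (hword i j d))))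
  · refine pp_all fun i => pp_all fun d => PrimrecPred.and (pp_const _) (pp_imp_const fun _ => ?_)
    exact (pp_imp (hmod i d) (pp_const _)).and (pp_imp (hmod i d).not (pp_const _))

include hu hw hz hw' hz' in
theorem step_pr (nx : ∀ i : Fin k, Option (HZ G × Fin (q i))) (ℓ' : LocT (HZ G) q D 2) :
    PrimrecPred fun a => StepOK wd (u a) nx ℓ' (w a) (z a) (w' a) (z' a) := by
  refine (pp_const _).and (PrimrecPred.and ?_ ?_)
  · refine pp_all fun i => pp_imp_const fun _ => ?_
    exact Primrec.eq.comp (Primrec.nat_add.comp (app_pr hz' i) (Primrec.const _))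
      (Primrec.nat_add.comp (app_pr hz i) (Primrec.const _))
  · refine pp_all fun i => pp_all fun j => pp_imp_const fun _ => pp_imp_const fun _ => ?_
    refine ora_primrec true hu ?_
    refine Primrec.list_append.comp (Primrec.list_append.comp (Primrec.list_append.comp
      (Primrec.list_append.comp (Primrec.list_append.comp ?_ ?_) ?_) ?_) ?_) ?_
    · exact invW_primrec.comp (app_pr hw' j)
    · exact app_pr hw' i
    · exact Primrec.const _
    · exact invW_primrec.comp (app_pr hw i)
    · exact app_pr hw j
    · exact Primrec.const _

end pr

variable {gen : Fin m → G} (hwd : ∀ g, evalWord gen (wd g) = g)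

/-- the configuration described by an item -/
def cf (gen : Fin m → G) (ℓ : LocT (HZ G) q D 2) (w : Fin k → List (Fin m × Bool)) (z : Fin k → ℕ) (h : G) :
    Conf (HZ G) q :=
  fun i => (ℓ.1.1 i).map fun a => ((h * evalWord gen (w i), Multiplicative.ofAdd (z i : ℤ)), a)

theorem hz_eq (a b : G) (x y : ℕ) (d : HZ G) :
    ((b, Multiplicative.ofAdd (y : ℤ)) : HZ G) = (a, Multiplicative.ofAdd (x : ℤ)) * d ↔
      a⁻¹ * b * d.1⁻¹ = 1 ∧ y + dn d = x + dp d := by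
  have e := dz_eq d
  obtain ⟨d1, d2⟩ := d
  simp only [Prod.mk_mul_mk, Prod.mk.injEq]
  refine and_congr ?_ ?_
  · rw [mul_inv_eq_one, inv_mul_eq_iff_eq_mul]
  · rw [← Multiplicative.toAdd.injective.eq_iff, toAdd_mul, toAdd_ofAdd, toAdd_ofAdd]
    simp only [dz] at e
    rw [e]
    omega

open Classical in
include hwd in
theorem good_near {N : ℕ} {P : ℕ} {ℓ : LocT (HZ G) q D 2} {w z} (hP : 0 < P)
    (hg : Good wd (charPrefix (WordProblem gen) N) P ℓ w z) (h : G) :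
    loct D (xP G P) (cf gen ℓ w z h) = ℓ := by
  obtain ⟨h1, h2⟩ := hg
  apply Prod.ext
  · apply Prod.ext
    · funext i
      simp only [loct, ndt, cf, Option.map_map]
      cases ℓ.1.1 i <;> rfl
    · funext i j d
      obtain ⟨h3, h4⟩ := h1 i j d
      have key : (∃ g a b, cf gen ℓ w z h i = some (g, a) ∧ cf gen ℓ w z h j = some (g * d, b)) ↔
          ℓ.1.1 i ≠ none ∧ ℓ.1.1 j ≠ none ∧ evalWord gen (invW (w i) ++ w j ++ invW (wd d.1.1)) = 1 ∧
          z j + dn d.1 = z i + dp d.1 := by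
        simp only [cf]
        cases ei : ℓ.1.1 i with
        | none => simp
        | some a =>
          cases ej : ℓ.1.1 j with
          | none => simp
          | some b =>
            have := hz_eq (h * evalWord gen (w i)) (h * evalWord gen (w j)) (z i) (z j) d.1
            simp only [evalWord_append, evalWord_inv, hwd]
            rw [show (h * evalWord gen (w i))⁻¹ * (h * evalWord gen (w j)) * d.1.1⁻¹ =
              (evalWord gen (w i))⁻¹ * evalWord gen (w j) * d.1.1⁻¹ by group] at this
            simp only [Option.map_some, Option.some.injEq, ne_eq, reduceCtorEq, not_false_eq_true, true_and]
            rw [← this]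
            constructor
            · rintro ⟨g, a', b', h5, h6⟩
              rw [Prod.mk.injEq] at h5 h6
              rw [h6.1, ← h5.1]
            · intro h5
              exact ⟨_, _, _, rfl, by rw [h5]⟩
      simp only [loct, ndt]
      cases hb : ℓ.1.2 i j d with
      | true =>
        obtain ⟨h5, h6, h7, h8⟩ := h3 hb
        rw [decide_eq_true_iff, key]
        exact ⟨h5, h6, ora_true h8, h7⟩
      | false =>
        rw [decide_eq_false_iff_not, key]
        rintro ⟨h5, h6, h7, h8⟩
        rcases h4 hb with h | h | h | h
        · exact h5 h
        · exact h6 h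
        · exact h h8
        · exact ora_false h h7
  · funext i d
    obtain ⟨h3, h4⟩ := h2 i d
    simp only [loct, cf]
    cases ei : ℓ.1.1 i with
    | none => rw [h3 ei]; rfl
    | some a =>
      obtain ⟨h5, h6⟩ := h4 (by simp [ei])
      simp only [Option.map_some]
      rw [xP_apply hP]
      split_ifs with h
      · exact (h5 h).symm
      · exact (h6 h).symm

open Classical in
include hwd in
theorem good_mk {N ℓ₀ : ℕ} {P : ℕ} (hP : 0 < P) {c : Conf (HZ G) q} {w z} {h : G}
    (hc : cf gen (loct D (xP G P) c) w z h = c)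
    (hlen : ∀ i j, ∀ d ∈ D, c i ≠ none → c j ≠ none → (invW (w i) ++ w j ++ invW (wd d.1)).length ≤ ℓ₀)
    (hN : (2 * m + 2) ^ ℓ₀ ≤ N) :
    Good wd (charPrefix (WordProblem gen) N) P (loct D (xP G P) c) w z := by
  set ℓ := loct D (xP G P) c with hℓ
  have hst : ∀ i, ℓ.1.1 i = (c i).map Prod.snd := fun i => rfl
  have hci : ∀ i a, ℓ.1.1 i = some a →
      c i = some ((h * evalWord gen (w i), Multiplicative.ofAdd (z i : ℤ)), a) := by
    intro i a ha
    rw [← hc]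
    simp only [cf, ha, Option.map_some]
  have hnn : ∀ i, ℓ.1.1 i = none ↔ c i = none := fun i => by rw [hst]; simp
  refine ⟨fun i j d => ?_, fun i d => ?_⟩
  · have hor : c i ≠ none → c j ≠ none → _ := fun hi hj =>
      ora_mk (gen := gen) (hlen i j d.1 d.2 hi hj) hN
    have hev : ℓ.1.2 i j d = true ↔ ∃ g a b, c i = some (g, a) ∧ c j = some (g * d, b) := by
      show decide _ = true ↔ _
      rw [decide_eq_true_iff]
    have hq : ∀ a b, ℓ.1.1 i = some a → ℓ.1.1 j = some b → (ℓ.1.2 i j d = true ↔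
        evalWord gen (invW (w i) ++ w j ++ invW (wd d.1.1)) = 1 ∧ z j + dn d.1 = z i + dp d.1) := by
      intro a b ha hb
      have := hz_eq (h * evalWord gen (w i)) (h * evalWord gen (w j)) (z i) (z j) d.1
      simp only [evalWord_append, evalWord_inv, hwd]
      rw [show (h * evalWord gen (w i))⁻¹ * (h * evalWord gen (w j)) * d.1.1⁻¹ =
        (evalWord gen (w i))⁻¹ * evalWord gen (w j) * d.1.1⁻¹ by group] at this
      rw [← this, hev, hci i a ha, hci j b hb]
      constructor
      · rintro ⟨g, a', b', h5, h6⟩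
        simp only [Option.some.injEq] at h5 h6
        rw [Prod.mk.injEq] at h5 h6
        rw [h6.1, ← h5.1]
      · intro h5
        exact ⟨_, _, _, rfl, by rw [h5]⟩
    constructor
    · intro ht
      obtain ⟨g, a, b, h1, h2⟩ := hev.1 ht
      have hi : c i ≠ none := by simp [h1]
      have hj : c j ≠ none := by simp [h2]
      obtain ⟨h3, h4⟩ := (hq a b (by simp [hst, h1]) (by simp [hst, h2])).1 ht
      refine ⟨by simpa [hst] using hi, by simpa [hst] using hj, h4, ?_⟩
      have := hor hi hj
      rwa [decide_eq_true h3] at this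
    · intro hf
      cases ei : ℓ.1.1 i with
      | none => exact Or.inl rfl
      | some a =>
        cases ej : ℓ.1.1 j with
        | none => exact Or.inr (Or.inl rfl)
        | some b =>
          refine Or.inr (Or.inr ?_)
          by_contra hcon
          push Not at hcon
          have h1 : ¬ _ := fun h' => hcon.2 (by
            have := hor (by rw [hci i a ei]; simp) (by rw [hci j b ej]; simp)
            rwa [decide_eq_false h'] at this)
          have := (hq a b ei ej).2 ⟨not_not.1 h1, hcon.1⟩
          rw [this] at hf; cases hf
  · constructor
    · intro h0
      rw [hnn] at h0
      simp [hℓ, loct, h0]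
    · intro h0
      obtain ⟨a, ha⟩ := Option.ne_none_iff_exists'.1 h0
      have : ℓ.2 i d = some (xP G P ((h * evalWord gen (w i), Multiplicative.ofAdd (z i : ℤ)) * d)) := by
        simp only [hℓ, loct, hci i a ha, Option.map_some]
      rw [this, xP_apply hP]
      constructor <;> intro h' <;> simp [h']

end cert
end FH


namespace FH
set_option linter.unusedSectionVars false

theorem exists_nx {H : Type*} [Group H] {s k : ℕ} {aut : GWA H s k} {D M : Finset H} (hd : Dyn aut D M) :
    ∃ nx : LocT H aut.q D s → Conf H aut.q, ∀ x c i,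
      stp aut x c i = (nx (loct D x c) i).map (fun p => (pos c i * p.1, p.2)) ∧
      (nx (loct D x c) i ≠ none → pos (nx (loct D x c)) i ∈ M) := by
  classical
  refine ⟨fun ℓ => if h : ∃ p : (H → Fin s) × Conf H aut.q, loct D p.1 p.2 = ℓ then
    fun i => (stp aut h.choose.1 h.choose.2 i).map fun p => ((pos h.choose.2 i)⁻¹ * p.1, p.2)
    else fun _ => none, fun x c i => ?_⟩
  have h : ∃ p : (H → Fin s) × Conf H aut.q, loct D p.1 p.2 = loct D x c := ⟨(x, c), rfl⟩
  simp only [dif_pos h]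
  have h2 := h.choose_spec
  generalize h.choose = p at h2
  obtain ⟨x0, c0⟩ := p
  simp only at h2 ⊢
  have hn : ndt D c0 = ndt D c := congrArg Prod.fst h2
  cases h3 : c i with
  | none =>
    have h4 : c0 i = none := (ndt_none hn i).2 h3
    have h5 : stp aut x c i = none := (stp_none aut).2 h3
    have h6 : stp aut x0 c0 i = none := (stp_none aut).2 h4
    simp [h5, h6]
  | some p =>
    obtain ⟨g, a⟩ := p
    have h4 : c0 i ≠ none := fun h4 => by rw [(ndt_none hn i).1 h4] at h3; cases h3
    obtain ⟨⟨g0, a0⟩, h5⟩ := Option.ne_none_iff_exists'.1 h4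
    have h6 := rel_step hd h2 h5 h3
    obtain ⟨⟨g1, a1⟩, h7⟩ := Option.ne_none_iff_exists'.1 (mt (stp_none aut (x := x0)).1 h4)
    have h8 := hd.mov i x0 c0 _ _ _ _ h5 h7
    rw [h6, h7, pos_eq h5, pos_eq h3]
    refine ⟨by simp [mul_assoc], fun _ => ?_⟩
    simp [pos, h7, h5]
    exact h8

section
variable {G : Type*} [Group G] {m : ℕ} {k : ℕ} {gen : Fin m → G}
  {wd : G → List (Fin m × Bool)} (hwd : ∀ g, evalWord gen (wd g) = g)
  {aut : GWA (HZ G) 2 k} {D M : Finset (HZ G)}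
  {nx : LocT (HZ G) aut.q D 2 → Conf (HZ G) aut.q}
  (hnx : ∀ x c i, stp aut x c i = (nx (loct D x c) i).map (fun p => (pos c i * p.1, p.2)) ∧
      (nx (loct D x c) i ≠ none → pos (nx (loct D x c)) i ∈ M))

include hwd hnx
theorem step_sound {N : ℕ} {x : HZ G → Fin 2} {ℓ ℓ' : LocT (HZ G) aut.q D 2} {w w' z z'} {h : G}
    (hc : loct D x (cf gen ℓ w z h) = ℓ)
    (hs : StepOK wd (charPrefix (WordProblem gen) N) (nx ℓ) ℓ' w z w' z') :
    ∃ h', stp aut x (cf gen ℓ w z h) = cf gen ℓ' w' z' h' := by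
  obtain ⟨h1, h2, h3⟩ := hs
  have hstp : ∀ i, stp aut x (cf gen ℓ w z h) i = _ := fun i => (hnx x (cf gen ℓ w z h) i).1
  rw [hc] at hstp
  by_cases hne : ∃ j, nx ℓ j ≠ none
  · obtain ⟨j, hj⟩ := hne
    refine ⟨h * evalWord gen (w j) * (pos (nx ℓ) j).1 * (evalWord gen (w' j))⁻¹, ?_⟩
    funext i
    have hi1 := h1 i
    rw [hstp i]
    cases hi : nx ℓ i with
    | none => simp [cf, hi1, hi]
    | some p =>
      obtain ⟨mv, b⟩ := p
      have hin : nx ℓ i ≠ none := by simp [hi]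
      have hz := h2 i hin
      have ho := ora_true (h3 i j hin hj)
      rw [pos_eq hi] at hz ho
      simp only [evalWord_append, evalWord_inv, hwd] at ho
      have hci : cf gen ℓ w z h i ≠ none := by
        rw [Ne, ← stp_none aut (x := x), hstp i, hi]; simp
      obtain ⟨⟨g, a⟩, hci'⟩ := Option.ne_none_iff_exists'.1 hci
      have hpos : pos (cf gen ℓ w z h) i = (h * evalWord gen (w i), Multiplicative.ofAdd (z i : ℤ)) := by
        rw [pos_eq hci']
        simp only [cf, Option.map_eq_some_iff] at hci'
        obtain ⟨a', _, h5⟩ := hci'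
        rw [Prod.mk.injEq] at h5
        exact h5.1.symm
      rw [hpos]
      simp only [cf, hi1, hi, Option.map_some, Option.some.injEq, Prod.mk.injEq, and_true]
      symm
      rw [hz_eq]
      refine ⟨?_, hz⟩
      have key : ∀ a b c d e f : G, a⁻¹ * b * c⁻¹ * d⁻¹ * e * f = 1 →
          (h * d)⁻¹ * (h * e * f * a⁻¹ * b) * c⁻¹ = 1 := by
        intro a b c d e f hh
        have : (h * d)⁻¹ * (h * e * f * a⁻¹ * b) * c⁻¹ =
          (e * f)⁻¹ ⁻¹ * 1 * (e * f)⁻¹ * (d⁻¹ * e * f * (a⁻¹ * b * c⁻¹ * d⁻¹ * e * f) * (d⁻¹ * e * f)⁻¹ ) := by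
            rw [hh]
            have e2 : a⁻¹ * b * c⁻¹ = (d⁻¹ * e * f)⁻¹ := by
              rw [← mul_eq_one_iff_eq_inv]; simpa [mul_assoc] using hh
            have : (h * d)⁻¹ * (h * e * f * a⁻¹ * b) * c⁻¹ = d⁻¹ * e * f * (a⁻¹ * b * c⁻¹) := by group
            rw [this, e2]; group
        rw [this, hh]; group
      exact key _ _ _ _ _ _ ho
  · push Not at hne
    refine ⟨1, ?_⟩
    funext i
    rw [hstp i, hne i]
    simp [cf, h1 i, hne i]

theorem step_mk {N ℓ₀ : ℕ} {x : HZ G → Fin 2} {c : Conf (HZ G) aut.q} {w w' z z'} {h h' : G}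
    (hc : cf gen (loct D x c) w z h = c)
    (hc' : cf gen (loct D x (stp aut x c)) w' z' h' = stp aut x c)
    (hlen : ∀ i j, c i ≠ none → c j ≠ none → ∀ a b, a ∈ M → b ∈ M → (invW (w' j) ++ w' i ++ invW (wd a.1) ++
    invW (w i) ++ w j ++ wd b.1).length ≤ ℓ₀)
    (hN : (2 * m + 2) ^ ℓ₀ ≤ N) :
    StepOK wd (charPrefix (WordProblem gen) N) (nx (loct D x c)) (loct D x (stp aut x c)) w z w' z' := by
  classical
  have hstp : ∀ i, stp aut x c i = _ := fun i => (hnx x c i).1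
  have hM := fun i => (hnx x c i).2
  set ℓ := loct D x c with hℓ
  have hpc : ∀ i, nx ℓ i ≠ none → c i ≠ none := fun i hi => by
    rw [Ne, ← stp_none aut (x := x), hstp i]; simpa using hi
  have hp : ∀ i, c i ≠ none → pos c i = (h * evalWord gen (w i), Multiplicative.ofAdd (z i : ℤ)) := by
    intro i hi
    obtain ⟨⟨g, a⟩, hci⟩ := Option.ne_none_iff_exists'.1 hi
    rw [pos_eq hci]
    rw [← hc] at hci
    simp only [cf, Option.map_eq_some_iff] at hci
    obtain ⟨a', _, h5⟩ := hci
    rw [Prod.mk.injEq] at h5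
    exact h5.1.symm
  have hp' : ∀ i, nx ℓ i ≠ none → (h * evalWord gen (w i))⁻¹ * (h' * evalWord gen (w' i)) * (pos (nx ℓ) i).1⁻¹ = 1 ∧
      z' i + dn (pos (nx ℓ) i) = z i + dp (pos (nx ℓ) i) := by
    intro i hi
    rw [← hz_eq, ← hp i (hpc i hi)]
    obtain ⟨⟨mv, b⟩, hmv⟩ := Option.ne_none_iff_exists'.1 hi
    have h5 := hstp i
    rw [hmv, Option.map_some] at h5
    rw [pos_eq hmv]
    rw [← hc'] at h5
    simp only [cf, Option.map_eq_some_iff] at h5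
    obtain ⟨a', _, h5⟩ := h5
    rw [Prod.mk.injEq] at h5
    exact h5.1
  refine ⟨fun i => ?_, fun i hi => (hp' i hi).2, fun i j hi hj => ?_⟩
  · show (stp aut x c i).map Prod.snd = _
    rw [hstp i, Option.map_map]; rfl
  · have := ora_mk (gen := gen) (hlen i j (hpc i hi) (hpc j hj) _ _ (hM i hi) (hM j hj)) hN
    rwa [decide_eq_true] at this
    simp only [evalWord_append, evalWord_inv, hwd]
    have e1 := (hp' i hi).1
    have e2 := (hp' j hj).1
    rw [mul_inv_eq_one] at e1 e2
    rw [← e1, ← e2]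
    group

end

section
variable {G : Type*} [Group G]

theorem xP_shift {P : ℕ} {h : HZ G} (hh : (P : ℤ) ∣ Multiplicative.toAdd h.2) : shiftC h (xP G P) = xP G P := by
  funext k
  simp only [shiftC, xP]
  congr 1
  rw [Prod.snd_mul, Prod.snd_inv, toAdd_mul, toAdd_inv, eq_iff_iff]
  exact dvd_add_right (by simpa using hh)

theorem loct_sh {H : Type*} [Group H] {s k : ℕ} {q : Fin k → ℕ} {D : Finset H} {x : H → Fin s} {u : H}
    (hu : shiftC u x = x) (c : Conf H q) : loct D x (sh u c) = loct D x c := by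
  apply Prod.ext
  · apply Prod.ext
    · funext i
      show ((c i).map _).map _ = _
      rw [Option.map_map]; rfl
    · funext i j d
      simp only [loct, ndt, decide_eq_decide]
      constructor
      · rintro ⟨g, a, b, h1, h2⟩
        rw [sh_some] at h1 h2
        exact ⟨_, _, _, h1, by rw [h2, mul_assoc]⟩
      · rintro ⟨g, a, b, h1, h2⟩
        refine ⟨u * g, a, b, ?_, ?_⟩
        · rw [sh_some, h1]; simp
        · rw [sh_some, h2]; simp [mul_assoc]
  · funext i d
    show ((c i).map _).map _ = _
    rw [Option.map_map]
    simp only [loct]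
    congr 1
    funext p
    simp only [Function.comp]
    conv_lhs => rw [← hu]
    simp [shiftC, mul_assoc]

end
end FH


namespace FH
set_option linter.unusedSectionVars false

section acc
variable {G : Type*} [Group G] {m : ℕ} {k : ℕ} (wd : G → List (Fin m × Bool))
  (aut : GWA (HZ G) 2 k) (D : Finset (HZ G)) (nx : LocT (HZ G) aut.q D 2 → Conf (HZ G) aut.q)
  {N : ℕ} (dec : Fin N → LocT (HZ G) aut.q D 2)

abbrev Item (N m k : ℕ) := Fin N × (Fin k → List (Fin m × Bool)) × (Fin k → ℕ)

/-- accepted certificates -/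
def Acc (P : ℕ) (u : List Bool) (n : ℕ) (it : ℕ → Item N m k) : Prop :=
  dec (it 0).1 ∈ tauJ aut D ∧ dec (it n).1 ∈ tauF aut D ∧
  (∀ t < n + 1, Good wd u P (dec (it t).1) (it t).2.1 (it t).2.2) ∧
  (∀ t < n, StepOK wd u (nx (dec (it t).1)) (dec (it (t + 1)).1) (it t).2.1 (it t).2.2
    (it (t + 1)).2.1 (it (t + 1)).2.2)

theorem acc_pr (d0 : Item N m k) : PrimrecPred fun a : (ℕ × List Bool) × (ℕ × List (Item N m k)) =>
    Acc wd aut D nx dec a.1.1 a.1.2 a.2.1 (fun t => a.2.2.getD t d0) := by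
  have hit : Primrec fun b : ((ℕ × List Bool) × (ℕ × List (Item N m k))) × ℕ => b.1.2.2.getD b.2 d0 :=
    (Primrec.list_getD d0).comp (Primrec.snd.comp (Primrec.snd.comp Primrec.fst)) Primrec.snd
  have hit' : Primrec fun b : ((ℕ × List Bool) × (ℕ × List (Item N m k))) × ℕ => b.1.2.2.getD (b.2 + 1) d0 :=
    (Primrec.list_getD d0).comp (Primrec.snd.comp (Primrec.snd.comp Primrec.fst)) (Primrec.succ.comp Primrec.snd)
  have hP : Primrec fun b : ((ℕ × List Bool) × (ℕ × List (Item N m k))) × ℕ => b.1.1.1 :=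
    Primrec.fst.comp (Primrec.fst.comp Primrec.fst)
  have hu : Primrec fun b : ((ℕ × List Bool) × (ℕ × List (Item N m k))) × ℕ => b.1.1.2 :=
    Primrec.snd.comp (Primrec.fst.comp Primrec.fst)
  have w1 := Primrec.fst.comp (Primrec.snd.comp hit)
  have z1 := Primrec.snd.comp (Primrec.snd.comp hit)
  have w2 := Primrec.fst.comp (Primrec.snd.comp hit')
  have z2 := Primrec.snd.comp (Primrec.snd.comp hit')
  have hG1 : PrimrecPred fun b : ((ℕ × List Bool) × (ℕ × List (Item N m k))) × ℕ =>
      Good wd b.1.1.2 b.1.1.1 (dec (b.1.2.2.getD b.2 d0).1) (b.1.2.2.getD b.2 d0).2.1 (b.1.2.2.getD b.2 d0).2.2 :=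
    pp_cases (Primrec.fst.comp hit) (p := fun i (b : ((ℕ × List Bool) × (ℕ × List (Item N m k))) × ℕ) =>
      Good wd b.1.1.2 b.1.1.1 (dec i) (b.1.2.2.getD b.2 d0).2.1 (b.1.2.2.getD b.2 d0).2.2)
      fun i => good_pr wd hu hP w1 z1 (dec i)
  have hS1 : PrimrecPred fun b : ((ℕ × List Bool) × (ℕ × List (Item N m k))) × ℕ =>
      StepOK wd b.1.1.2 (nx (dec (b.1.2.2.getD b.2 d0).1)) (dec (b.1.2.2.getD (b.2+1) d0).1)
        (b.1.2.2.getD b.2 d0).2.1 (b.1.2.2.getD b.2 d0).2.2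
        (b.1.2.2.getD (b.2+1) d0).2.1 (b.1.2.2.getD (b.2+1) d0).2.2 :=
    pp_cases (Primrec.fst.comp hit) (p := fun i (b : ((ℕ × List Bool) × (ℕ × List (Item N m k))) × ℕ) =>
      StepOK wd b.1.1.2 (nx (dec i)) (dec (b.1.2.2.getD (b.2+1) d0).1)
        (b.1.2.2.getD b.2 d0).2.1 (b.1.2.2.getD b.2 d0).2.2
        (b.1.2.2.getD (b.2+1) d0).2.1 (b.1.2.2.getD (b.2+1) d0).2.2)
      fun i => pp_cases (Primrec.fst.comp hit') (p := fun j (b : ((ℕ × List Bool) × (ℕ × List (Item N m k))) × ℕ) =>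
      StepOK wd b.1.1.2 (nx (dec i)) (dec j)
        (b.1.2.2.getD b.2 d0).2.1 (b.1.2.2.getD b.2 d0).2.2
        (b.1.2.2.getD (b.2+1) d0).2.1 (b.1.2.2.getD (b.2+1) d0).2.2)
        fun j => step_pr wd hu w1 z1 w2 z2 (nx (dec i)) (dec j)
  have hall : ∀ {p : ((ℕ × List Bool) × (ℕ × List (Item N m k))) × ℕ → Prop}
      {f : (ℕ × List Bool) × (ℕ × List (Item N m k)) → ℕ}, PrimrecPred p → Primrec f →
      PrimrecPred fun a => ∀ t < f a, p (a, t) := by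
    intro p f hp hf
    have h1 : PrimrecRel fun (t : ℕ) a => p (a, t) := hp.comp (Primrec.snd.pair Primrec.fst)
    exact (h1.forall_mem_list.comp (Primrec.list_range.comp hf) Primrec.id).of_eq fun a => by simp
  have hd : ∀ {p : LocT (HZ G) aut.q D 2 → Prop} {f : (ℕ × List Bool) × (ℕ × List (Item N m k)) → ℕ},
      Primrec f → PrimrecPred fun a : (ℕ × List Bool) × (ℕ × List (Item N m k)) => p (dec (a.2.2.getD (f a) d0).1) := by
    intro p f hf
    exact pp_cases (Primrec.fst.comp (hit.comp (Primrec.id.pair hf))) (p := fun i _ => p (dec i)) fun i => pp_const _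
  refine (hd (Primrec.const 0)).and ((hd (Primrec.fst.comp Primrec.snd)).and ((hall hG1 ?_).and (hall hS1 ?_)))
  · exact Primrec.succ.comp (Primrec.fst.comp Primrec.snd)
  · exact Primrec.fst.comp Primrec.snd

variable {wd aut D nx dec} {gen : Fin m → G} (hwd : ∀ g, evalWord gen (wd g) = g) {M : Finset (HZ G)}
  (hnx : ∀ x c i, stp aut x c i = (nx (loct D x c) i).map (fun p => (pos c i * p.1, p.2)) ∧
      (nx (loct D x c) i ≠ none → pos (nx (loct D x c)) i ∈ M))
include hwd hnx

theorem acc_sound {P L n : ℕ} {it : ℕ → Item N m k} (hP : 0 < P)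
    (h : Acc wd aut D nx dec P (charPrefix (WordProblem gen) L) n it) :
    ∃ c, loct D (xP G P) c ∈ tauJ aut D ∧ loct D (xP G P) (run aut (xP G P) c n) ∈ tauF aut D := by
  obtain ⟨hJ, hF, hg, hs⟩ := h
  have key : ∀ t ≤ n, ∃ h, run aut (xP G P) (cf gen (dec (it 0).1) (it 0).2.1 (it 0).2.2 1) t =
      cf gen (dec (it t).1) (it t).2.1 (it t).2.2 h := by
    intro t
    induction t with
    | zero => exact fun _ => ⟨1, rfl⟩
    | succ t ih =>
      intro ht
      obtain ⟨h, hh⟩ := ih (by omega)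
      obtain ⟨h', hh'⟩ := step_sound hwd hnx (good_near wd hwd hP (hg t (by omega)) h) (hs t (by omega))
      refine ⟨h', ?_⟩
      simp only [run] at hh ⊢
      rw [Function.iterate_succ_apply', hh, hh']
  refine ⟨cf gen (dec (it 0).1) (it 0).2.1 (it 0).2.2 1, ?_, ?_⟩
  · rw [good_near wd hwd hP (hg 0 (by omega))]; exact hJ
  · obtain ⟨h, hh⟩ := key n le_rfl
    rw [hh, good_near wd hwd hP (hg n (by omega))]; exact hF

theorem acc_complete {P L n B μ : ℕ} (hP : 0 < P) (hdec : Function.Surjective dec)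
    (hlen : ∀ g, (wd g).length = wordNorm gen g)
    (hμ : ∀ h ∈ M, wordNorm gen h.1 ≤ μ) (hμD : ∀ h ∈ D, wordNorm gen h.1 ≤ μ)
    (hL : (2 * m + 2) ^ (4 * B + 2 * μ) ≤ L)
    (c : Conf (HZ G) aut.q) (hJ : loct D (xP G P) c ∈ tauJ aut D)
    (hF : loct D (xP G P) (run aut (xP G P) c n) ∈ tauF aut D)
    (hB : ∀ t i j, c i ≠ none → c j ≠ none →
        gd gen (MonoidHom.fst G (Multiplicative ℤ)) (pos (run aut (xP G P) c t) i) (pos (run aut (xP G P) c t) j) ≤ B) :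
    ∃ it, Acc wd aut D nx dec P (charPrefix (WordProblem gen) L) n it := by
  classical
  let K : ℕ := ∑ t ∈ Finset.range (n + 1), ∑ i, (Multiplicative.toAdd (pos (run aut (xP G P) c t) i).2).natAbs
  let u : HZ G := (1, Multiplicative.ofAdd ((P * K : ℕ) : ℤ))
  have hu : shiftC u (xP G P) = xP G P := xP_shift ⟨(K : ℤ), by simp only [u, toAdd_ofAdd]; push_cast; rfl⟩
  let e : ℕ → Conf (HZ G) aut.q := fun t => sh u (run aut (xP G P) c t)
  have hloc : ∀ t, loct D (xP G P) (e t) = loct D (xP G P) (run aut (xP G P) c t) := fun t => loct_sh hu _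
  have hes : ∀ t, stp aut (xP G P) (e t) = e (t + 1) := by
    intro t
    have := stp_sh aut u (xP G P) (run aut (xP G P) c t)
    rw [hu] at this
    simp only [e, run] at this ⊢
    rw [this, Function.iterate_succ_apply']
  have hen : ∀ t i, e t i ≠ none ↔ c i ≠ none := fun t i => by
    rw [not_iff_not]
    simp only [e, sh_none]
    exact iter_none t
  have hpe : ∀ t i, c i ≠ none → pos (e t) i = u * pos (run aut (xP G P) c t) i := fun t i hi =>
    pos_sh (by rw [Ne, show run aut (xP G P) c t i = none ↔ c i = none from iter_none t]; exact hi)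
  have hzpos : ∀ t ≤ n, ∀ i, c i ≠ none → 0 ≤ Multiplicative.toAdd (pos (e t) i).2 := by
    intro t ht i hi
    rw [hpe t i hi]
    simp only [u, Prod.snd_mul, toAdd_mul, toAdd_ofAdd]
    have h1 : (Multiplicative.toAdd (pos (run aut (xP G P) c t) i).2).natAbs ≤ K :=
      (Finset.single_le_sum (f := fun i => (Multiplicative.toAdd (pos (run aut (xP G P) c t) i).2).natAbs)
        (fun _ _ => Nat.zero_le _) (Finset.mem_univ i)).trans
        (Finset.single_le_sum (f := fun t => ∑ i, (Multiplicative.toAdd (pos (run aut (xP G P) c t) i).2).natAbs)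
        (fun _ _ => Nat.zero_le _) (Finset.mem_range.2 (by omega)))
    have h2 : K ≤ P * K := Nat.le_mul_of_pos_left _ hP
    omega
  obtain ⟨fr, hfr⟩ : ∃ fr : ℕ → G, ∀ t i, c i ≠ none → wordNorm gen ((fr t)⁻¹ * (pos (e t) i).1) ≤ B := by
    by_cases h : ∃ i0, c i0 ≠ none
    · obtain ⟨i0, hi0⟩ := h
      refine ⟨fun t => (pos (e t) i0).1, fun t i hi => ?_⟩
      beta_reduce
      rw [hpe t i hi, hpe t i0 hi0]
      have := hB t i0 i hi0 hi
      simpa [gd, dst, u] using this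
    · push Not at h
      exact ⟨fun _ => 1, fun t i hi => absurd (h i) hi⟩
  choose dc hdc using hdec
  let it : ℕ → Item N m k := fun t => (dc (loct D (xP G P) (e t)),
    (fun i => if c i = none then [] else wd ((fr t)⁻¹ * (pos (e t) i).1)),
    fun i => (Multiplicative.toAdd (pos (e t) i).2).toNat)
  have hwl : ∀ t i, ((it t).2.1 i).length ≤ B := by
    intro t i
    simp only [it]
    split_ifs with h
    · simp
    · rw [hlen]; exact hfr t i h
  have hcf : ∀ t ≤ n, cf gen (loct D (xP G P) (e t)) (it t).2.1 (it t).2.2 (fr t) = e t := by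
    intro t ht
    funext i
    have hst : (loct D (xP G P) (e t)).1.1 i = (e t i).map Prod.snd := rfl
    simp only [cf, hst, it]
    cases h : e t i with
    | none => rfl
    | some p =>
      obtain ⟨g, a⟩ := p
      have hci : c i ≠ none := (hen t i).1 (by simp [h])
      have := hzpos t ht i hci
      rw [pos_eq h] at this ⊢
      simp only [Option.map_some, if_neg hci, hwd, Int.toNat_of_nonneg this]
      simp
  refine ⟨it, ?_, ?_, ?_, ?_⟩
  · simp only [it, hdc, hloc]; exact hJ
  · simp only [it, hdc, hloc]; exact hF
  · intro t ht
    have : dec (it t).1 = loct D (xP G P) (e t) := hdc _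
    rw [this]
    refine good_mk wd hwd (ℓ₀ := 4 * B + 2 * μ) hP (hcf t (by omega)) ?_ hL
    intro i j d hd _ _
    simp only [List.length_append, invW_length, hlen]
    have := hwl t i
    have := hwl t j
    have := hμD d hd
    omega
  · intro t ht
    have h1 : dec (it t).1 = loct D (xP G P) (e t) := hdc _
    have h2 : dec (it (t + 1)).1 = loct D (xP G P) (e (t + 1)) := hdc _
    rw [h1, h2, ← hes]
    refine step_mk hwd hnx (ℓ₀ := 4 * B + 2 * μ) (hcf t (by omega)) (by rw [hes]; exact hcf (t + 1) (by omega)) ?_ hL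
    intro i j _ _ a b ha hb
    simp only [List.length_append, invW_length, hlen]
    have := hwl t i
    have := hwl t j
    have := hwl (t + 1) i
    have := hwl (t + 1) j
    have := hμ a ha
    have := hμ b hb
    omega

end acc

section main
variable {G : Type*} [Group G] {m : ℕ} {gen : Fin m → G}
  (hG : Subgroup.closure (Set.range gen) = ⊤) (ht : ∀ g : G, IsOfFinOrder g)

theorem pow2_pr : Primrec fun p : ℕ => 2 ^ p := by
  have : Primrec fun p : ℕ => Nat.rec (motive := fun _ => ℕ) 1 (fun _ r => 2 * r) p :=
    Primrec.nat_rec₁ 1 ((Primrec.nat_mul.comp (Primrec.const 2) Primrec.snd).to₂)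
  refine this.of_eq fun p => ?_
  induction p with
  | zero => rfl
  | succ p ih => rw [pow_succ, ← ih, mul_comm]

include hG ht in
theorem three_heads (aut : GWA (HZ G) 2 3) : ∃ χ : ℕ × List Bool →. ℕ, Partrec χ ∧ ∃ q μ δ : ℕ,
    ∀ p L, (2 * m + 2) ^ (4 * bd3 gen q (2 ^ p) μ δ + 2 * μ) ≤ L →
      ((χ (p, charPrefix (WordProblem gen) L)).Dom ↔ xP G (2 ^ p) ∉ autSet aut) := by
  classical
  obtain ⟨WI, hWI⟩ := clopen_window aut.Ini aut.clopen_Ini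
  obtain ⟨WF, hWF⟩ := clopen_window aut.Fini aut.clopen_Fini
  obtain ⟨D, M, hD0, hd⟩ := exists_dyn aut (((WI ×ˢ WI) ∪ (WF ×ˢ WF)).image fun p => p.1⁻¹ * p.2)
  have hWID : ∀ w ∈ WI, ∀ w' ∈ WI, w⁻¹ * w' ∈ D := fun w hw w' hw' => hD0 (Finset.mem_image.2
    ⟨(w, w'), Finset.mem_union_left _ (Finset.mem_product.2 ⟨hw, hw'⟩), rfl⟩)
  have hWFD : ∀ w ∈ WF, ∀ w' ∈ WF, w⁻¹ * w' ∈ D := fun w hw w' hw' => hD0 (Finset.mem_image.2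
    ⟨(w, w'), Finset.mem_union_right _ (Finset.mem_product.2 ⟨hw, hw'⟩), rfl⟩)
  obtain ⟨nx, hnx⟩ := exists_nx hd
  choose wd hlen hwd using norm_word hG
  obtain ⟨N, ⟨e⟩⟩ := Finite.exists_equiv_fin (LocT (HZ G) aut.q D 2)
  let d0 : Item N m 3 := (e ((fun _ => none, fun _ _ _ => false), fun _ _ => none), fun _ => [], fun _ => 0)
  let q : ℕ := ∑ i, aut.q i
  have hq : ∀ i, aut.q i ≤ q := fun i => Finset.single_le_sum (fun _ _ => Nat.zero_le _) (Finset.mem_univ i)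
  let μ : ℕ := ∑ h ∈ M ∪ D, wordNorm gen h.1
  have hμ' : ∀ h ∈ M ∪ D, wordNorm gen h.1 ≤ μ := fun h hh =>
    Finset.single_le_sum (f := fun h : HZ G => wordNorm gen h.1) (fun _ _ => Nat.zero_le _) hh
  have hμ : ∀ h ∈ M, wordNorm gen h.1 ≤ μ := fun h hh => hμ' h (Finset.mem_union_left _ hh)
  have hμD : ∀ h ∈ D, wordNorm gen h.1 ≤ μ := fun h hh => hμ' h (Finset.mem_union_right _ hh)
  have hpr := acc_pr wd aut D nx e.symm d0
  have hpr2 : PrimrecPred fun a : (ℕ × List Bool) × (ℕ × List (Item N m 3)) =>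
      Acc wd aut D nx e.symm (2 ^ a.1.1) a.1.2 a.2.1 (fun t => a.2.2.getD t d0) :=
    hpr.comp (Primrec.pair (Primrec.pair (pow2_pr.comp (Primrec.fst.comp Primrec.fst))
      (Primrec.snd.comp Primrec.fst)) Primrec.snd)
  obtain ⟨χ, hχ, hdom⟩ := pp_exists_re hpr2
  haveI : Infinite (HZ G) := inferInstance
  refine ⟨χ, hχ, q, μ, D.card, fun p L hL => ?_⟩
  have hP : 0 < 2 ^ p := by positivity
  rw [hdom, not_mem_autSet]
  constructor
  · rintro ⟨⟨n, l⟩, ha⟩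
    obtain ⟨c, h1, h2⟩ := acc_sound hwd hnx hP ha
    exact rej_of_tables hd hWI hWF hWID hWFD _ c n h1 h2
  · rintro ⟨c, n, hI, hF⟩
    haveI : NeZero (2 ^ p) := ⟨hP.ne'⟩
    let π : HZ G →* Multiplicative (ZMod (2 ^ p)) :=
      (AddMonoidHom.toMultiplicative (Int.castAddHom (ZMod (2 ^ p)))).comp (MonoidHom.snd G (Multiplicative ℤ))
    have hx : ∀ h, π h = 1 → shiftC h (xP G (2 ^ p)) = xP G (2 ^ p) := by
      intro h hh
      apply xP_shift
      rw [← ZMod.intCast_zmod_eq_zero_iff_dvd _ (2 ^ p)]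
      exact hh
    have hcard : Fintype.card (Multiplicative (ZMod (2 ^ p))) = 2 ^ p := by
      rw [Fintype.card_multiplicative, ZMod.card]
    obtain ⟨c', h1, h2, h3⟩ := tables_of_rej hG ht (MonoidHom.fst G (Multiplicative ℤ)) π hd hμ hμD hx hWF hWFD q hq
      c n hI hF
    rw [hcard] at h3
    obtain ⟨it, hit⟩ := acc_complete hwd hnx hP e.symm.surjective hlen hμ hμD hL c' h1 h2 h3
    refine ⟨(n, (List.range (n + 1)).map it), ?_⟩
    have hget : ∀ t ≤ n, ((List.range (n + 1)).map it).getD t d0 = it t := by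
      intro t ht
      rw [List.getD_eq_getElem?_getD, List.getElem?_map, List.getElem?_range (by omega)]; rfl
    obtain ⟨a1, a2, a3, a4⟩ := hit
    refine ⟨?_, ?_, fun t ht => ?_, fun t ht => ?_⟩
    · simpa only [hget 0 (by omega)] using a1
    · simpa only [hget n le_rfl] using a2
    · have ht' : t < n + 1 := ht
      simpa only [hget t (by omega)] using a3 t ht
    · have ht' : t < n := ht
      simpa only [hget t (by omega), hget (t + 1) (by omega)] using a4 t ht

end main
end FH


namespace FH
set_option linter.unusedSectionVars false

theorem poly_le (C k : ℕ) : ∃ N, ∀ n ≥ N, C * n ^ k ≤ 2 ^ n := by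
  have h := tendsto_pow_const_div_const_pow_of_one_lt k (r := 2) (by norm_num)
  have h2 : ∀ᶠ n : ℕ in Filter.atTop, (n : ℝ) ^ k / 2 ^ n < 1 / (C + 1) :=
    h.eventually_lt_const (by positivity)
  obtain ⟨N, hN⟩ := Filter.eventually_atTop.1 h2
  refine ⟨N, fun n hn => ?_⟩
  have h3 := hN n hn
  rw [div_lt_div_iff₀ (by positivity) (by positivity), one_mul] at h3
  have h4 : ((n ^ k * (C + 1) : ℕ) : ℝ) < ((2 ^ n : ℕ) : ℝ) := by push_cast; exact h3
  have h5 : n ^ k * (C + 1) < 2 ^ n := by exact_mod_cast h4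
  nlinarith [Nat.zero_le (n ^ k)]

theorem bounds {G : Type*} [Group G] {m : ℕ} {gen : Fin m → G}
    (hG : Subgroup.closure (Set.range gen) = ⊤) (ζ : ℕ → ℕ)
    (hζ : ∀ c : ℝ, 1 < c → ∃ N : ℕ, ∀ n ≥ N, c ^ n ≤ (ζ n : ℝ)) (q μ δ : ℕ) :
    ∃ N, ∀ p ≥ N, (2 * m + 2) ^ (4 * bd3 gen q (2 ^ p) μ δ + 2 * μ) ≤
      ζ (ζ (max (ζ (max (ζ p) (torsionFn gen (ζ p))))
        (torsionFn gen (ζ (max (ζ p) (torsionFn gen (ζ p))))))) := by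
  have hz : ∀ c : ℕ, 2 ≤ c → ∃ N : ℕ, ∀ n ≥ N, c ^ n ≤ ζ n := by
    intro c hc
    obtain ⟨N, hN⟩ := hζ c (by exact_mod_cast hc)
    exact ⟨N, fun n hn => by exact_mod_cast hN n hn⟩
  obtain ⟨N1, h1⟩ := hz 2 le_rfl
  obtain ⟨N2, h2⟩ := hz 4 (by norm_num)
  obtain ⟨N3, h3⟩ := hz (2 * m + 2) (by omega)
  obtain ⟨N4, h4⟩ := poly_le (((q + 1) * ((q + 1) * (δ + 1)) + 1) * (μ + 3)) 3
  obtain ⟨N5, h5⟩ := poly_le (34 * μ + 96) 2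
  refine ⟨N1 + N2 + N3 + N4 + N5 + (q + 2) * μ + 1, fun p hp => ?_⟩
  have hT := torsion_mono hG
  set t := max (ζ p) (torsionFn gen (ζ p)) with htd
  set u := max (ζ t) (torsionFn gen (ζ t)) with hud
  have z1 : 4 ^ p ≤ ζ p := h2 p (by omega)
  have e4 : (4 : ℕ) ^ p = 2 ^ p * 2 ^ p := by rw [← mul_pow]; norm_num
  have p2 : p < 2 ^ p := Nat.lt_two_pow_self
  have t1 : 4 ^ p ≤ t := z1.trans (le_max_left _ _)
  have p4 : 2 ^ p ≤ 4 ^ p := Nat.pow_le_pow_left (by norm_num) p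
  have tp : p ≤ t := by omega
  have zt : 2 ^ t ≤ ζ t := h1 t (by omega)
  have t2 : t < 2 ^ t := Nat.lt_two_pow_self
  have ut : ζ t ≤ u := le_max_left _ _
  have tu : t ≤ u := by omega
  have zu : 2 ^ u ≤ ζ u := h1 u (by omega)
  have u2 : u < 2 ^ u := Nat.lt_two_pow_self
  have b1 : bd1 gen q (2 ^ p) μ ≤ 3 * t ^ 2 := by
    simp only [bd1, wb]
    have hA : ((q + 1) * 2 ^ p + 1) * μ ≤ ζ p := by
      refine le_trans ?_ z1
      rw [e4]
      have : ((q + 1) * 2 ^ p + 1) * μ ≤ ((q + 2) * μ) * 2 ^ p := by nlinarith [Nat.zero_le μ, Nat.zero_le (2 ^ p * μ), Nat.mul_le_mul_right μ (show 1 ≤ 2 ^ p by omega)]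
      exact this.trans (Nat.mul_le_mul_right _ (by omega))
    generalize ((q + 1) * 2 ^ p + 1) * μ = A at hA
    have hA1 : A ≤ t := hA.trans (le_max_left _ _)
    have hA2 : torsionFn gen A ≤ t := (hT hA).trans (le_max_right _ _)
    have := Nat.mul_le_mul hA2 hA1
    have : 1 ≤ t := by omega
    nlinarith
  have b2 : bd2 gen q (2 ^ p) μ δ ≤ 3 * u ^ 2 := by
    simp only [bd2]
    generalize bd1 gen q (2 ^ p) μ = B at b1
    simp only [wb]
    have hA : ((q + 1) * ((q + 1) * ((δ + 1) * 2 ^ p)) + 1) * (μ + B) ≤ ζ t := by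
      refine le_trans ?_ zt
      refine le_trans ?_ (h4 t (by omega))
      have ht1 : 1 ≤ t := by omega
      have e1 : (q + 1) * ((q + 1) * ((δ + 1) * 2 ^ p)) + 1 ≤ ((q + 1) * ((q + 1) * (δ + 1)) + 1) * t := by
        have : (q + 1) * ((q + 1) * (δ + 1)) * 2 ^ p ≤ (q + 1) * ((q + 1) * (δ + 1)) * t :=
          Nat.mul_le_mul_left _ (by omega)
        nlinarith
      have e2 : μ + B ≤ (μ + 3) * t ^ 2 := by
        have : 1 ≤ t ^ 2 := Nat.one_le_pow _ _ ht1
        nlinarith [Nat.mul_le_mul_left μ this]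
      refine (Nat.mul_le_mul e1 e2).trans (le_of_eq ?_)
      ring
    generalize ((q + 1) * ((q + 1) * ((δ + 1) * 2 ^ p)) + 1) * (μ + B) = A at hA
    have hA1 : A ≤ u := hA.trans ut
    have hA2 : torsionFn gen A ≤ u := (hT hA).trans (le_max_right _ _)
    have := Nat.mul_le_mul hA2 hA1
    have : 1 ≤ u := by omega
    nlinarith
  have b3 : 4 * bd3 gen q (2 ^ p) μ δ + 2 * μ ≤ (34 * μ + 96) * u ^ 2 := by
    simp only [bd3]
    have : 1 ≤ u ^ 2 := Nat.one_le_pow _ _ (by omega)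
    have h7 := Nat.mul_le_mul_left μ this
    have h8 : t ^ 2 ≤ u ^ 2 := Nat.pow_le_pow_left tu 2
    have h9 : (34 * μ + 96) * u ^ 2 = 34 * (μ * u ^ 2) + 96 * u ^ 2 := by ring
    rw [h9]
    clear_value t u
    generalize bd1 gen q (2 ^ p) μ = B1 at *
    generalize bd2 gen q (2 ^ p) μ δ = B2 at *
    generalize μ * u ^ 2 = mu at *
    generalize u ^ 2 = uu at *
    generalize t ^ 2 = tt at *
    clear h1 h2 h3 h4 h5 hz hζ hT p2 t2 u2 zu zt z1
    omega
  have b4 := b3.trans ((h5 u (by omega)).trans zu)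
  exact (Nat.pow_le_pow_right (by omega) b4).trans (h3 (ζ u) (by omega))

end FH


namespace FH
set_option linter.unusedSectionVars false

section build
open Classical
variable {H : Type*} [Group H] {s k : ℕ} {Q : Type} [Fintype Q]

/-- number of states -/
noncomputable abbrev nQ (Q : Type) [Fintype Q] : ℕ := Fintype.card Q

noncomputable abbrev eQ : Q ≃ Fin (nQ Q) := Fintype.equivFin Q

/-- configurations with all heads present -/
abbrev FC (H : Type*) (k : ℕ) (Q : Type) := Fin k → H × Q

noncomputable def emb (c : FC H k Q) : Conf H (fun _ : Fin k => nQ Q) :=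
  fun i => some ((c i).1, eQ (c i).2)

/-- what is seen at a position -/
noncomputable def view (c : FC H k Q) (g : H) : Fin k → Option Q :=
  fun j => if (c j).1 = g then some (c j).2 else none

noncomputable def nxt (rule : Fin k → Fin s → (Fin k → Option Q) → H × Q) (x : H → Fin s)
    (c : FC H k Q) : FC H k Q := fun i =>
  let r := rule i (x (c i).1) (view c (c i).1)
  ((c i).1 * r.1, r.2)

noncomputable def yview (y : YS H k (fun _ : Fin k => nQ Q)) (g : H) : Fin k → Option Q :=
  fun j => (y.1 j g).map eQ.symm

theorem yview_emb (c : FC H k Q) (g : H) : yview (ofC (emb c)) g = view c g := by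
  funext j
  by_cases h : (c j).1 = g <;> simp [yview, view, ofC, emb, h]

noncomputable def bf (rule : Fin k → Fin s → (Fin k → Option Q) → H × Q)
    (p : (H → Fin s) × YS H k (fun _ : Fin k => nQ Q)) :
    (H → Fin s) × YS H k (fun _ : Fin k => nQ Q) :=
  (p.1, ofC fun i => (toC p.2 i).map fun ga =>
    (ga.1 * (rule i (p.1 ga.1) (yview p.2 ga.1)).1, eQ (rule i (p.1 ga.1) (yview p.2 ga.1)).2))

theorem bf_some (rule : Fin k → Fin s → (Fin k → Option Q) → H × Q)
    (p : (H → Fin s) × YS H k (fun _ : Fin k => nQ Q)) (i : Fin k) (g : H) (b : Fin (nQ Q)) :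
    (bf rule p).2.1 i g = some b ↔ ∃ h a, p.2.1 i h = some a ∧
      h * (rule i (p.1 h) (yview p.2 h)).1 = g ∧ eQ (rule i (p.1 h) (yview p.2 h)).2 = b := by
  simp only [bf, ofC_some, Option.map_eq_some_iff, Prod.exists, toC_some, Prod.mk.injEq]

noncomputable abbrev mkGWA (rule : Fin k → Fin s → (Fin k → Option Q) → H × Q)
    (ini fin : (Fin k → Option Q) → Prop) : GWA H s k where
  q := fun _ => nQ Q
  f := bf rule
  cont := by
    refine cont_of_coords _ (fun p => rfl) ?_
    intro i g p
    let M : Finset H := Finset.univ.image fun v : Fin s × (Fin k → Option Q) => (rule i v.1 v.2).1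
    refine ⟨M.image fun m => g * m⁻¹, fun p' h => ?_⟩
    have key : ∀ p p' : (H → Fin s) × YS H k (fun _ : Fin k => nQ Q),
        Agree (M.image fun m => g * m⁻¹) p p' → ∀ b,
        (bf rule p').2.1 i g = some b → (bf rule p).2.1 i g = some b := by
      intro p p' h b hb
      rw [bf_some] at hb ⊢
      obtain ⟨u, a, h1, h2, h3⟩ := hb
      have hu : u ∈ M.image fun m => g * m⁻¹ := by
        refine Finset.mem_image.2 ⟨_, Finset.mem_image.2 ⟨(p'.1 u, yview p'.2 u), Finset.mem_univ _, rfl⟩, ?_⟩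
        rw [← h2]; simp
      obtain ⟨e1, e2⟩ := h u hu
      have e3 : yview p.2 u = yview p'.2 u := by
        funext j; simp only [yview, e2 j]
      refine ⟨u, a, ?_, ?_, ?_⟩
      · rw [e2 i]; exact h1
      · rw [e1, e3]; exact h2
      · rw [e1, e3]; exact h3
    apply Option.ext
    intro b
    exact ⟨key p p' h b, key p' p h.symm b⟩
  fst_eq := fun p => rfl
  equivar := by
    intro g p
    apply Prod.ext
    · rfl
    · refine ys_ext fun i h a => ?_
      rw [bf_some]
      show _ ↔ (bf rule p).2.1 i (g⁻¹ * h) = _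
      rw [bf_some]
      constructor
      · rintro ⟨u, a, h1, h2, h3⟩
        refine ⟨g⁻¹ * u, a, h1, ?_, h3⟩
        rw [mul_assoc]; congr 1
      · rintro ⟨u, a, h1, h2, h3⟩
        have e : yview (yshift g p.2) (g * u) = yview p.2 u := by
          funext j; simp [yview, yshift, shiftC]
        have e' : shiftC g p.1 (g * u) = p.1 u := by simp [shiftC]
        refine ⟨g * u, a, ?_, ?_, ?_⟩
        · show p.2.1 i (g⁻¹ * (g * u)) = _
          simpa using h1
        · simp only [e, e']; rw [mul_assoc, h2]; simp
        · simp only [e, e']; exact h3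
  vanish := by
    intro p i
    simp only [bf]
    rw [← conf_none_iff, Option.map_eq_none_iff, conf_none_iff, ofC_toC]
  Ini := {y | ini (yview y 1)}
  Fini := {y | fin (yview y 1)}
  clopen_Ini := by
    refine clopen_of_window _ {1} ?_
    intro y y' h
    have : yview y 1 = yview y' 1 := by
      funext j; simp only [yview]; rw [h 1 (by simp)]
    simp [this]
  clopen_Fini := by
    refine clopen_of_window _ {1} ?_
    intro y y' h
    have : yview y 1 = yview y' 1 := by
      funext j; simp only [yview]; rw [h 1 (by simp)]
    simp [this]

variable (rule : Fin k → Fin s → (Fin k → Option Q) → H × Q) (ini fin : (Fin k → Option Q) → Prop)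

theorem stp_emb (x : H → Fin s) (c : FC H k Q) :
    stp (mkGWA rule ini fin) x (emb c) = emb (nxt rule x c) := by
  refine conf_ext fun i g a => ?_
  rw [stp_some]
  show (bf rule (x, ofC (emb c))).2.1 i g = _ ↔ _
  rw [bf_some]
  simp only [yview_emb]
  constructor
  · rintro ⟨u, a, h1, h2, h3⟩
    rw [ofC_some] at h1
    simp only [emb, Option.some.injEq, Prod.mk.injEq] at h1
    obtain ⟨rfl, h1⟩ := h1
    simp only [emb, nxt, h2, h3]
  · intro h
    simp only [emb, nxt, Option.some.injEq, Prod.mk.injEq] at h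
    exact ⟨(c i).1, eQ (c i).2, by rw [ofC_some]; rfl, h.1, h.2⟩

theorem stp_emb_iter (x : H → Fin s) (c : FC H k Q) (n : ℕ) :
    (stp (mkGWA rule ini fin) x)^[n] (emb c) = emb ((nxt rule x)^[n] c) := by
  induction n with
  | zero => rfl
  | succ n ih => rw [Function.iterate_succ_apply', Function.iterate_succ_apply', ih, stp_emb]

theorem yview_shift (g : H) (y : YS H k (fun _ : Fin k => nQ Q)) :
    yview (yshift g y) 1 = yview y g⁻¹ := by
  funext j; simp [yview, yshift, shiftC]

theorem mk_mem (i0 : Fin k → Q) (hini : ∀ v, ini v ↔ ∀ j, v j = some (i0 j)) (x : H → Fin s) :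
    x ∉ autSet (mkGWA rule ini fin) ↔
      ∃ g n h, fin (view ((nxt rule x)^[n] fun i => (g, i0 i)) h) := by
  rw [not_mem_autSet]
  have hI : ∀ c, Sees (mkGWA rule ini fin).Ini c ↔ ∃ g, c = emb (fun i => (g, i0 i)) := by
    intro c
    constructor
    · rintro ⟨g, hg⟩
      change ini (yview (yshift g (ofC c)) 1) at hg
      rw [yview_shift, hini] at hg
      refine ⟨g⁻¹, ?_⟩
      funext i
      have := hg i
      simp only [yview, Option.map_eq_some_iff] at this
      obtain ⟨a, h1, h2⟩ := this
      rw [ofC_some] at h1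
      rw [h1, emb, ← h2]
      simp
    · rintro ⟨g, rfl⟩
      refine ⟨g⁻¹, ?_⟩
      change ini (yview (yshift g⁻¹ (ofC _)) 1)
      rw [yview_shift, yview_emb, hini]
      intro j
      simp [view]
  constructor
  · rintro ⟨c, n, h1, h2⟩
    obtain ⟨g, rfl⟩ := (hI c).1 h1
    simp only [run] at h2
    rw [stp_emb_iter] at h2
    obtain ⟨h, hh⟩ := h2
    change fin (yview (yshift h (ofC _)) 1) at hh
    rw [yview_shift, yview_emb] at hh
    exact ⟨g, n, h⁻¹, hh⟩
  · rintro ⟨g, n, h, hh⟩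
    refine ⟨_, n, (hI _).2 ⟨g, rfl⟩, ?_⟩
    simp only [run]
    rw [stp_emb_iter]
    refine ⟨h⁻¹, ?_⟩
    change fin (yview (yshift h⁻¹ (ofC _)) 1)
    rw [yview_shift, yview_emb, inv_inv]
    exact hh

end build
end FH


namespace FH
set_option linter.unusedSectionVars false

/-- states of the heads -/
inductive St (K : Type) (Λ : ℕ) where
  | scan0 : St K Λ
  | scan (r : ZMod Λ) : St K Λ
  | fetch (q : K) (r : ZMod Λ) : St K Λ
  | dn (q : K) (r : ZMod Λ) : St K Λ
  | up (q : K) (r t : ZMod Λ) : St K Λ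
  | fin : St K Λ
  | dead : St K Λ
  | idle : St K Λ
  | actv (q : K) (r t : ZMod Λ) : St K Λ

/-- resolved instructions -/
structure Act (G : Type*) (K : Type) (Λ : ℕ) where
  halt : Bool
  jmp : ZMod Λ → ℤ
  s : G
  nx : K

section machine
open Classical
variable {G : Type*} [Group G] {K : Type} [Fintype K] {Λ : ℕ} [NeZero Λ]

noncomputable instance : Fintype (St K Λ) := by
  have : Finite (St K Λ) := by
    let φ : St K Λ → Fin 9 × Option K × Option (ZMod Λ) × Option (ZMod Λ) := fun s =>
      match s with
      | .scan0 => (0, none, none, none)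
      | .scan r => (1, none, some r, none)
      | .fetch q r => (2, some q, some r, none)
      | .dn q r => (3, some q, some r, none)
      | .up q r t => (4, some q, some r, some t)
      | .fin => (5, none, none, none)
      | .dead => (6, none, none, none)
      | .idle => (7, none, none, none)
      | .actv q r t => (8, some q, some r, some t)
    refine Finite.of_injective φ ?_
    intro a b h
    cases a <;> cases b <;> simp [φ] at h ⊢ <;> tauto
  exact Fintype.ofFinite _

/-- a position -/
abbrev hz (g : G) (z : ℤ) : HZ G := (g, Multiplicative.ofAdd z)

theorem hz_mul (g g' : G) (z z' : ℤ) : hz g z * hz g' z' = hz (g * g') (z + z') := rfl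

theorem hz_inj (g g' : G) (z z' : ℤ) : hz g z = hz g' z' ↔ g = g' ∧ z = z' := by
  simp [hz]

variable (act : K → ZMod Λ → Act G K Λ) (q0 : K)

/-- rule of the leader -/
noncomputable def ruleL (sym : Fin 2) (v : Fin 4 → Option (St K Λ)) : HZ G × St K Λ :=
  match v 0 with
  | some .scan0 => if sym = 1 then (hz 1 1, .scan 1) else (hz 1 0, .dead)
  | some (.scan r) => if sym = 1 then (hz 1 0, .fetch q0 r) else (hz 1 1, .scan (r + 1))
  | some (.fetch q r) => if (act q r).halt then (hz 1 (-1), .fin) else (hz 1 (-1), .dn q r)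
  | some (.dn q r) => if v 1 = none then (hz 1 (-1), .dn q r) else (hz (act q r).s 1, .up q r 1)
  | some (.up q r t) => if v 2 = none then (hz 1 1, .up q r (t + 1)) else
      (hz 1 0, .fetch (act q r).nx t)
  | some .fin => (hz 1 (-1), .fin)
  | _ => (hz 1 0, .dead)

/-- rule of the base -/
noncomputable def ruleO (v : Fin 4 → Option (St K Λ)) : HZ G × St K Λ :=
  match v 0 with
  | some (.dn q r) => (hz (act q r).s 0, .idle)
  | _ => (hz 1 0, .idle)

/-- rule of the counter, default -/
noncomputable def ruleA0 (v : Fin 4 → Option (St K Λ)) : HZ G × St K Λ :=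
  match v 2 with
  | some (.actv q r t) => (hz 1 ((act q r).jmp t), .actv q r (t + 1))
  | _ => (hz 1 0, .idle)

/-- rule of the counter -/
noncomputable def ruleA (sym : Fin 2) (v : Fin 4 → Option (St K Λ)) : HZ G × St K Λ :=
  match v 0 with
  | some .scan0 => (hz 1 1, .idle)
  | some (.scan _) => if sym = 1 then (hz 1 0, .idle) else (hz 1 1, .idle)
  | some (.fetch q r) => if (act q r).halt then (hz 1 0, .idle) else
      (hz (act q r).s ((act q r).jmp 0), .actv q r 1)
  | some (.up _ _ _) => (hz 1 0, .idle)
  | _ => ruleA0 act v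

noncomputable def rl (i : Fin 4) (sym : Fin 2) (v : Fin 4 → Option (St K Λ)) : HZ G × St K Λ :=
  if i = 0 then ruleL act q0 sym v else if i = 1 then ruleO act v
  else if i = 2 then ruleA act sym v else (hz 1 0, .idle)

/-- configurations -/
def quad (l : HZ G) (sl : St K Λ) (o a : HZ G) (sa : St K Λ) (z : HZ G) : FC (HZ G) 4 (St K Λ) :=
  ![(l, sl), (o, .idle), (a, sa), (z, .idle)]

theorem quad_ext {c : FC (HZ G) 4 (St K Λ)} {l : HZ G} {sl : St K Λ} {o a : HZ G} {sa : St K Λ} {z : HZ G}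
    (h0 : c 0 = (l, sl)) (h1 : c 1 = (o, .idle)) (h2 : c 2 = (a, sa)) (h3 : c 3 = (z, .idle)) :
    c = quad l sl o a sa z := by
  funext i
  fin_cases i
  · exact h0
  · exact h1
  · exact h2
  · exact h3

section
variable {l : HZ G} {sl : St K Λ} {o a : HZ G} {sa : St K Λ} {z g : HZ G}
@[simp] theorem view0 : view (quad l sl o a sa z) g 0 = if l = g then some sl else none := by
  simp [view, quad]; congr
@[simp] theorem view1 : view (quad l sl o a sa z) g 1 = if o = g then some St.idle else none := by
  simp [view, quad]; congr
@[simp] theorem view2 : view (quad l sl o a sa z) g 2 = if a = g then some sa else none := by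
  simp [view, quad]; congr
@[simp] theorem view3 : view (quad l sl o a sa z) g 3 = if z = g then some St.idle else none := by
  simp [view, quad]; congr

theorem nxt_quad (x : HZ G → Fin 2) {l' : HZ G} {sl' : St K Λ} {o' a' : HZ G} {sa' : St K Λ}
    (h0 : ruleL act q0 (x l) (view (quad l sl o a sa z) l) = (l', sl'))
    (h1 : ruleO act (view (quad l sl o a sa z) o) = (o', .idle))
    (h2 : ruleA act (x a) (view (quad l sl o a sa z) a) = (a', sa')) :
    nxt (rl act q0) x (quad l sl o a sa z) = quad (l * l') sl' (o * o') (a * a') sa' z := by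
  apply quad_ext
  · simp only [nxt, rl, if_true]
    show ((l * _, _) : HZ G × St K Λ) = _
    have e : (quad l sl o a sa z 0).1 = l := rfl
    rw [e, h0]
  · simp only [nxt, rl]
    have e : (quad l sl o a sa z 1).1 = o := rfl
    rw [e]
    simp [h1]
  · simp only [nxt, rl]
    have e : (quad l sl o a sa z 2).1 = a := rfl
    rw [e]
    simp [h2]
  · simp only [nxt, rl]
    have e : (quad l sl o a sa z 3).1 = z := rfl
    rw [e]
    simp

end

section steps
variable (x : HZ G → Fin 2) (g ga : G) (z za w : ℤ) (q : K) (r t u : ZMod Λ) (Z : HZ G)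

theorem step_dn (h : z ≠ w) :
    nxt (rl act q0) x (quad (hz g z) (.dn q r) (hz g w) (hz ga za) (.actv q r t) Z) =
      quad (hz g (z - 1)) (.dn q r) (hz g w) (hz ga (za + (act q r).jmp t)) (.actv q r (t + 1)) Z := by
  have := nxt_quad act q0 x (l := hz g z) (sl := .dn q r) (o := hz g w) (a := hz ga za)
    (sa := .actv q r t) (z := Z) (l' := hz 1 (-1)) (sl' := .dn q r) (o' := hz 1 0)
    (a' := hz 1 ((act q r).jmp t)) (sa' := .actv q r (t + 1)) ?_ ?_ ?_
  · rw [this]; simp only [hz_mul, mul_one, add_zero]; rfl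
  · simp [ruleL, h.symm]
  · simp [ruleO, h]
  · by_cases hh : hz g z = hz ga za <;> simp [ruleA, ruleA0, hh]

theorem step_turn :
    nxt (rl act q0) x (quad (hz g w) (.dn q r) (hz g w) (hz ga za) (.actv q r t) Z) =
      quad (hz (g * (act q r).s) (w + 1)) (.up q r 1) (hz (g * (act q r).s) w)
        (hz ga (za + (act q r).jmp t)) (.actv q r (t + 1)) Z := by
  have := nxt_quad act q0 x (l := hz g w) (sl := .dn q r) (o := hz g w) (a := hz ga za)
    (sa := .actv q r t) (z := Z) (l' := hz (act q r).s 1) (sl' := .up q r 1) (o' := hz (act q r).s 0)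
    (a' := hz 1 ((act q r).jmp t)) (sa' := .actv q r (t + 1)) ?_ ?_ ?_
  · rw [this]; simp only [hz_mul, mul_one, add_zero]
  · simp [ruleL]
  · simp [ruleO]
  · by_cases hh : hz g w = hz ga za <;> simp [ruleA, ruleA0, hh]

theorem step_up (h : z ≠ za) :
    nxt (rl act q0) x (quad (hz g z) (.up q r u) (hz ga w) (hz g za) (.actv q r t) Z) =
      quad (hz g (z + 1)) (.up q r (u + 1)) (hz ga w)
        (hz g (za + (act q r).jmp t)) (.actv q r (t + 1)) Z := by
  have := nxt_quad act q0 x (l := hz g z) (sl := .up q r u) (o := hz ga w) (a := hz g za)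
    (sa := .actv q r t) (z := Z) (l' := hz 1 1) (sl' := .up q r (u + 1)) (o' := hz 1 0)
    (a' := hz 1 ((act q r).jmp t)) (sa' := .actv q r (t + 1)) ?_ ?_ ?_
  · rw [this]; simp only [hz_mul, mul_one, add_zero]
  · simp [ruleL, h.symm]
  · by_cases hh : hz g z = hz ga w <;> simp [ruleO, hh]
  · simp [ruleA, ruleA0, h]

theorem step_meet :
    nxt (rl act q0) x (quad (hz g z) (.up q r u) (hz ga w) (hz g z) (.actv q r t) Z) =
      quad (hz g z) (.fetch (act q r).nx u) (hz ga w) (hz g z) .idle Z := by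
  have := nxt_quad act q0 x (l := hz g z) (sl := .up q r u) (o := hz ga w) (a := hz g z)
    (sa := .actv q r t) (z := Z) (l' := hz 1 0) (sl' := .fetch (act q r).nx u) (o' := hz 1 0)
    (a' := hz 1 0) (sa' := .idle) ?_ ?_ ?_
  · rw [this]; simp only [hz_mul, mul_one, add_zero]
  · simp [ruleL]
  · by_cases hh : hz g z = hz ga w <;> simp [ruleO, hh]
  · simp [ruleA]

theorem step_fetch (h : (act q r).halt = false) :
    nxt (rl act q0) x (quad (hz g z) (.fetch q r) (hz ga w) (hz g z) .idle Z) =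
      quad (hz g (z - 1)) (.dn q r) (hz ga w) (hz (g * (act q r).s) (z + (act q r).jmp 0))
        (.actv q r 1) Z := by
  have := nxt_quad act q0 x (l := hz g z) (sl := .fetch q r) (o := hz ga w) (a := hz g z)
    (sa := .idle) (z := Z) (l' := hz 1 (-1)) (sl' := .dn q r) (o' := hz 1 0)
    (a' := hz (act q r).s ((act q r).jmp 0)) (sa' := .actv q r 1) ?_ ?_ ?_
  · rw [this]; simp only [hz_mul, mul_one, add_zero]; rfl
  · simp [ruleL, h]
  · by_cases hh : hz g z = hz ga w <;> simp [ruleO, hh]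
  · simp [ruleA, h]

theorem step_halt (h : (act q r).halt = true) :
    nxt (rl act q0) x (quad (hz g z) (.fetch q r) (hz ga w) (hz g z) .idle Z) =
      quad (hz g (z - 1)) .fin (hz ga w) (hz g z) .idle Z := by
  have := nxt_quad act q0 x (l := hz g z) (sl := .fetch q r) (o := hz ga w) (a := hz g z)
    (sa := .idle) (z := Z) (l' := hz 1 (-1)) (sl' := .fin) (o' := hz 1 0)
    (a' := hz 1 0) (sa' := .idle) ?_ ?_ ?_
  · rw [this]; simp only [hz_mul, mul_one, add_zero]; rfl
  · simp [ruleL, h]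
  · by_cases hh : hz g z = hz ga w <;> simp [ruleO, hh]
  · simp [ruleA, h]

theorem step_fin (o a : HZ G) :
    nxt (rl act q0) x (quad (hz g z) .fin o a .idle Z) =
      quad (hz g (z - 1)) .fin o a .idle Z := by
  have := nxt_quad act q0 x (l := hz g z) (sl := .fin) (o := o) (a := a)
    (sa := .idle) (z := Z) (l' := hz 1 (-1)) (sl' := .fin) (o' := hz 1 0)
    (a' := hz 1 0) (sa' := .idle) ?_ ?_ ?_
  · rw [this]
    have e1 : ∀ v : HZ G, v * hz 1 0 = v := fun v => by ext <;> simp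
    rw [e1, e1, hz_mul, mul_one]; rfl
  · simp [ruleL]
  · by_cases hh : hz g z = o <;> simp [ruleO, hh]
  · by_cases hh : hz g z = a <;> simp [ruleA, ruleA0, hh]

theorem step_scan0 (h : x (hz g z) = 1) :
    nxt (rl act q0) x (quad (hz g z) .scan0 (hz ga w) (hz g z) .idle Z) =
      quad (hz g (z + 1)) (.scan 1) (hz ga w) (hz g (z + 1)) .idle Z := by
  have := nxt_quad act q0 x (l := hz g z) (sl := .scan0) (o := hz ga w) (a := hz g z)
    (sa := .idle) (z := Z) (l' := hz 1 1) (sl' := .scan 1) (o' := hz 1 0)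
    (a' := hz 1 1) (sa' := .idle) ?_ ?_ ?_
  · rw [this]; simp only [hz_mul, mul_one, add_zero]
  · simp [ruleL, h]
  · by_cases hh : hz g z = hz ga w <;> simp [ruleO, hh]
  · simp [ruleA]

theorem step_scan (h : x (hz g z) ≠ 1) :
    nxt (rl act q0) x (quad (hz g z) (.scan r) (hz ga w) (hz g z) .idle Z) =
      quad (hz g (z + 1)) (.scan (r + 1)) (hz ga w) (hz g (z + 1)) .idle Z := by
  have := nxt_quad act q0 x (l := hz g z) (sl := .scan r) (o := hz ga w) (a := hz g z)
    (sa := .idle) (z := Z) (l' := hz 1 1) (sl' := .scan (r + 1)) (o' := hz 1 0)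
    (a' := hz 1 1) (sa' := .idle) ?_ ?_ ?_
  · rw [this]; simp only [hz_mul, mul_one, add_zero]
  · simp [ruleL, h]
  · by_cases hh : hz g z = hz ga w <;> simp [ruleO, hh]
  · simp [ruleA, h]

theorem step_found (h : x (hz g z) = 1) :
    nxt (rl act q0) x (quad (hz g z) (.scan r) (hz ga w) (hz g z) .idle Z) =
      quad (hz g z) (.fetch q0 r) (hz ga w) (hz g z) .idle Z := by
  have := nxt_quad act q0 x (l := hz g z) (sl := .scan r) (o := hz ga w) (a := hz g z)
    (sa := .idle) (z := Z) (l' := hz 1 0) (sl' := .fetch q0 r) (o' := hz 1 0)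
    (a' := hz 1 0) (sa' := .idle) ?_ ?_ ?_
  · rw [this]; simp only [hz_mul, mul_one, add_zero]
  · simp [ruleL, h]
  · by_cases hh : hz g z = hz ga w <;> simp [ruleO, hh]
  · simp [ruleA, h]

/-- the state of the leader -/
theorem leader_state (c : FC (HZ G) 4 (St K Λ)) :
    (nxt (rl act q0) x c 0).2 = (ruleL act q0 (x (c 0).1) (view c (c 0).1)).2 := by
  simp [nxt, rl]

theorem view_self (c : FC (HZ G) 4 (St K Λ)) : view c (c 0).1 0 = some (c 0).2 := by simp [view]

theorem fin_persists (c : FC (HZ G) 4 (St K Λ)) (h : (c 0).2 = .fin) (n : ℕ) :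
    ((nxt (rl act q0) x)^[n] c 0).2 = .fin := by
  induction n with
  | zero => exact h
  | succ n ih =>
    rw [Function.iterate_succ_apply', leader_state]
    simp only [ruleL, view_self, ih]

theorem dead_persists (c : FC (HZ G) 4 (St K Λ)) (h : (c 0).2 = .dead) (n : ℕ) :
    ((nxt (rl act q0) x)^[n] c 0).2 = .dead := by
  induction n with
  | zero => exact h
  | succ n ih =>
    rw [Function.iterate_succ_apply', leader_state]
    simp only [ruleL, view_self, ih]

theorem scan0_dead (c : FC (HZ G) 4 (St K Λ)) (h : (c 0).2 = .scan0) (hx : x (c 0).1 ≠ 1) :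
    (nxt (rl act q0) x c 0).2 = .dead := by
  rw [leader_state]
  simp only [ruleL, view_self, h, hx, if_false]

end steps
end machine
end FH


namespace FH
set_option linter.unusedSectionVars false

section trips
open Classical
variable {G : Type*} [Group G] {K : Type} [Fintype K] {Λ : ℕ} [NeZero Λ]
variable (act : K → ZMod Λ → Act G K Λ) (q0 : K) (x : HZ G → Fin 2)

/-- position of the counter after `t` ticks -/
def alp (a : Act G K Λ) (n : ℕ) (t : ℕ) : ℤ := n + ∑ i ∈ Finset.range t, a.jmp (i : ZMod Λ)

theorem alp_succ (a : Act G K Λ) (n : ℕ) (t : ℕ) : alp a n (t + 1) = alp a n t + a.jmp (t : ZMod Λ) := by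
  simp [alp, Finset.sum_range_succ, add_assoc]

/-- big configurations -/
noncomputable def MC (w : ℤ) (Z : HZ G) (q : K) (n : ℕ) (g : G) : FC (HZ G) 4 (St K Λ) :=
  quad (hz g (w + n)) (.fetch q (n : ZMod Λ)) (hz g w) (hz g (w + n)) .idle Z

theorem trip (w : ℤ) (Z : HZ G) (q : K) (n : ℕ) (g : G) (hn : 1 ≤ n) (T : ℕ) (hT : n < T)
    (hs : (act q (n : ZMod Λ)).halt = false)
    (hm : alp (act q (n : ZMod Λ)) n T = T - n)
    (hno : ∀ t, n < t → t < T → alp (act q (n : ZMod Λ)) n t ≠ t - n) :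
    (nxt (rl act q0) x)^[T + 1] (MC w Z q n g) =
      MC w Z (act q (n : ZMod Λ)).nx (T - n) (g * (act q (n : ZMod Λ)).s) := by
  set a := act q (n : ZMod Λ) with ha
  have hA : ∀ t : ℕ, t + 1 ≤ n → (nxt (rl act q0) x)^[t + 1] (MC w Z q n g) =
      quad (hz g (w + n - (t + 1))) (.dn q n) (hz g w) (hz (g * a.s) (w + alp a n (t + 1)))
        (.actv q n ((t + 1 : ℕ) : ZMod Λ)) Z := by
    intro t
    induction t with
    | zero =>
      intro _
      have := step_fetch act q0 x g g (w + n) w q n Z hs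
      simp only [zero_add, Function.iterate_one, MC]
      rw [this]
      simp only [← ha]
      simp [alp, add_assoc]
    | succ t ih =>
      intro ht
      rw [Function.iterate_succ_apply', ih (by omega), step_dn, ← ha, alp_succ a n (t + 1), ← add_assoc]
      · congr 2
        · push_cast; ring
        · push_cast; rfl
      · omega
  have hB : (nxt (rl act q0) x)^[n + 1] (MC w Z q n g) =
      quad (hz (g * a.s) (w + 1)) (.up q n 1) (hz (g * a.s) w) (hz (g * a.s) (w + alp a n (n + 1)))
        (.actv q n ((n + 1 : ℕ) : ZMod Λ)) Z := by
    obtain ⟨k, rfl⟩ : ∃ k, n = k + 1 := ⟨n - 1, by omega⟩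
    rw [Function.iterate_succ_apply', hA k le_rfl]
    have e : w + ((k + 1 : ℕ) : ℤ) - (k + 1) = w := by push_cast; ring
    rw [e, step_turn, ← ha, alp_succ a (k + 1) (k + 1), ← add_assoc]
    congr 1
    push_cast; rfl
  have hC : ∀ j : ℕ, n + 1 + j ≤ T → (nxt (rl act q0) x)^[n + 1 + j] (MC w Z q n g) =
      quad (hz (g * a.s) (w + 1 + j)) (.up q n ((1 + j : ℕ) : ZMod Λ)) (hz (g * a.s) w)
        (hz (g * a.s) (w + alp a n (n + 1 + j))) (.actv q n ((n + 1 + j : ℕ) : ZMod Λ)) Z := by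
    intro j
    induction j with
    | zero => intro _; simp only [add_zero]; rw [hB]; simp
    | succ j ih =>
      intro hj
      rw [← add_assoc, Function.iterate_succ_apply', ih (by omega), step_up, ← ha,
        alp_succ a n (n + 1 + j), ← add_assoc]
      · congr 1
        · congr 1; push_cast; ring
        · congr 1; push_cast; ring
        · push_cast; simp [add_assoc]
        · push_cast; rfl
      · have := hno (n + 1 + j) (by omega) (by omega)
        push_cast at this ⊢
        intro h
        apply this
        linarith
  obtain ⟨j, rfl⟩ : ∃ j, T = n + 1 + j := ⟨T - n - 1, by omega⟩
  rw [Function.iterate_succ_apply', hC j le_rfl, hm]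
  have e : w + (((n + 1 + j : ℕ) : ℤ) - n) = w + 1 + j := by push_cast; ring
  rw [e, step_meet, ← ha]
  have e2 : n + 1 + j - n = 1 + j := by omega
  rw [e2, MC]
  have e3 : w + 1 + (j : ℤ) = w + ((1 + j : ℕ) : ℤ) := by push_cast; ring
  rw [e3]

/-- big steps -/
def MStep (a b : K × ℕ × G) : Prop :=
  1 ≤ a.2.1 ∧ (act a.1 (a.2.1 : ZMod Λ)).halt = false ∧ b.1 = (act a.1 (a.2.1 : ZMod Λ)).nx ∧
  b.2.2 = a.2.2 * (act a.1 (a.2.1 : ZMod Λ)).s ∧ ∃ T, a.2.1 < T ∧ b.2.1 = T - a.2.1 ∧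
    alp (act a.1 (a.2.1 : ZMod Λ)) a.2.1 T = T - a.2.1 ∧
    ∀ t, a.2.1 < t → t < T → alp (act a.1 (a.2.1 : ZMod Λ)) a.2.1 t ≠ t - a.2.1

theorem mstep_iter (w : ℤ) (Z : HZ G) (g0 : G) {a b : K × ℕ × G}
    (h : Relation.ReflTransGen (MStep act) a b) :
    ∃ N, (nxt (rl act q0) x)^[N] (MC w Z a.1 a.2.1 (g0 * a.2.2)) = MC w Z b.1 b.2.1 (g0 * b.2.2) := by
  induction h with
  | refl => exact ⟨0, rfl⟩
  | @tail b c _ hs ih =>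
    obtain ⟨N, hN⟩ := ih
    obtain ⟨h1, h2, h3, h4, T, h5, h6, h7, h8⟩ := hs
    refine ⟨T + 1 + N, ?_⟩
    rw [Function.iterate_add_apply, hN, trip act q0 x w Z b.1 b.2.1 _ h1 T h5 h2 h7 h8, h3, h4, h6, mul_assoc]

/-- initial states -/
def i0 : Fin 4 → St K Λ := ![.scan0, .idle, .idle, .idle]

theorem start_eq (h : HZ G) : (fun i => (h, i0 i) : FC (HZ G) 4 (St K Λ)) = quad h .scan0 h h .idle h := by
  apply quad_ext <;> rfl

theorem xP_one (P : ℕ) (g : G) (z : ℤ) : xP G P (hz g z) = 1 ↔ (P : ℤ) ∣ z := by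
  simp [xP]

theorem scan_run (P : ℕ) (hP : 1 ≤ P) (g0 : G) (z0 : ℤ) (hz0 : (P : ℤ) ∣ z0) :
    (nxt (rl act q0) (xP G P))^[P + 1] (fun i => (hz g0 z0, i0 i)) = MC z0 (hz g0 z0) q0 P g0 := by
  rw [start_eq]
  have hA : ∀ j : ℕ, j + 1 ≤ P → (nxt (rl act q0) (xP G P))^[j + 1]
      (quad (hz g0 z0) .scan0 (hz g0 z0) (hz g0 z0) .idle (hz g0 z0)) =
      quad (hz g0 (z0 + ((j + 1 : ℕ) : ℤ))) (.scan ((j + 1 : ℕ) : ZMod Λ)) (hz g0 z0)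
        (hz g0 (z0 + ((j + 1 : ℕ) : ℤ))) .idle (hz g0 z0) := by
    intro j
    induction j with
    | zero =>
      intro _
      rw [zero_add, Function.iterate_one, step_scan0 act q0 _ _ _ _ _ _ ((xP_one P _ _).2 hz0)]
      simp
    | succ j ih =>
      intro hj
      rw [Function.iterate_succ_apply', ih (by omega), step_scan]
      · congr 1
        · congr 1; push_cast; ring
        · push_cast; rfl
        · congr 1; push_cast; ring
      · rw [Ne, xP_one]
        intro h
        rw [Int.dvd_add_right hz0, Int.natCast_dvd_natCast] at h
        have := Nat.le_of_dvd (by omega) h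
        omega
  obtain ⟨j, rfl⟩ : ∃ j, P = j + 1 := ⟨P - 1, by omega⟩
  rw [Function.iterate_succ_apply', hA j le_rfl, step_found]
  · rfl
  · rw [xP_one]; exact dvd_add hz0 dvd_rfl

/-- the four headed automaton -/
noncomputable abbrev A4 : GWA (HZ G) 2 4 := mkGWA (rl act q0) (fun v => ∀ j, v j = some (i0 j))
  (fun v => v 0 = some .fin ∧ v 1 ≠ none ∧ v 3 = none)

theorem A4_mem (P : ℕ) (hP : 1 ≤ P) (q : K) (n : ℕ) (g : G) (hn : 1 ≤ n)
    (hr : Relation.ReflTransGen (MStep act) (q0, P, 1) (q, n, g))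
    (hs : (act q (n : ZMod Λ)).halt = true) : xP G P ∉ autSet (A4 act q0) ↔ g ≠ 1 := by
  rw [mk_mem _ _ _ i0 (fun v => Iff.rfl)]
  have main : ∀ (g0 : G) (z0 : ℤ), (P : ℤ) ∣ z0 → ∃ N, ∀ j : ℕ,
      ((nxt (rl act q0) (xP G P))^[N] (fun i => (hz g0 z0, i0 i)) 0).2 ≠ .fin ∧
      (nxt (rl act q0) (xP G P))^[N + 1 + j] (fun i => (hz g0 z0, i0 i)) =
        quad (hz (g0 * g) (z0 + n - 1 - j)) .fin (hz (g0 * g) z0) (hz (g0 * g) (z0 + n)) .idle (hz g0 z0) := by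
    intro g0 z0 hd
    obtain ⟨N, hN⟩ := mstep_iter act q0 (xP G P) z0 (hz g0 z0) g0 hr
    have h1 : (nxt (rl act q0) (xP G P))^[N + (P + 1)] (fun i => (hz g0 z0, i0 i)) =
        MC z0 (hz g0 z0) q n (g0 * g) := by
      rw [Function.iterate_add_apply, scan_run act q0 P hP g0 z0 hd]
      simpa using hN
    refine ⟨N + (P + 1), fun j => ⟨?_, ?_⟩⟩
    · rw [h1]; simp [MC, quad]
    · induction j with
      | zero =>
        rw [add_zero, Function.iterate_succ_apply', h1, MC, step_halt _ _ _ _ _ _ _ _ _ _ hs]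
        simp
      | succ j ih =>
        rw [← add_assoc, Function.iterate_succ_apply', ih, step_fin]
        congr 2
        push_cast; ring
  constructor
  · rintro ⟨⟨g0, z0⟩, m, ⟨hg, hzz⟩, h0, h1, h3⟩ rfl
    have : ∃ z : ℤ, (g0, z0) = hz g0 z := ⟨Multiplicative.toAdd z0, rfl⟩
    obtain ⟨z, hz'⟩ := this
    rw [hz'] at h0 h1 h3
    have hfin : ((nxt (rl act q0) (xP G P))^[m] (fun i => (hz g0 z, i0 i)) 0).2 = .fin := by
      simp only [view] at h0
      split_ifs at h0 with hh
      simpa using h0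
    by_cases hd : (P : ℤ) ∣ z
    · obtain ⟨N, hN⟩ := main g0 z hd
      have hm : N < m := by
        by_contra hcon
        apply (hN 0).1
        have := fin_persists act q0 (xP G P) _ hfin (N - m)
        rwa [← Function.iterate_add_apply, Nat.sub_add_cancel (by omega)] at this
      obtain ⟨j, rfl⟩ : ∃ j, m = N + 1 + j := ⟨m - N - 1, by omega⟩
      rw [(hN j).2] at h1 h3
      rw [view1] at h1
      rw [view3] at h3
      simp only [mul_one] at h1 h3
      split_ifs at h1 h3 <;> simp_all
    · cases m with
      | zero => simp [i0] at hfin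
      | succ m =>
        rw [Function.iterate_succ_apply, dead_persists] at hfin
        · cases hfin
        · apply scan0_dead
          · rfl
          · rw [Ne, xP_one]; exact hd
  · intro hg
    obtain ⟨N, hN⟩ := main 1 0 (dvd_zero _)
    refine ⟨hz 1 0, N + 1 + (n - 1), hz g 0, ?_⟩
    rw [(hN (n - 1)).2]
    have e : (0 : ℤ) + n - 1 - ((n - 1 : ℕ) : ℤ) = 0 := by omega
    rw [e, view0, view1, view3]
    simp [Ne.symm hg]

end trips
end FH


namespace FH
set_option linter.unusedSectionVars false

/-- flat instructions -/
inductive Ins (G : Type*) where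
  | mul (k q : ℕ) : Ins G
  | div (k q q' : ℕ) : Ins G
  | out (s : G) (q : ℕ) : Ins G

/-- the numbers that occur are controlled by the modulus -/
def Ins.ok {G : Type*} (Λ : ℕ) : Ins G → Prop
  | .mul k _ => 1 ≤ k ∧ k ∣ Λ ∧ k + 1 ∣ Λ
  | .div k _ _ => 1 ≤ k ∧ k ∣ Λ ∧ k + 1 ∣ Λ
  | .out _ _ => True

section flat
variable {G : Type*} [Group G]

/-- one step of the flat machine -/
inductive FS (code : List (Ins G)) : ℕ × ℕ × G → ℕ × ℕ × G → Prop
  | mul {pc n g k q} : code[pc]? = some (.mul k q) → FS code (pc, n, g) (q, k * n, g)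
  | div {pc n g k q q'} : code[pc]? = some (.div k q q') → FS code (pc, k * n, g) (q, n, g)
  | ndiv {pc n g k q q'} : code[pc]? = some (.div k q q') → ¬ k ∣ n → FS code (pc, n, g) (q', n, g)
  | out {pc n g s q} : code[pc]? = some (.out s q) → FS code (pc, n, g) (q, n, g * s)

/-- clipped program counters -/
def toK (L q : ℕ) : Fin (L + 1) := ⟨min q L, by omega⟩

open Classical in
/-- resolved instructions -/
noncomputable def actOf (Λ : ℕ) (code : List (Ins G)) (pc : Fin (code.length + 1)) (ρ : ZMod Λ) :
    Act G (Fin (code.length + 1)) Λ :=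
  match code[pc.val]? with
  | none => ⟨true, fun _ => 0, 1, pc⟩
  | some (.mul k q) => ⟨false, fun t => if t.val % (k + 1) = 0 then ((k : ℤ) - 1) else 0, 1, toK _ q⟩
  | some (.div k q q') => if k ∣ ρ.val then
      ⟨false, fun t => if t.val % (k + 1) = k then -((k : ℤ) - 1) else 0, 1, toK _ q⟩
      else ⟨false, fun _ => 0, 1, toK _ q'⟩
  | some (.out s q) => ⟨false, fun _ => 0, s, toK _ q⟩

theorem sum_mul (k : ℕ) (d : ℤ) (t : ℕ) :
    ∑ i ∈ Finset.range t, (if i % (k + 1) = 0 then d else 0) = d * ((t + k) / (k + 1) : ℕ) := by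
  induction t with
  | zero =>
    have : k / (k + 1) = 0 := Nat.div_eq_of_lt (by omega)
    rw [zero_add, this]; simp
  | succ t ih =>
    have h : k + 1 ∣ t + k + 1 ↔ t % (k + 1) = 0 := by
      rw [add_assoc, Nat.dvd_add_self_right, Nat.dvd_iff_mod_eq_zero]
    rw [Finset.sum_range_succ, ih, show t + 1 + k = t + k + 1 by ring, Nat.succ_div]
    simp only [h]
    split_ifs
    · rw [Nat.cast_add, Nat.cast_one]; ring
    · simp

theorem sum_div (k : ℕ) (d : ℤ) (t : ℕ) :
    ∑ i ∈ Finset.range t, (if i % (k + 1) = k then d else 0) = d * (t / (k + 1) : ℕ) := by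
  induction t with
  | zero => simp
  | succ t ih =>
    rw [Finset.sum_range_succ, ih, Nat.succ_div]
    have h : k + 1 ∣ t + 1 ↔ t % (k + 1) = k := by
      have h1 := Nat.div_add_mod t (k + 1)
      have h2 := Nat.mod_lt t (show 0 < k + 1 by omega)
      generalize t % (k + 1) = r at *
      generalize t / (k + 1) = j at *
      have h3 : t + 1 = (k + 1) * j + (r + 1) := by omega
      rw [h3, Nat.dvd_add_right (Dvd.intro _ rfl)]
      constructor
      · intro h
        have := Nat.le_of_dvd (by omega) h
        omega
      · rintro rfl; exact dvd_rfl
    simp only [h]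
    split_ifs
    · rw [Nat.cast_add, Nat.cast_one]; ring
    · simp

variable {Λ : ℕ} [NeZero Λ] {code : List (Ins G)}

theorem mod_natc {c : ℕ} (h : c ∣ Λ) (i : ℕ) : (i : ZMod Λ).val % c = i % c := by
  rw [ZMod.val_natCast, Nat.mod_mod_of_dvd _ h]

theorem dvd_cast {c : ℕ} (h : c ∣ Λ) (i : ℕ) : c ∣ (i : ZMod Λ).val ↔ c ∣ i := by
  rw [Nat.dvd_iff_mod_eq_zero, mod_natc h, ← Nat.dvd_iff_mod_eq_zero]

theorem toK_val {pc : ℕ} {i : Ins G} (h : code[pc]? = some i) : (toK code.length pc).val = pc := by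
  obtain ⟨h, _⟩ := List.getElem?_eq_some_iff.1 h
  simp [toK]; omega

theorem zero_jump (a : Act G (Fin (code.length + 1)) Λ) (ha : a.jmp = fun _ => 0) (n : ℕ) (hn : 1 ≤ n) :
    ∃ T, n < T ∧ n = T - n ∧ alp a n T = T - n ∧
    ∀ t, n < t → t < T → alp a n t ≠ t - n := by
  refine ⟨2 * n, by omega, by omega, ?_, fun t h1 h2 => ?_⟩
  · simp [alp, ha]; ring
  · simp [alp, ha]; omega

theorem fs_mstep (hok : ∀ i ∈ code, i.ok Λ) {a b : ℕ × ℕ × G} (hn : 1 ≤ a.2.1) (h : FS code a b) :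
    1 ≤ b.2.1 ∧ MStep (actOf Λ code) (toK _ a.1, a.2.1, a.2.2) (toK _ b.1, b.2.1, b.2.2) := by
  cases h with
  | @mul pc n g k q hc =>
    obtain ⟨hk, hd, hd'⟩ := hok _ (List.mem_of_getElem? hc)
    simp only at hn
    have hv := toK_val hc
    have hact : actOf Λ code (toK _ pc) n = ⟨false, fun t => if t.val % (k + 1) = 0 then ((k : ℤ) - 1) else 0, 1, toK _ q⟩ := by
      simp only [actOf, hv, hc]
    refine ⟨Nat.mul_pos hk hn, hn, ?_, ?_, ?_, ?_⟩
    · simp only [hact]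
    · simp only [hact]
    · simp only [hact, mul_one]
    · simp only [hact]
      have ha : ∀ t, alp (⟨false, fun t => if t.val % (k + 1) = 0 then ((k : ℤ) - 1) else 0, 1, toK _ q⟩ : Act G (Fin (code.length + 1)) Λ) n t = n + ((k : ℤ) - 1) * ((t + k) / (k + 1) : ℕ) := by
        intro t
        simp only [alp, mod_natc hd', sum_mul]
      refine ⟨(k + 1) * n, by nlinarith, ?_, ?_, ?_⟩
      · rw [Nat.succ_mul]; simp
      · rw [ha]
        have : ((k + 1) * n + k) / (k + 1) = n := by
          rw [Nat.mul_add_div (by omega), Nat.div_eq_of_lt (by omega)]; simp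
        rw [this]; push_cast; ring
      · intro t h1 h2
        rw [ha]
        have h3 := Nat.div_add_mod (t + k) (k + 1)
        have h4 := Nat.mod_lt (t + k) (show 0 < k + 1 by omega)
        generalize (t + k) / (k + 1) = j at *
        generalize (t + k) % (k + 1) = r at *
        intro h5
        have h6 : ((k : ℤ) + 1) * j + r = t + k := by exact_mod_cast h3
        have h7 : 2 * (j : ℤ) - k + r = 2 * n := by linarith
        have h8 : (r : ℤ) ≤ k := by omega
        have h9 : (n : ℤ) ≤ j := by linarith
        have h10 : ((k : ℤ) + 1) * n ≤ (k + 1) * j := mul_le_mul_of_nonneg_left h9 (by positivity)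
        have h11 : (t : ℤ) < (k + 1) * n := by exact_mod_cast h2
        have h12 : (r : ℤ) < k := by linarith
        have h13 : (n : ℤ) + 1 ≤ j := by omega
        have h14 : ((k : ℤ) + 1) * (n + 1) ≤ (k + 1) * j := mul_le_mul_of_nonneg_left h13 (by positivity)
        have : (0 : ℤ) ≤ r := by positivity
        linarith
  | @div pc n g k q q' hc =>
    obtain ⟨hk, hd, hd'⟩ := hok _ (List.mem_of_getElem? hc)
    simp only at hn
    have hn1 : 1 ≤ n := by
      by_contra h
      have : n = 0 := by omega
      simp [this] at hn
    have hv := toK_val hc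
    have hact : actOf Λ code (toK _ pc) ((k * n : ℕ) : ZMod Λ) = ⟨false, fun t => if t.val % (k + 1) = k then -((k : ℤ) - 1) else 0, 1, toK _ q⟩ := by
      simp only [actOf, hv, hc]
      rw [if_pos ((dvd_cast hd _).2 (Dvd.intro _ rfl))]
    refine ⟨hn1, hn, ?_, ?_, ?_, ?_⟩
    · simp only [hact]
    · simp only [hact]
    · simp only [hact, mul_one]
    · simp only [hact]
      have ha : ∀ t, alp (⟨false, fun t => if t.val % (k + 1) = k then -((k : ℤ) - 1) else 0, 1, toK _ q⟩ : Act G (Fin (code.length + 1)) Λ) (k * n) t = (k * n : ℕ) + -((k : ℤ) - 1) * (t / (k + 1) : ℕ) := by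
        intro t
        simp only [alp, mod_natc hd', sum_div]
      refine ⟨(k + 1) * n, by nlinarith, ?_, ?_, ?_⟩
      · rw [Nat.succ_mul]; simp
      · rw [ha]
        rw [Nat.mul_div_cancel_left _ (by omega)]; push_cast; ring
      · intro t h1 h2
        rw [ha]
        have h3 := Nat.div_add_mod t (k + 1)
        have h4 := Nat.mod_lt t (show 0 < k + 1 by omega)
        generalize t / (k + 1) = j at *
        generalize t % (k + 1) = r at *
        intro h5
        push_cast at h5
        have h6 : ((k : ℤ) + 1) * j + r = t := by exact_mod_cast h3
        have h7 : 2 * (k : ℤ) * j + r = 2 * k * n := by linarith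
        have h8 : (r : ℤ) ≤ k := by omega
        have h0 : (0 : ℤ) ≤ r := by positivity
        have hk' : (1 : ℤ) ≤ k := by exact_mod_cast hk
        have h11 : (t : ℤ) < (k + 1) * n := by exact_mod_cast h2
        rcases lt_trichotomy (j : ℤ) n with hj | hj | hj
        · have : (k : ℤ) * (j + 1) ≤ k * n := mul_le_mul_of_nonneg_left (by omega) (by positivity)
          linarith
        · rw [hj] at h6; linarith
        · have : (k : ℤ) * (n + 1) ≤ k * j := mul_le_mul_of_nonneg_left (by omega) (by positivity)
          linarith
  | @ndiv pc n g k q q' hc hnd =>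
    obtain ⟨hk, hd, hd'⟩ := hok _ (List.mem_of_getElem? hc)
    have hv := toK_val hc
    have hact : actOf Λ code (toK _ pc) ((n : ℕ) : ZMod Λ) = ⟨false, fun _ => 0, 1, toK _ q'⟩ := by
      simp only [actOf, hv, hc]
      rw [if_neg (fun h => hnd ((dvd_cast hd _).1 h))]
    refine ⟨hn, hn, ?_, ?_, ?_, ?_⟩
    · simp only [hact]
    · simp only [hact]
    · simp only [hact, mul_one]
    · simp only [hact]
      exact zero_jump _ rfl _ hn
  | @out pc n g s q hc =>
    have hv := toK_val hc
    have hact : actOf Λ code (toK _ pc) ((n : ℕ) : ZMod Λ) = ⟨false, fun _ => 0, s, toK _ q⟩ := by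
      simp only [actOf, hv, hc]
    refine ⟨hn, hn, ?_, ?_, ?_, ?_⟩
    · simp only [hact]
    · simp only [hact]
    · simp only [hact]
    · simp only [hact]
      exact zero_jump _ rfl _ hn

theorem fs_msteps (hok : ∀ i ∈ code, i.ok Λ) {a b : ℕ × ℕ × G} (hn : 1 ≤ a.2.1)
    (h : Relation.ReflTransGen (FS code) a b) :
    1 ≤ b.2.1 ∧ Relation.ReflTransGen (MStep (actOf Λ code))
      (toK _ a.1, a.2.1, a.2.2) (toK _ b.1, b.2.1, b.2.2) := by
  induction h with
  | refl => exact ⟨hn, .refl⟩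
  | tail _ hs ih =>
    have := fs_mstep hok ih.1 hs
    exact ⟨this.1, ih.2.tail this.2⟩

theorem exists_modulus (code : List (Ins G))
    (h : ∀ i ∈ code, ∀ k q q', i = .mul k q ∨ i = .div k q q' → 1 ≤ k) :
    ∃ Λ : ℕ, Λ ≠ 0 ∧ ∀ i ∈ code, i.ok Λ := by
  induction code with
  | nil => exact ⟨1, by simp, by simp⟩
  | cons i l ih =>
    obtain ⟨Λ, h1, h2⟩ := ih (fun j hj => h j (List.mem_cons_of_mem _ hj))
    have hmono : ∀ (i : Ins G) (Λ c : ℕ), i.ok Λ → i.ok (Λ * c) := by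
      intro i Λ c hi
      cases i with
      | mul k q => exact ⟨hi.1, hi.2.1.mul_right _, hi.2.2.mul_right _⟩
      | div k q q' => exact ⟨hi.1, hi.2.1.mul_right _, hi.2.2.mul_right _⟩
      | out s q => trivial
    have hi : ∃ c, c ≠ 0 ∧ i.ok c := by
      have := h i List.mem_cons_self
      cases i with
      | mul k q =>
        have hk := this k q 0 (Or.inl rfl)
        exact ⟨k * (k + 1), by positivity, hk, Dvd.intro _ rfl, Dvd.intro_left _ rfl⟩
      | div k q q' =>
        have hk := this k q q' (Or.inr rfl)
        exact ⟨k * (k + 1), by positivity, hk, Dvd.intro _ rfl, Dvd.intro_left _ rfl⟩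
      | out s q => exact ⟨1, one_ne_zero, trivial⟩
    obtain ⟨c, hc, hic⟩ := hi
    refine ⟨Λ * c, by positivity, ?_⟩
    intro j hj
    rcases List.mem_cons.1 hj with rfl | hj
    · rw [mul_comm]; exact hmono _ _ _ hic
    · exact hmono _ _ _ (h2 j hj)

/-- a flat program gives a four headed automaton -/
theorem flat_aut (code : List (Ins G))
    (h : ∀ i ∈ code, ∀ k q q', i = .mul k q ∨ i = .div k q q' → 1 ≤ k) :
    ∃ aut : GWA (HZ G) 2 4, ∀ (P n : ℕ) (g : G), 1 ≤ P →
      Relation.ReflTransGen (FS code) (0, P, 1) (code.length, n, g) →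
      (xP G P ∉ autSet aut ↔ g ≠ 1) := by
  obtain ⟨Λ, h0, hok⟩ := exists_modulus code h
  haveI : NeZero Λ := ⟨h0⟩
  refine ⟨A4 (actOf Λ code) (toK _ 0), fun P n g hP hr => ?_⟩
  obtain ⟨h1, h2⟩ := fs_msteps hok hP hr
  refine A4_mem _ _ P hP _ n g h1 h2 ?_
  simp [actOf, toK]

end flat
end FH


namespace FH
set_option linter.unusedSectionVars false

/-- structured counter programs -/
inductive Pg (G : Type*) where
  | inc (r : ℕ) : Pg G
  | dec (r : ℕ) : Pg G
  | out (s : G) : Pg G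
  | seq (P Q : Pg G) : Pg G
  | loop (r : ℕ) (P : Pg G) : Pg G

section prog
variable {G : Type*} [Group G]

/-- big step semantics -/
inductive Run : Pg G → (ℕ → ℕ) → G → (ℕ → ℕ) → G → Prop
  | inc {r σ g} : Run (.inc r) σ g (Function.update σ r (σ r + 1)) g
  | dec {r σ g} : Run (.dec r) σ g (Function.update σ r (σ r - 1)) g
  | out {s σ g} : Run (.out s) σ g σ (g * s)
  | seq {P Q σ g σ' g' σ'' g''} : Run P σ g σ' g' → Run Q σ' g' σ'' g'' → Run (.seq P Q) σ g σ'' g''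
  | loop0 {r P σ g} : σ r = 0 → Run (.loop r P) σ g σ g
  | loopS {r P σ g σ' g' σ'' g''} : σ r ≠ 0 → Run P σ g σ' g' → Run (.loop r P) σ' g' σ'' g'' →
      Run (.loop r P) σ g σ'' g''

/-- registers are bounded -/
def Pg.bd (R : ℕ) : Pg G → Prop
  | .inc r => r < R
  | .dec r => r < R
  | .out _ => True
  | .seq P Q => P.bd R ∧ Q.bd R
  | .loop r P => r < R ∧ P.bd R

theorem Pg.bd_mono {R R' : ℕ} (h : R ≤ R') : ∀ P : Pg G, P.bd R → P.bd R'
  | .inc _, hp => lt_of_lt_of_le hp h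
  | .dec _, hp => lt_of_lt_of_le hp h
  | .out _, _ => trivial
  | .seq P Q, hp => ⟨P.bd_mono h hp.1, Q.bd_mono h hp.2⟩
  | .loop _ P, hp => ⟨lt_of_lt_of_le hp.1 h, P.bd_mono h hp.2⟩

theorem Pg.bd_exists (P : Pg G) : ∃ R, P.bd R := by
  induction P with
  | inc r => exact ⟨r + 1, Nat.lt_succ_self r⟩
  | dec r => exact ⟨r + 1, Nat.lt_succ_self r⟩
  | out s => exact ⟨0, trivial⟩
  | seq P Q ih ih' =>
    obtain ⟨R, h⟩ := ih
    obtain ⟨R', h'⟩ := ih'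
    exact ⟨max R R', P.bd_mono (le_max_left _ _) h, Q.bd_mono (le_max_right _ _) h'⟩
  | loop r P ih =>
    obtain ⟨R, h⟩ := ih
    exact ⟨max R (r + 1), lt_of_lt_of_le (Nat.lt_succ_self r) (le_max_right _ _), P.bd_mono (le_max_left _ _) h⟩

/-- the primes -/
noncomputable def pr (r : ℕ) : ℕ := Nat.nth Nat.Prime r

theorem pr_prime (r : ℕ) : (pr r).Prime := Nat.prime_nth_prime r

theorem pr_inj {r s : ℕ} (h : pr r = pr s) : r = s :=
  Nat.nth_injective Nat.infinite_setOf_prime h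

theorem pr_zero : pr 0 = 2 := Nat.nth_prime_zero_eq_two

/-- encoding of register contents -/
noncomputable def enc (R : ℕ) (σ : ℕ → ℕ) : ℕ := ∏ r ∈ Finset.range R, pr r ^ σ r

theorem enc_update (R : ℕ) (σ : ℕ → ℕ) {r : ℕ} (hr : r < R) (v : ℕ) :
    enc R (Function.update σ r v) = pr r ^ v * ∏ s ∈ (Finset.range R).erase r, pr s ^ σ s := by
  rw [enc, ← Finset.mul_prod_erase _ _ (Finset.mem_range.2 hr)]
  simp only [Function.update_self]
  congr 1
  apply Finset.prod_congr rfl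
  intro s hs
  rw [Function.update_of_ne (Finset.ne_of_mem_erase hs)]

theorem enc_inc (R : ℕ) (σ : ℕ → ℕ) {r : ℕ} (hr : r < R) :
    enc R (Function.update σ r (σ r + 1)) = pr r * enc R σ := by
  have h := enc_update R σ hr (σ r)
  rw [Function.update_eq_self] at h
  rw [enc_update R σ hr, h, pow_succ]; ring

theorem enc_dec (R : ℕ) (σ : ℕ → ℕ) {r : ℕ} (hr : r < R) (h : σ r ≠ 0) :
    enc R σ = pr r * enc R (Function.update σ r (σ r - 1)) := by
  have := enc_inc R (Function.update σ r (σ r - 1)) hr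
  rw [← this]
  simp only [Function.update_self, Function.update_idem]
  rw [Nat.sub_add_cancel (by omega), Function.update_eq_self]

theorem enc_ndvd (R : ℕ) (σ : ℕ → ℕ) {r : ℕ} (h : σ r = 0) : ¬ pr r ∣ enc R σ := by
  intro hd
  rw [enc, Prime.dvd_finset_prod_iff (pr_prime r).prime] at hd
  obtain ⟨s, _, hs⟩ := hd
  have h1 := (Nat.prime_dvd_prime_iff_eq (pr_prime r) (pr_prime s)).1 ((pr_prime r).dvd_of_dvd_pow hs)
  have := pr_inj h1
  subst this
  rw [h, pow_zero] at hs
  exact (pr_prime r).one_lt.ne' (Nat.dvd_one.1 hs)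

/-- compilation -/
noncomputable def cmp : Pg G → ℕ → List (Ins G)
  | .inc r, a => [.mul (pr r) (a + 1)]
  | .dec r, a => [.div (pr r) (a + 1) (a + 1)]
  | .out s, a => [.out s (a + 1)]
  | .seq P Q, a => cmp P a ++ cmp Q (a + (cmp P a).length)
  | .loop r P, a => [.div (pr r) (a + 1) (a + 3 + (cmp P (a + 2)).length), .mul (pr r) (a + 2)] ++
      (cmp P (a + 2) ++ [.out 1 a])

theorem cmp_pos (P : Pg G) (a : ℕ) :
    ∀ i ∈ cmp P a, ∀ k q q', i = .mul k q ∨ i = .div k q q' → 1 ≤ k := by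
  have hp : ∀ r, 1 ≤ pr r := fun r => (pr_prime r).one_lt.le
  induction P generalizing a with
  | inc r => intro i hi k q q' h; simp [cmp] at hi; subst hi; rcases h with h | h <;> cases h; exact hp r
  | dec r => intro i hi k q q' h; simp [cmp] at hi; subst hi; rcases h with h | h <;> cases h; exact hp r
  | out s => intro i hi k q q' h; simp [cmp] at hi; subst hi; rcases h with h | h <;> cases h
  | seq P Q ih ih' =>
    intro i hi
    rcases List.mem_append.1 hi with h | h
    · exact ih a i h
    · exact ih' _ i h
  | loop r P ih =>
    intro i hi
    simp only [cmp, List.mem_append, List.mem_cons, List.not_mem_nil, or_false] at hi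
    rcases hi with (rfl | rfl) | hi | rfl
    · intro k q q' h; rcases h with h | h <;> cases h; exact hp r
    · intro k q q' h; rcases h with h | h <;> cases h; exact hp r
    · exact ih _ i hi
    · intro k q q' h; rcases h with h | h <;> cases h

theorem get_mid {pre l post : List (Ins G)} {i : ℕ} (hi : i < l.length) :
    (pre ++ (l ++ post))[pre.length + i]? = l[i]? := by
  rw [List.getElem?_append_right (by omega), Nat.add_sub_cancel_left, List.getElem?_append_left hi]

theorem cmp_run {R : ℕ} {P : Pg G} {σ σ' : ℕ → ℕ} {g g' : G} (h : Run P σ g σ' g') (hb : P.bd R)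
    (pre post : List (Ins G)) (a : ℕ) (ha : pre.length = a) :
    Relation.ReflTransGen (FS (pre ++ (cmp P a ++ post))) (a, enc R σ, g)
      (a + (cmp P a).length, enc R σ', g') := by
  induction h generalizing pre post a with
  | @inc r σ g =>
    apply Relation.ReflTransGen.single
    rw [enc_inc R σ hb]
    apply FS.mul
    have := get_mid (pre := pre) (l := cmp (.inc r) a) (post := post) (i := 0) (by simp [cmp])
    rw [add_zero, ha] at this
    rw [this]; rfl
  | @dec r σ g =>
    apply Relation.ReflTransGen.single
    have := get_mid (pre := pre) (l := cmp (.dec r) a) (post := post) (i := 0) (by simp [cmp])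
    rw [add_zero, ha] at this
    have e : (cmp (.dec r : Pg G) a)[0]? = some (.div (pr r) (a + 1) (a + 1)) := rfl
    rw [e] at this
    by_cases h : σ r = 0
    · have : Function.update σ r (σ r - 1) = σ := by rw [h, Nat.zero_sub, ← h, Function.update_eq_self]
      rw [this]
      exact FS.ndiv (by assumption) (enc_ndvd R σ h)
    · rw [enc_dec R σ hb h]
      exact FS.div this
  | @out s σ g =>
    apply Relation.ReflTransGen.single
    have := get_mid (pre := pre) (l := cmp (.out s) a) (post := post) (i := 0) (by simp [cmp])
    rw [add_zero, ha] at this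
    exact FS.out this
  | @seq P Q σ g σ' g' σ'' g'' _ _ ih ih' =>
    have h1 := ih hb.1 pre (cmp Q (a + (cmp P a).length) ++ post) a ha
    have h2 := ih' hb.2 (pre ++ cmp P a) post (a + (cmp P a).length) (by simp [ha])
    simp only [cmp, List.append_assoc, List.length_append] at h1 h2 ⊢
    rw [← add_assoc]
    exact h1.trans h2
  | @loop0 r P σ g h0 =>
    apply Relation.ReflTransGen.single
    have := get_mid (pre := pre) (l := cmp (.loop r P) a) (post := post) (i := 0) (by simp [cmp])
    rw [add_zero, ha] at this
    have e : (cmp (.loop r P) a)[0]? = some (.div (pr r) (a + 1) (a + 3 + (cmp P (a + 2)).length)) := rfl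
    rw [e] at this
    have el : a + (cmp (.loop r P) a).length = a + 3 + (cmp P (a + 2)).length := by
      simp [cmp]; ring
    rw [el]
    exact FS.ndiv this (enc_ndvd R σ h0)
  | @loopS r P σ g σ' g' σ'' g'' h0 _ _ ih ih' =>
    refine Relation.ReflTransGen.trans ?_ (ih' hb pre post a ha)
    have e0 := get_mid (pre := pre) (l := cmp (.loop r P) a) (post := post) (i := 0) (by simp [cmp])
    have e1 := get_mid (pre := pre) (l := cmp (.loop r P) a) (post := post) (i := 1) (by simp [cmp])
    have e2 := get_mid (pre := pre) (l := cmp (.loop r P) a) (post := post)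
      (i := 2 + (cmp P (a + 2)).length) (by simp [cmp]; omega)
    rw [add_zero, ha] at e0
    rw [ha] at e1 e2
    have s0 : FS (pre ++ (cmp (.loop r P) a ++ post)) (a, enc R σ, g)
        (a + 1, enc R (Function.update σ r (σ r - 1)), g) := by
      rw [enc_dec R σ hb.1 h0]
      exact FS.div (e0.trans rfl)
    have s1 : FS (pre ++ (cmp (.loop r P) a ++ post)) (a + 1, enc R (Function.update σ r (σ r - 1)), g)
        (a + 2, enc R σ, g) := by
      rw [enc_dec R σ hb.1 h0]
      exact FS.mul (e1.trans rfl)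
    have s2 := ih hb.2 (pre ++ [.div (pr r) (a + 1) (a + 3 + (cmp P (a + 2)).length), .mul (pr r) (a + 2)])
      ([.out 1 a] ++ post) (a + 2) (by simp [ha])
    have ec : pre ++ (cmp (.loop r P) a ++ post) =
      pre ++ [.div (pr r) (a + 1) (a + 3 + (cmp P (a + 2)).length), .mul (pr r) (a + 2)] ++
        (cmp P (a + 2) ++ ([.out 1 a] ++ post)) := by simp [cmp]
    rw [← ec] at s2
    have s3 : FS (pre ++ (cmp (.loop r P) a ++ post)) (a + 2 + (cmp P (a + 2)).length, enc R σ', g')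
        (a, enc R σ', g' * 1) := by
      apply FS.out
      rw [add_assoc, e2]
      simp only [cmp]
      rw [List.getElem?_append_right (by simp)]
      rw [List.getElem?_append_right (by simp)]
      simp
    rw [mul_one] at s3
    exact (((Relation.ReflTransGen.single s0).tail s1).trans s2).tail s3

/-- a structured program gives a four headed automaton -/
theorem prog_aut (P : Pg G) : ∃ aut : GWA (HZ G) 2 4, ∀ (p : ℕ) (σ : ℕ → ℕ) (g : G),
    Run P (Function.update (fun _ => 0) 0 p) 1 σ g → (xP G (2 ^ p) ∉ autSet aut ↔ g ≠ 1) := by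
  obtain ⟨aut, ha⟩ := flat_aut (cmp P 0) (cmp_pos P 0)
  refine ⟨aut, fun p σ g h => ?_⟩
  obtain ⟨R, hR⟩ := P.bd_exists
  have hR' := P.bd_mono (show R ≤ R + 1 by omega) hR
  have := cmp_run h hR' [] [] 0 rfl
  simp only [List.nil_append, List.append_nil, zero_add] at this
  have e : enc (R + 1) (Function.update (fun _ => 0) 0 p) = 2 ^ p := by
    rw [enc_update _ _ (by omega), pr_zero]
    simp
  rw [e] at this
  exact ha _ _ g (Nat.one_le_two_pow) this

end prog
end FH


namespace FH
set_option linter.unusedSectionVars false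

section comp
variable {G : Type*} [Group G]

theorem Run.to {P : Pg G} {σ σ' σ'' : ℕ → ℕ} {g g' : G} (h : Run P σ g σ' g') (e : σ' = σ'') :
    Run P σ g σ'' g' := e ▸ h

theorem run_loop {r : ℕ} {P : Pg G} (n : ℕ) (F : ℕ → ℕ → ℕ) (Γ : ℕ → G)
    (h : ∀ i < n, F i r ≠ 0 ∧ Run P (F i) (Γ i) (F (i + 1)) (Γ (i + 1))) (hn : F n r = 0) :
    Run (.loop r P) (F 0) (Γ 0) (F n) (Γ n) := by
  induction n generalizing F Γ with
  | zero => exact Run.loop0 hn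
  | succ n ih =>
    have := ih (fun i => F (i + 1)) (fun i => Γ (i + 1)) (fun i hi => h (i + 1) (by omega)) hn
    exact Run.loopS (h 0 (by omega)).1 (h 0 (by omega)).2 this

/-- clear a register -/
def clr (a : ℕ) : Pg G := .loop a (.dec a)

theorem clr_run (a : ℕ) (σ : ℕ → ℕ) (g : G) : Run (clr a) σ g (Function.update σ a 0) g := by
  have := run_loop (r := a) (P := .dec a) (σ a) (fun i => Function.update σ a (σ a - i))
    (fun _ => g) (fun i hi => ⟨by simp; omega, Run.dec.to (by simp [Nat.sub_sub])⟩) (by simp)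
  simpa [clr] using this

/-- add register `a` to `b` using scratch `t` -/
def cpy (a b t : ℕ) : Pg G :=
  .seq (.loop a (.seq (.dec a) (.seq (.inc b) (.inc t)))) (.loop t (.seq (.dec t) (.inc a)))

theorem cpy_run {a b t : ℕ} (hab : a ≠ b) (hat : a ≠ t) (hbt : b ≠ t) (σ : ℕ → ℕ) (ht : σ t = 0)
    (g : G) : Run (cpy a b t) σ g (Function.update σ b (σ b + σ a)) g := by
  have h1 := run_loop (r := a) (P := .seq (.dec a) (.seq (.inc b) (.inc t))) (σ a)
    (fun i => Function.update (Function.update (Function.update σ a (σ a - i)) b (σ b + i)) t i)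
    (fun _ => g) (fun i hi => ⟨by simp [Function.update_apply, hab, hat]; omega,
      (Run.seq Run.dec (Run.seq Run.inc Run.inc)).to (by
        funext r; simp only [Function.update_apply]; grind)⟩)
    (by simp [Function.update_apply, hab, hat])
  have h2 := run_loop (r := t) (P := .seq (.dec t) (.inc a)) (σ a)
    (fun i => Function.update (Function.update (Function.update σ a i) b (σ b + σ a)) t (σ a - i))
    (fun _ => g) (fun i hi => ⟨by simp; omega,
      (Run.seq Run.dec Run.inc).to (by
        funext r; simp only [Function.update_apply]; grind)⟩)
    (by simp)
  simp only [tsub_self, tsub_zero] at h1 h2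
  have e : Function.update (Function.update (Function.update σ a (σ a)) b (σ b + 0)) t 0 = σ := by
    funext r; simp only [Function.update_apply]; grind
  rw [e] at h1
  refine (Run.seq h1 h2).to ?_
  funext r; simp only [Function.update_apply]; grind

/-- compilable partial functions -/
def Cb (G : Type*) [Group G] {n : ℕ} (f : List.Vector ℕ n →. ℕ) : Prop :=
  ∀ (k : ℕ) (x : Fin n → ℕ) (o : ℕ), (∀ i, x i < k) → o < k → (∀ i, x i ≠ o) →
    ∃ P : Pg G, ∀ (σ : ℕ → ℕ) (g : G) (y : ℕ), (∀ r, k ≤ r → σ r = 0) → σ o = 0 →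
      y ∈ f (List.Vector.ofFn fun i => σ (x i)) → Run P σ g (Function.update σ o y) g

theorem cb_zero : Cb G (n := 0) (fun _ => Part.some 0) := by
  intro k x o hx ho hxo
  refine ⟨clr o, fun σ g y h0 h1 hy => ?_⟩
  rw [Part.mem_some_iff] at hy
  rw [hy]
  exact clr_run o σ g

theorem cb_get {n : ℕ} (i : Fin n) : Cb G (n := n) (fun v => Part.some (v.get i)) := by
  intro k x o hx ho hxo
  refine ⟨cpy (x i) o k, fun σ g y h0 h1 hy => ?_⟩
  rw [Part.mem_some_iff, List.Vector.get_ofFn] at hy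
  refine (cpy_run (hxo i) (hx i).ne ho.ne σ (h0 k le_rfl) g).to ?_
  rw [hy, h1, zero_add]

theorem cb_succ : Cb G (n := 1) (fun v => Part.some (Nat.succ v.head)) := by
  intro k x o hx ho hxo
  refine ⟨.seq (cpy (x 0) o k) (.inc o), fun σ g y h0 h1 hy => ?_⟩
  rw [Part.mem_some_iff, List.Vector.head_ofFn] at hy
  refine ((cpy_run (hxo 0) (hx 0).ne ho.ne σ (h0 k le_rfl) g).seq Run.inc).to ?_
  rw [hy, h1, zero_add]
  simp

/-- fill a block of registers -/
def fill (σ : ℕ → ℕ) (k : ℕ) (w : ℕ → ℕ) (j : ℕ) : ℕ → ℕ :=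
  fun r => if k ≤ r ∧ r < k + j then w (r - k) else σ r

theorem clrs (k j : ℕ) : ∃ P : Pg G, ∀ σ g, Run P σ g (fill σ k (fun _ => 0) j) g := by
  induction j with
  | zero =>
    refine ⟨.seq (.inc 0) (.dec 0), fun σ g => (Run.seq Run.inc Run.dec).to ?_⟩
    funext r; simp only [Function.update_apply, fill]; grind
  | succ j ih =>
    obtain ⟨P, hP⟩ := ih
    refine ⟨.seq P (clr (k + j)), fun σ g => ((hP σ g).seq (clr_run _ _ _)).to ?_⟩
    funext r; simp only [Function.update_apply, fill]; grind

theorem cb_comp {m n : ℕ} {f : List.Vector ℕ n →. ℕ} {g : Fin n → List.Vector ℕ m →. ℕ}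
    {h : List.Vector ℕ m →. ℕ} (hf : Cb G f) (hg : ∀ i, Cb G (g i))
    (hh : ∀ v y, y ∈ h v → ∃ w : Fin n → ℕ, (∀ i, w i ∈ g i v) ∧ y ∈ f (List.Vector.ofFn w)) :
    Cb G h := by
  intro k x o hx ho hxo
  have hQ : ∀ j, j ≤ n → ∃ P : Pg G, ∀ (σ : ℕ → ℕ) (γ : G) (w : ℕ → ℕ), (∀ r, k ≤ r → σ r = 0) →
      (∀ i : Fin n, w i ∈ g i (List.Vector.ofFn fun i => σ (x i))) →
      Run P σ γ (fill σ k w j) γ := by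
    intro j
    induction j with
    | zero =>
      intro _
      obtain ⟨P, hP⟩ := clrs (G := G) k 0
      refine ⟨P, fun σ γ w _ _ => (hP σ γ).to ?_⟩
      funext r; simp only [fill]; grind
    | succ j ih =>
      intro hj
      obtain ⟨P, hP⟩ := ih (by omega)
      obtain ⟨Q, hQ⟩ := hg ⟨j, hj⟩ (k + n) x (k + j) (fun i => by have := hx i; omega) (by omega)
        (fun i => by have := hx i; omega)
      refine ⟨.seq P Q, fun σ γ w h0 hw => ((hP σ γ w h0 hw).seq (hQ _ γ (w j) ?_ ?_ ?_)).to ?_⟩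
      · intro r hr; simp only [fill]; have := h0 r (by omega); grind
      · simp only [fill]; have := h0 (k + j) (by omega); grind
      · have e : (fun i => fill σ k w j (x i)) = fun i => σ (x i) := by
          funext i; have := hx i; simp only [fill]; grind
        rw [e]; exact hw ⟨j, hj⟩
      · funext r; simp only [Function.update_apply, fill]; grind
  obtain ⟨P, hP⟩ := hQ n le_rfl
  obtain ⟨Q, hQ⟩ := hf (k + n) (fun i => k + i) o (fun i => by have := i.2; omega) (by omega)
    (fun i => by omega)
  obtain ⟨C, hC⟩ := clrs (G := G) k n
  refine ⟨.seq P (.seq Q C), fun σ γ y h0 h1 hy => ?_⟩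
  obtain ⟨w, hw, hwy⟩ := hh _ _ hy
  have hw' : ∀ i : Fin n, (fun j => if h : j < n then w ⟨j, h⟩ else 0) i.val = w i := fun i => by
    simp
  refine ((hP σ γ (fun j => if h : j < n then w ⟨j, h⟩ else 0) h0 ?_).seq
    ((hQ _ γ y ?_ ?_ ?_).seq (hC _ _))).to ?_
  · intro i; have := hw i; rw [← hw' i] at this; exact this
  · intro r hr; simp only [fill]; have := h0 r (by omega); grind
  · simp only [fill]; grind
  · convert hwy using 3
    funext i; simp [fill]
  · funext r; simp only [Function.update_apply, fill]
    have := h0 r; grind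

theorem cb_prec {n : ℕ} {f : List.Vector ℕ n → ℕ} {g : List.Vector ℕ (n + 2) → ℕ}
    (hf : Cb G (fun v => Part.some (f v))) (hg : Cb G (fun v => Part.some (g v))) :
    Cb G (fun v : List.Vector ℕ (n + 1) =>
      Part.some (v.head.rec (f v.tail) fun y IH => g (y ::ᵥ IH ::ᵥ v.tail))) := by
  intro k x o hx ho hxo
  obtain ⟨Q, hQ⟩ := hf (k + 4) (fun i => x i.succ) (k + 2) (fun i => by have := hx i.succ; omega)
    (by omega) (fun i => by have := hx i.succ; omega)
  obtain ⟨R, hR⟩ := hg (k + 4) (Fin.cons (k + 1) (Fin.cons (k + 2) fun i => x i.succ)) (k + 3)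
    (by
      refine Fin.cases ?_ (Fin.cases ?_ fun i => ?_)
      · simp
      · simp
      · have := hx i.succ; simp; omega)
    (by omega)
    (by
      refine Fin.cases ?_ (Fin.cases ?_ fun i => ?_)
      · simp
      · simp
      · have := hx i.succ; simp; omega)
  refine ⟨.seq (cpy (x 0) k (k + 1)) (.seq Q (.seq (.loop k (.seq (.dec k) (.seq R
    (.seq (clr (k + 2)) (.seq (cpy (k + 3) (k + 2) (k + 4)) (.seq (clr (k + 3)) (.inc (k + 1))))))))
    (.seq (cpy (k + 2) o (k + 3)) (.seq (clr (k + 2)) (clr (k + 1)))))),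
    fun σ γ y h0 h1 hy => ?_⟩
  rw [Part.mem_some_iff] at hy
  set t : List.Vector ℕ n := List.Vector.ofFn fun i => σ (x i.succ) with ht
  have et : (List.Vector.ofFn fun i => σ (x i)) = σ (x 0) ::ᵥ t := rfl
  rw [et, List.Vector.head_cons, List.Vector.tail_cons] at hy
  set rc : ℕ → ℕ := fun N => N.rec (f t) fun y IH => g (y ::ᵥ IH ::ᵥ t) with hrc
  have rc0 : rc 0 = f t := rfl
  have rcS : ∀ i, rc (i + 1) = g (i ::ᵥ rc i ::ᵥ t) := fun i => rfl
  have hyr : y = rc (σ (x 0)) := hy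
  clear hy
  clear_value rc
  have z0 := h0 k (by omega)
  have z1 := h0 (k + 1) (by omega)
  have z2 := h0 (k + 2) (by omega)
  have z3 := h0 (k + 3) (by omega)
  have hx0 := hx 0
  let F : ℕ → ℕ → ℕ := fun i => Function.update (Function.update (Function.update σ k (σ (x 0) - i))
    (k + 1) i) (k + 2) (rc i)
  have s1 := cpy_run (a := x 0) (b := k) (t := k + 1) (by omega) (by omega) (by omega) σ z1 γ
  have s2 := hQ (Function.update σ k (σ k + σ (x 0))) γ (f t)
    (fun r hr => by have := h0 r; simp only [Function.update_apply]; grind)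
    (by simp only [Function.update_apply]; grind)
    (by
      rw [Part.mem_some_iff]; congr 1; rw [ht]; congr 1; funext i
      have := hx i.succ
      simp only [Function.update_apply]; grind)
  have s2' : Run Q (Function.update σ k (σ k + σ (x 0))) γ (F 0) γ := s2.to (by
    funext r; simp only [F, Function.update_apply]; grind)
  have s3 := run_loop (r := k) (P := .seq (.dec k) (.seq R
    (.seq (clr (k + 2)) (.seq (cpy (k + 3) (k + 2) (k + 4)) (.seq (clr (k + 3)) (.inc (k + 1)))))))
    (σ (x 0)) F (fun _ => γ) (fun i hi => ⟨by
      simp only [F, Function.update_apply]; grind, by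
      have z4 := h0 (k + 4) (by omega)
      have r := hR (Function.update (F i) k (F i k - 1)) γ (rc (i + 1))
        (fun r hr => by have := h0 r; simp only [F, Function.update_apply]; grind)
        (by simp only [F, Function.update_apply]; grind)
        (by
          rw [Part.mem_some_iff]
          rw [rcS]
          congr 1
          ext j
          rw [List.Vector.get_ofFn]
          refine Fin.cases ?_ (Fin.cases ?_ fun j => ?_) j
          · simp [F, Function.update_apply]
          · simp [F]
            rfl
          · have := hx j.succ
            simp only [Fin.cons_succ, List.Vector.get_cons_succ, ht, List.Vector.get_ofFn, F,
              Function.update_apply]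
            grind)
      refine (Run.dec.seq (r.seq ((clr_run _ _ _).seq ((cpy_run (by omega) (by omega) (by omega) _
        ?_ _).seq ((clr_run _ _ _).seq Run.inc))))).to ?_
      · simp only [F, Function.update_apply]; grind
      · funext r; simp only [F, Function.update_apply]; grind⟩)
    (by simp only [F, Function.update_apply]; grind)
  refine (s1.seq (s2'.seq (s3.seq ((cpy_run (by omega) (by omega) (by omega) _ ?_ _).seq
    ((clr_run _ _ _).seq (clr_run _ _ _)))))).to ?_
  · simp only [F, Function.update_apply]; grind
  · funext r; simp only [F, Function.update_apply]; grind

theorem cb_rfind {n : ℕ} {f : List.Vector ℕ (n + 1) → ℕ}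
    (hf : Cb G (fun v => Part.some (f v))) :
    Cb G (fun v : List.Vector ℕ n => Nat.rfind fun a => Part.some (decide (f (a ::ᵥ v) = 0))) := by
  intro k x o hx ho hxo
  obtain ⟨Q, hQ⟩ := hf (k + 2) (Fin.cons k x) (k + 1)
    (by
      refine Fin.cases ?_ fun i => ?_
      · simp
      · have := hx i; simp; omega)
    (by omega)
    (by
      refine Fin.cases ?_ fun i => ?_
      · simp
      · have := hx i; simp; omega)
  refine ⟨.seq Q (.seq (.loop (k + 1) (.seq (clr (k + 1)) (.seq (.inc k) Q)))
    (.seq (cpy k o (k + 1)) (clr k))), fun σ γ y h0 h1 hy => ?_⟩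
  set t : List.Vector ℕ n := List.Vector.ofFn fun i => σ (x i) with ht
  obtain ⟨hy0, hy1⟩ := Nat.mem_rfind.1 hy
  have z0 := h0 k (by omega)
  have z1 := h0 (k + 1) (by omega)
  let F : ℕ → ℕ → ℕ := fun i => Function.update (Function.update σ k i) (k + 1) (f (i ::ᵥ t))
  have hq : ∀ i, Run Q (Function.update σ k i) γ (F i) γ := by
    intro i
    refine hQ (Function.update σ k i) γ (f (i ::ᵥ t))
      (fun r hr => by have := h0 r; simp only [Function.update_apply]; grind)
      (by simp only [Function.update_apply]; grind) ?_
    rw [Part.mem_some_iff]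
    congr 1
    ext j
    rw [List.Vector.get_ofFn]
    refine Fin.cases ?_ (fun j => ?_) j
    · simp
    · have := hx j
      simp only [Fin.cons_succ, List.Vector.get_cons_succ, ht, List.Vector.get_ofFn,
        Function.update_apply]
      grind
  have s3 := run_loop (r := k + 1) (P := .seq (clr (k + 1)) (.seq (.inc k) Q)) y F (fun _ => γ)
    (fun i hi => ⟨by
      have := hy1 hi
      simp at this
      simpa [F] using this, by
      refine (clr_run _ _ _).seq (Run.seq Run.inc ?_)
      convert hq (i + 1) using 1
      funext r; simp only [F, Function.update_apply]; grind⟩)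
    (by simp at hy0; simpa [F] using hy0)
  have hy0' : f (y ::ᵥ t) = 0 := by simpa using hy0
  have e0 : Function.update σ k 0 = σ := by rw [← z0]; simp
  have s1 := hq 0
  rw [e0] at s1
  refine (s1.seq (s3.seq ((cpy_run (by omega) (by omega) (by omega) _ ?_ _).seq
    (clr_run _ _ _)))).to ?_
  · simp only [F, Function.update_apply]; grind
  · funext r; simp only [F, Function.update_apply]; grind

theorem cb_prim {n : ℕ} {f : List.Vector ℕ n → ℕ} (h : Nat.Primrec' f) :
    Cb G (fun v => Part.some (f v)) := by
  induction h with
  | zero => exact cb_zero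
  | succ => exact cb_succ
  | get i => exact cb_get i
  | comp g _ _ ih ih' =>
    refine cb_comp ih ih' fun v y hy => ⟨fun i => g i v, fun i => Part.mem_some _, hy⟩
  | prec _ _ ih ih' => exact cb_prec ih ih'

theorem mem_mOfFn' {n : ℕ} (f : Fin n → Part ℕ) (w : List.Vector ℕ n)
    (h : w ∈ List.Vector.mOfFn f) (i : Fin n) : w.get i ∈ f i := by
  induction n with
  | zero => exact i.elim0
  | succ n ih =>
    simp only [List.Vector.mOfFn, Part.bind_eq_bind, Part.mem_bind_iff, Part.pure_eq_some,
      Part.mem_some_iff] at h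
    obtain ⟨a, ha, v, hv, rfl⟩ := h
    refine Fin.cases ?_ (fun j => ?_) i
    · simpa using ha
    · simpa [List.Vector.get_cons_succ] using ih _ v hv j

theorem cb_part {n : ℕ} {f : List.Vector ℕ n →. ℕ} (h : Nat.Partrec' f) : Cb G f := by
  induction h with
  | prim h => exact cb_prim h
  | comp g _ _ ih ih' =>
    refine cb_comp ih ih' fun v y hy => ?_
    obtain ⟨w, hw, hy⟩ := Part.mem_bind_iff.1 hy
    refine ⟨w.get, fun i => ?_, by simpa using hy⟩
    exact mem_mOfFn' _ _ hw i
  | rfind _ ih => exact cb_rfind ih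

/-- computable functions are compilable -/
theorem cb_fun {ψ : ℕ → ℕ} (h : Computable ψ) (k x o : ℕ) (hx : x < k) (ho : o < k) (hxo : x ≠ o) :
    ∃ P : Pg G, ∀ (σ : ℕ → ℕ) (g : G), (∀ r, k ≤ r → σ r = 0) → σ o = 0 →
      Run P σ g (Function.update σ o (ψ (σ x))) g := by
  have h' : Nat.Partrec' (n := 1) fun v => (ψ : ℕ →. ℕ) v.head := Nat.Partrec'.part_iff₁.2 h
  obtain ⟨P, hP⟩ := cb_part (G := G) h' k (fun _ => x) o (fun _ => hx) ho (fun _ => hxo)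
  refine ⟨P, fun σ g h0 h1 => hP σ g _ h0 h1 ?_⟩
  simp

end comp
end FH


namespace FH
set_option linter.unusedSectionVars false

section last
variable {G : Type*} [Group G] {m : ℕ} (gen : Fin m → G)

/-- value of a letter -/
def lv (l : Fin m × Bool) : G := if l.2 then gen l.1 else (gen l.1)⁻¹

theorem evalWord_snoc (w : List (Fin m × Bool)) (l) :
    evalWord gen (w ++ [l]) = evalWord gen w * lv gen l := by
  simp [evalWord, lv]

theorem dig_surj {v : ℕ} (h : v < 2 * m) : ∃ l : Fin m × Bool, dig l = v := by
  refine ⟨(⟨v / 2, by omega⟩, decide (v % 2 = 1)), ?_⟩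
  simp only [dig, decide_eq_true_eq]
  split_ifs <;> omega

theorem wordCode_surj (hm : 0 < m) (N : ℕ) : ∃ w : List (Fin m × Bool), wordCode w = N := by
  induction N using Nat.strong_induction_on with
  | _ N ih =>
    rcases Nat.eq_zero_or_pos N with rfl | h
    · exact ⟨[], rfl⟩
    obtain ⟨w, hw⟩ := ih ((N - 1) / (2 * m)) (lt_of_le_of_lt (Nat.div_le_self _ _) (by omega))
    obtain ⟨l, hl⟩ := dig_surj (Nat.mod_lt (N - 1) (show 0 < 2 * m by omega))
    refine ⟨w ++ [l], ?_⟩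
    rw [wordCode_snoc, hw, hl]
    have := Nat.div_add_mod' (N - 1) (2 * m)
    omega

theorem flag_comp (v : ℕ) : Computable fun N : ℕ => if (N - 1) % (2 * m) = v then 1 else 0 := by
  refine Primrec.to_comp (Primrec.ite ?_ (Primrec.const 1) (Primrec.const 0))
  exact Primrec.eq.comp (Primrec.nat_mod.comp (Primrec.pred) (Primrec.const _)) (Primrec.const _)

theorem next_comp : Computable fun N : ℕ => (N - 1) / (2 * m) :=
  (Primrec.nat_div.comp Primrec.pred (Primrec.const _)).to_comp

theorem digit_prog (j : ℕ) (hj : j ≤ 2 * m) : ∃ P : Pg G, ∀ (σ : ℕ → ℕ) (g : G) (l : Fin m × Bool),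
    (∀ r, 2 ≤ r → σ r = 0) → (σ 1 - 1) % (2 * m) = dig l →
    Run P σ g σ (g * if dig l < j then (lv gen l)⁻¹ else 1) := by
  induction j with
  | zero =>
    refine ⟨.out 1, fun σ g l _ _ => ?_⟩
    simpa using Run.out (s := (1 : G)) (σ := σ) (g := g)
  | succ j ih =>
    obtain ⟨P, hP⟩ := ih (by omega)
    obtain ⟨l', hl'⟩ := dig_surj (m := m) (v := j) (by omega)
    obtain ⟨Q, hQ⟩ := cb_fun (G := G) (flag_comp (m := m) j) 3 1 2 (by omega) (by omega) (by omega)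
    refine ⟨.seq P (.seq Q (.loop 2 (.seq (.dec 2) (.out (lv gen l')⁻¹)))),
      fun σ g l h0 hl => ?_⟩
    have z2 := h0 2 le_rfl
    have e0 : Function.update σ 2 0 = σ := by rw [← z2]; simp
    have s1 := hP σ g l h0 hl
    have s2 := hQ σ (g * if dig l < j then (lv gen l)⁻¹ else 1) (fun r hr => h0 r (by omega)) z2
    refine s1.seq (s2.seq ?_)
    simp only [hl]
    by_cases h : dig l = j
    · have : l' = l := dig_inj (hl'.trans h.symm)
      subst this
      rw [if_pos h, if_neg (by omega), if_pos (by omega), mul_one]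
      refine Run.loopS (by simp) (Run.seq Run.dec Run.out) ?_
      simp only [Function.update_self, tsub_self, Function.update_idem, e0]
      exact Run.loop0 z2
    · rw [if_neg h, e0]
      have : (dig l < j + 1) ↔ (dig l < j) := by omega
      simp only [this]
      exact Run.loop0 z2

theorem word_prog : ∃ P : Pg G, ∀ (w : List (Fin m × Bool)) (σ : ℕ → ℕ) (g : G),
    (∀ r, 2 ≤ r → σ r = 0) → σ 1 = wordCode w →
    Run P σ g (Function.update σ 1 0) (g * (evalWord gen w)⁻¹) := by
  obtain ⟨D, hD⟩ := digit_prog gen (2 * m) le_rfl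
  obtain ⟨Q, hQ⟩ := cb_fun (G := G) (next_comp (m := m)) 3 1 2 (by omega) (by omega) (by omega)
  refine ⟨.loop 1 (.seq D (.seq Q (.seq (clr 1) (.seq (cpy 2 1 3) (clr 2))))), fun w => ?_⟩
  induction w using List.reverseRecOn with
  | nil =>
    intro σ g h0 h1
    rw [wordCode_nil] at h1
    have e0 : Function.update σ 1 0 = σ := by rw [← h1]; simp
    rw [e0]
    simpa [evalWord] using Run.loop0 h1
  | append_singleton w l ih =>
    intro σ g h0 h1
    rw [wordCode_snoc] at h1
    have hl := dig_lt l
    have e1 : (σ 1 - 1) % (2 * m) = dig l := by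
      rw [h1, ← add_assoc, Nat.add_sub_cancel, Nat.mul_add_mod', Nat.mod_eq_of_lt hl]
    have e2 : (σ 1 - 1) / (2 * m) = wordCode w := by
      rw [h1, ← add_assoc, Nat.add_sub_cancel, mul_comm,
        Nat.mul_add_div (by omega), Nat.div_eq_of_lt hl, add_zero]
    have z2 := h0 2 le_rfl
    have z3 := h0 3 (by omega)
    have s1 := hD σ g l h0 e1
    rw [if_pos hl] at s1
    have s2 := hQ σ (g * (lv gen l)⁻¹) (fun r hr => h0 r (by omega)) z2
    rw [e2] at s2
    have s3 := ih (Function.update σ 1 (wordCode w)) (g * (lv gen l)⁻¹)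
      (fun r hr => by have := h0 r hr; simp only [Function.update_apply]; grind) (by simp)
    refine Run.loopS (by omega) ((s1.seq (s2.seq ((clr_run _ _ _).seq ((cpy_run (by omega)
      (by omega) (by omega) _ ?_ _).seq (clr_run _ _ _)))))) ?_
    · simp only [Function.update_apply]; grind
    · rw [evalWord_snoc, mul_inv_rev, ← mul_assoc]
      convert s3 using 1
      · funext r; simp only [Function.update_apply]; grind
      · simp

theorem four_heads (hm : 0 < m) {ψ : ℕ → ℕ} (h : Computable ψ) :
    ∃ aut : GWA (HZ G) 2 4, ∀ p, (xP G (2 ^ p) ∉ autSet aut ↔ ψ p ∉ WordProblem gen) := by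
  obtain ⟨W, hW⟩ := word_prog gen
  obtain ⟨Q, hQ⟩ := cb_fun (G := G) h 2 0 1 (by omega) (by omega) (by omega)
  obtain ⟨aut, ha⟩ := prog_aut (.seq Q W)
  refine ⟨aut, fun p => ?_⟩
  obtain ⟨w, hw⟩ := wordCode_surj hm (ψ p)
  have s1 := hQ (Function.update (fun _ => 0) 0 p) 1
    (fun r hr => by simp only [Function.update_apply]; grind) (by simp)
  have s2 := hW w _ 1 (fun r hr => by simp only [Function.update_apply]; grind)
    (show Function.update (Function.update (fun _ => 0) 0 p) 1
      (ψ ((Function.update (fun _ => 0) 0 p : ℕ → ℕ) 0)) 1 = _ by simp [hw])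
  rw [ha p _ _ (s1.seq s2), ← hw, mem_wp]
  simp

end last
end FH

/-- If `G` is a finitely generated torsion group whose word problem is
`(ζ∘ζ∘T∘ζ∘T∘ζ)`-impredictable for a total computable superexponential `ζ`, where
`T(n) = max(n, T_G(n))`, then `S(G × ℤ, 3) ⊊ S(G × ℤ, 4)`. -/
theorem four_heads_of_impredictable {G : Type*} [Group G] {mG : ℕ}
    (genG : Fin mG → G)
    (hG : Subgroup.closure (Set.range genG) = ⊤)
    (htG : ∀ g : G, IsOfFinOrder g)
    (ζ : ℕ → ℕ) (hζc : Computable ζ)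
    (hζ : ∀ c : ℝ, 1 < c → ∃ N : ℕ, ∀ n ≥ N, c ^ n ≤ (ζ n : ℝ))
    (himp : Impredictable
      (fun n => ζ (ζ (max (ζ (max (ζ n) (torsionFn genG (ζ n))))
        (torsionFn genG (ζ (max (ζ n) (torsionFn genG (ζ n))))))))
      (WordProblem genG)) :
    headsLT (G × Multiplicative ℤ) 3 4 := by
  obtain ⟨ψ, hψ, hi⟩ := himp
  rcases Nat.eq_zero_or_pos mG with rfl | hm
  · exfalso
    have hc : Computable fun p : ℕ × List Bool => decide (ψ p.1 = 0) :=
      ((Primrec.eq.comp Primrec.id (Primrec.const 0)).decide.to_comp).comp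
        (hψ.comp Computable.fst)
    have hχ : Partrec fun p : ℕ × List Bool =>
        (bif decide (ψ p.1 = 0) then Part.none else Part.some 0 : Part ℕ) :=
      Partrec.cond hc Partrec.none (Computable.const 0)
    obtain ⟨p, -, hp⟩ := hi _ hχ 0
    have e : ψ p ∈ WordProblem genG ↔ ψ p = 0 := by
      constructor
      · rintro ⟨w, hw, -⟩
        rw [← hw]
        cases w with
        | nil => rfl
        | cons l _ => exact l.1.elim0
      · intro h
        exact ⟨[], h.symm, rfl⟩
    rw [e] at hp
    by_cases h : ψ p = 0
    · simp [h] at hp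
    · simp [h] at hp
  refine ⟨fun s X h => FH.incl _ 3 s X h, ?_⟩
  obtain ⟨aut4, h4⟩ := FH.four_heads genG hm hψ
  refine ⟨2, autSet aut4, ⟨aut4, rfl⟩, ?_⟩
  rintro ⟨aut3, h3⟩
  obtain ⟨χ, hχ, q, μ, δ, h⟩ := FH.three_heads hG htG aut3
  obtain ⟨N, hN⟩ := FH.bounds hG ζ hζ q μ δ
  obtain ⟨p, hp, hpp⟩ := hi χ hχ N
  rw [h p _ (hN p hp), ← h3, h4 p] at hpp
  tauto
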